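/- Assume Q is the identity matrix. Then for every i ∈ {1,…,N} and every nonzero v_0 ∈ sing M[m] there exist vectors v_1,…,v_{m_i+N−i} ∈ sing M[m] such that the polynomial function v_0 u^{m_i+N−i} + v_1 u^{m_i+N−i−1} + … + v_{m_i+N−i} lies in the kernel of D_{Q=1,M}(u,τ) restricted to sing M[m]-valued functions. Moreover, polynomials of this form generate the kernel: there exist N·dim(sing M[m]) such polynomial solutions which are linearly independent over the field of one-periodic meromorphic functions on ℂ. -/

import Mathlib

noncomputable section

namespace XXXModel

/-- A vector-valued quasi-exponential: a finite sum of functions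
`Q₀^u p(u) = e^{(ln Q₀) u} p(u)` with `Q₀` a nonzero complex number with a fixed choice of
logarithm and `p` a vector-valued polynomial. -/
def IsQE {M : Type*} [AddCommGroup M] [Module ℂ M] (f : ℂ → M) : Prop :=
  ∃ (k d : ℕ) (lam : Fin k → ℂ) (v : Fin k → Fin d → M),
    ∀ u : ℂ, f u = ∑ i : Fin k, ∑ j : Fin d,
      (Complex.exp (lam i * u) * u ^ (j : ℕ)) • v i j

/-- `g` is meromorphic at the point `x`. -/
def MeromAt (g : ℂ → ℂ) (x : ℂ) : Prop :=
  ∃ k : ℕ, AnalyticAt ℂ (fun z => (z - x) ^ k * g z) x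

/-- Linear independence of a family of functions over the field of one-periodic
meromorphic functions on `ℂ`. -/
def IndepPeriodic {M : Type*} [AddCommGroup M] [Module ℂ M] {ι : Type*} [Fintype ι]
    (F : ι → ℂ → M) : Prop :=
  ∀ c : ι → ℂ → ℂ,
    (∀ i x, MeromAt (c i) x) →
    (∀ i x, c i (x + 1) = c i x) →
    (∀ x : ℂ, (∀ i, AnalyticAt ℂ (c i) x) → ∑ i, c i x • F i x = 0) →
    ∀ i x, AnalyticAt ℂ (c i) x → c i x = 0

variable {N n : ℕ}

/-- Points where the universal difference operator (of order `N`) associated with the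
evaluation points `z` is regular. -/
def Good (N : ℕ) {n : ℕ} (z : Fin n → ℂ) (u : ℂ) : Prop :=
  ∀ j : Fin n, ∀ k : ℕ, k < N → u - (k : ℂ) ≠ z j

section Setup

variable (V : Fin n → Type*) [∀ i, AddCommGroup (V i)] [∀ i, Module ℂ (V i)]
  (M : Type*) [AddCommGroup M] [Module ℂ M]
  (E : ∀ i : Fin n, Fin N → Fin N → (V i →ₗ[ℂ] V i))
  (φ : M ≃ₗ[ℂ] PiTensorProduct ℂ V)

/-- The commutation relations of `gl_N`: `[e_{ab}, e_{cd}] = δ_{bc} e_{ad} − δ_{da} e_{cb}`,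
for the operators `E i a b` (the action of `e_{ab}` on the `i`-th factor `V i`). -/
def GlRel : Prop :=
  ∀ (i : Fin n) (a b c d : Fin N),
    E i a b ∘ₗ E i c d - E i c d ∘ₗ E i a b =
      (if b = c then (1 : ℂ) else 0) • E i a d - (if d = a then (1 : ℂ) else 0) • E i c b

/-- Each `V i` is the irreducible finite-dimensional `gl_N`-module with highest weight
`Λ i`: it is generated by a nonzero vector `v` with `e_{ab} v = 0` for `a < b` and
`e_{aa} v = Λ_a v`. -/
def IsHW (Λ : Fin n → Fin N → ℤ) : Prop :=
  ∀ i : Fin n, ∃ v : V i, v ≠ 0 ∧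
    (∀ a b : Fin N, a < b → E i a b v = 0) ∧
    (∀ a : Fin N, E i a a v = (Λ i a : ℂ) • v) ∧
    ∀ W : Submodule ℂ (V i), (∀ a b : Fin N, ∀ x ∈ W, E i a b x ∈ W) → v ∈ W →
      ∀ x : V i, x ∈ W

/-- `e_{ab}` acting in the `j`-th tensor factor of `M ≃ V 1 ⊗ ⋯ ⊗ V n`. -/
def EE (j : Fin n) (a b : Fin N) : Module.End ℂ M :=
  φ.symm.toLinearMap ∘ₗ
    (PiTensorProduct.map
      (Function.update (fun i : Fin n => (LinearMap.id : V i →ₗ[ℂ] V i)) j (E j a b))) ∘ₗ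
    φ.toLinearMap

variable (z : Fin n → ℂ)

/-- The matrix `L^{(j)}(u - z_j)`, with entries `L_{ab} = δ_{ab} + e_{ba}^{(j)}/(u - z_j)`. -/
def Lmat (j : Fin n) (u : ℂ) : Matrix (Fin N) (Fin N) (Module.End ℂ M) :=
  fun a b => (if a = b then 1 else 0) + (u - z j)⁻¹ • EE V M E φ j b a

/-- The Yangian generating series acting on the tensor product of evaluation modules:
`T(u) = L^{(n)}(u−z_n) ⋯ L^{(1)}(u−z_1)`. -/
def Tmat (u : ℂ) : Matrix (Fin N) (Fin N) (Module.End ℂ M) :=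
  ((List.ofFn fun j : Fin n => Lmat V M E φ z j u).reverse).prod

variable (Q : Matrix (Fin N) (Fin N) ℂ)

/-- `X_{ab}(u,τ) = δ_{ab} − ∑_c Q_{ac} T_{cb}(u) τ^{−1}`, acting on `M`-valued functions. -/
def Xop (a b : Fin N) (f : ℂ → M) : ℂ → M :=
  fun u => (if a = b then f u else 0)
    - ∑ c : Fin N, Q a c • (Tmat V M E φ z u c b) (f (u - 1))

/-- The universal difference operator
`D_{Q,M}(u,τ) = ∑_{σ ∈ S_N} sgn(σ) X_{1σ(1)}(u,τ) ⋯ X_{Nσ(N)}(u,τ)`. -/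
def Dop (f : ℂ → M) : ℂ → M :=
  fun u => ∑ σ : Equiv.Perm (Fin N),
    ((Equiv.Perm.sign σ : ℤˣ) : ℤ) •
      (((List.ofFn fun a : Fin N => Xop V M E φ z Q a (σ a)).foldr (· ∘ ·) id) f u)

/-- The weight subspace `M[m]`. -/
def Wt (m : Fin N → ℤ) : Submodule ℂ M :=
  ⨅ a : Fin N, LinearMap.ker
    ((∑ j : Fin n, EE V M E φ j a a) - (m a : ℂ) • (1 : Module.End ℂ M))

/-- The subspace `sing M[m]` of `gl_N`-singular vectors of weight `m`. -/
def SingWt (m : Fin N → ℤ) : Submodule ℂ M :=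
  Wt V M E φ m ⊓ ⨅ a : Fin N, ⨅ b : Fin N, ⨅ _ : a < b,
    LinearMap.ker (∑ j : Fin n, EE V M E φ j a b)

end Setup

end XXXModel



namespace XXXAux
open Finset

section Fermi
variable {N : ℕ} {X Y : Type*} [AddCommGroup X] [Module ℂ X] [AddCommGroup Y] [Module ℂ Y]

/-- Fermionic sign. -/
def sg (a : Fin N) (I : Finset (Fin N)) : ℂ := (-1) ^ (#(I.filter (· < a)))

lemma sg_mul_self (a : Fin N) (I : Finset (Fin N)) : sg a I * sg a I = 1 := by
  unfold sg; rw [← pow_add, ← two_mul, pow_mul]; simp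

lemma sg_erase_self (a : Fin N) (I : Finset (Fin N)) : sg a (I.erase a) = sg a I := by
  unfold sg; congr 2; ext x; simp; intro h _; exact h.ne

lemma sg_insert_self (a : Fin N) (I : Finset (Fin N)) : sg a (insert a I) = sg a I := by
  unfold sg; congr 2; ext x; simp; intro h h'; exact absurd h' h.ne

lemma sg_insert (a b : Fin N) (I : Finset (Fin N)) (hb : b ∉ I) :
    sg a (insert b I) = (if b < a then -1 else 1) * sg a I := by
  unfold sg; rw [filter_insert]; split_ifs with h
  · rw [card_insert_of_notMem (by simp [hb])]; rw [pow_succ]; ring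
  · simp

lemma sg_erase (a b : Fin N) (I : Finset (Fin N)) (hb : b ∈ I) :
    sg a (I.erase b) = (if b < a then -1 else 1) * sg a I := by
  conv_rhs => rw [← insert_erase hb]
  rw [sg_insert a b _ (by simp), ← mul_assoc]; split_ifs <;> simp

/-- creation -/
def psi (a : Fin N) : (Finset (Fin N) → X) →ₗ[ℂ] (Finset (Fin N) → X) where
  toFun F I := if a ∈ I then sg a I • F (I.erase a) else 0
  map_add' F G := by ext I; simp only [Pi.add_apply]; split_ifs <;> simp
  map_smul' c F := by ext I; simp only [Pi.smul_apply, RingHom.id_apply]; split_ifs <;> simp [smul_comm c]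

/-- annihilation -/
def psis (a : Fin N) : (Finset (Fin N) → X) →ₗ[ℂ] (Finset (Fin N) → X) where
  toFun F I := if a ∈ I then 0 else sg a I • F (insert a I)
  map_add' F G := by ext I; simp only [Pi.add_apply]; split_ifs <;> simp
  map_smul' c F := by ext I; simp only [Pi.smul_apply, RingHom.id_apply]; split_ifs <;> simp [smul_comm c]

lemma psi_apply (a : Fin N) (F : Finset (Fin N) → X) (I) :
    psi a F I = if a ∈ I then sg a I • F (I.erase a) else 0 := rfl
lemma psis_apply (a : Fin N) (F : Finset (Fin N) → X) (I) :
    psis a F I = if a ∈ I then 0 else sg a I • F (insert a I) := rfl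

lemma psi_psi (a b : Fin N) (F : Finset (Fin N) → X) : psi a (psi b F) = - psi b (psi a F) := by
  ext I
  simp only [psi_apply, Pi.neg_apply, mem_erase]
  by_cases hab : a = b
  · subst hab; simp
  by_cases ha : a ∈ I <;> by_cases hb : b ∈ I <;> simp [ha, hb, hab, Ne.symm hab]
  rw [smul_smul, smul_smul, sg_erase b a I ha, sg_erase a b I hb, erase_right_comm,
    ← neg_smul]
  congr 1
  rcases lt_or_gt_of_ne hab with h | h
  · simp [h, h.not_gt]; ring
  · simp [h, h.not_gt]; ring

lemma psis_psi (a b : Fin N) (F : Finset (Fin N) → X) :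
    psis a (psi b F) = (if a = b then F else 0) - psi b (psis a F) := by
  ext I
  by_cases hab : a = b
  · subst hab
    simp only [psi_apply, psis_apply, Pi.sub_apply, if_true]
    by_cases ha : a ∈ I
    · simp [ha, smul_smul, sg_erase_self, sg_mul_self]
    · simp [ha, smul_smul, sg_insert_self, sg_mul_self]
  · simp only [psi_apply, psis_apply, Pi.sub_apply, if_neg hab, Pi.zero_apply, mem_insert, mem_erase]
    by_cases ha : a ∈ I <;> by_cases hb : b ∈ I <;> simp [ha, hb, hab, Ne.symm hab]
    rw [smul_smul, smul_smul, sg_insert b a I ha, sg_erase a b I hb, ← neg_smul]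
    have : (insert a I).erase b = insert a (I.erase b) := by
      rw [erase_insert_of_ne hab]
    rw [this]
    congr 1
    rcases lt_or_gt_of_ne hab with h | h
    · simp [h, h.not_gt]; ring
    · simp [h, h.not_gt]; ring

lemma psis_psis (a b : Fin N) (F : Finset (Fin N) → X) :
    psis a (psis b F) = - psis b (psis a F) := by
  ext I
  simp only [psis_apply, Pi.neg_apply, mem_insert]
  by_cases hab : a = b
  · subst hab; simp
  by_cases ha : a ∈ I <;> by_cases hb : b ∈ I <;> simp [ha, hb, hab, Ne.symm hab]
  rw [smul_smul, smul_smul, sg_insert b a I ha, sg_insert a b I hb, Finset.insert_comm,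
    ← neg_smul]
  congr 1
  rcases lt_or_gt_of_ne hab with h | h
  · simp [h, h.not_gt]; ring
  · simp [h, h.not_gt]; ring

/-- pointwise action -/
abbrev pw (f : X →ₗ[ℂ] Y) : (Finset (Fin N) → X) →ₗ[ℂ] (Finset (Fin N) → Y) :=
  f.compLeft (Finset (Fin N))

lemma pw_apply (f : X →ₗ[ℂ] Y) (F : Finset (Fin N) → X) (I) : pw f F I = f (F I) := rfl

lemma pw_psi (f : X →ₗ[ℂ] Y) (a : Fin N) (F : Finset (Fin N) → X) :
    pw f (psi a F) = psi a (pw f F) := by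
  ext I; simp only [pw_apply, psi_apply]; split_ifs <;> simp

lemma pw_psis (f : X →ₗ[ℂ] Y) (a : Fin N) (F : Finset (Fin N) → X) :
    pw f (psis a F) = psis a (pw f F) := by
  ext I; simp only [pw_apply, psis_apply]; split_ifs <;> simp

/-- number operator -/
lemma npsi_apply (F : Finset (Fin N) → X) (I) :
    (∑ a, psi a (psis a F)) I = (#I : ℂ) • F I := by
  rw [Finset.sum_apply]
  have : ∀ a, psi a (psis a F) I = if a ∈ I then F I else 0 := by
    intro a
    simp only [psi_apply, psis_apply]
    by_cases h : a ∈ I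
    · simp [h, smul_smul, sg_erase_self, sg_mul_self]
    · simp [h]
  simp only [this]
  rw [Finset.sum_ite_mem, univ_inter, sum_const, Nat.cast_smul_eq_nsmul]

lemma psis_vac (a : Fin N) (r : X) : psis a (Pi.single (∅ : Finset (Fin N)) r) = 0 := by
  ext I; simp only [psis_apply, Pi.zero_apply]
  split_ifs
  · rfl
  · rw [Pi.single_eq_of_ne (by simp)]; simp

lemma psi_single (a : Fin N) (I : Finset (Fin N)) (r : X) :
    psi a (Pi.single I r) = if a ∈ I then 0 else sg a I • Pi.single (insert a I) r := by
  ext J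
  simp only [psi_apply]
  by_cases ha : a ∈ I
  · rw [if_pos ha]
    have : J.erase a ≠ I := by rintro rfl; simp at ha
    simp [Pi.single_eq_of_ne this]
  · rw [if_neg ha, Pi.smul_apply]
    by_cases hJ : J = insert a I
    · subst hJ; simp [erase_insert ha, sg_insert_self]
    · rw [Pi.single_eq_of_ne hJ]
      split_ifs with h
      · have : J.erase a ≠ I := by rintro rfl; exact hJ (insert_erase h).symm
        simp [Pi.single_eq_of_ne this]
      · simp

lemma psis_single (a : Fin N) (I : Finset (Fin N)) (r : X) :
    psis a (Pi.single I r) = if a ∈ I then sg a I • Pi.single (I.erase a) r else 0 := by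
  ext J
  simp only [psis_apply]
  by_cases ha : a ∈ I
  · rw [if_pos ha, Pi.smul_apply]
    by_cases hJ : J = I.erase a
    · subst hJ; simp [insert_erase ha, sg_erase_self]
    · rw [Pi.single_eq_of_ne hJ]
      split_ifs with h
      · simp
      · have : insert a J ≠ I := by rintro rfl; exact hJ (erase_insert h).symm
        simp [Pi.single_eq_of_ne this]
  · rw [if_neg ha]
    have : insert a J ≠ I := by rintro rfl; simp at ha
    simp [Pi.single_eq_of_ne this]

end Fermi

section Bose
variable {N : ℕ} {X Y : Type*} [AddCommGroup X] [Module ℂ X] [AddCommGroup Y] [Module ℂ Y]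

/-- unit vector -/
abbrev eb (a : Fin N) : Fin N → ℕ := Pi.single a 1

/-- bosonic creation -/
def by' (a : Fin N) : ((Fin N → ℕ) → X) →ₗ[ℂ] ((Fin N → ℕ) → X) where
  toFun F k := (k a : ℂ) • F (k - eb a)
  map_add' F G := by ext; simp
  map_smul' c F := by ext; simp [smul_comm c]

/-- bosonic annihilation -/
def bd (a : Fin N) : ((Fin N → ℕ) → X) →ₗ[ℂ] ((Fin N → ℕ) → X) where
  toFun F k := F (k + eb a)
  map_add' F G := by ext; simp
  map_smul' c F := by ext; simp

lemma by_apply (a : Fin N) (F : (Fin N → ℕ) → X) (k) : by' a F k = (k a : ℂ) • F (k - eb a) := rfl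
lemma bd_apply (a : Fin N) (F : (Fin N → ℕ) → X) (k) : bd a F k = F (k + eb a) := rfl

lemma bd_by (a b : Fin N) (F : (Fin N → ℕ) → X) :
    bd a (by' b F) = (if a = b then F else 0) + by' b (bd a F) := by
  ext k
  simp only [by_apply, bd_apply, Pi.add_apply]
  by_cases hab : a = b
  · subst hab
    simp only [Pi.single_eq_same, add_tsub_cancel_right, if_true, Nat.cast_add, Nat.cast_one, add_smul, one_smul]
    rw [add_comm]
    congr 1
    by_cases h : k a = 0
    · simp [h]
    · congr 2
      ext c; by_cases hc : c = a
      · subst hc; simp; omega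
      · simp [hc]
  · rw [if_neg hab]
    simp only [Pi.zero_apply, zero_add, Pi.single_eq_of_ne (Ne.symm hab), add_zero]
    by_cases h : k b = 0
    · simp [h]
    · congr 2
      ext c; by_cases hc : c = a
      · subst hc; simp [hab]
      · simp [hc]

lemma by_by (a b : Fin N) (F : (Fin N → ℕ) → X) : by' a (by' b F) = by' b (by' a F) := by
  ext k; simp only [by_apply, smul_smul]
  by_cases hab : a = b
  · subst hab; rfl
  · rw [tsub_right_comm]; simp [hab, Ne.symm hab, mul_comm]

lemma bd_bd (a b : Fin N) (F : (Fin N → ℕ) → X) : bd a (bd b F) = bd b (bd a F) := by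
  ext k; simp only [bd_apply]; congr 1; exact add_right_comm _ _ _

/-- pointwise action -/
abbrev bpw (f : X →ₗ[ℂ] Y) : ((Fin N → ℕ) → X) →ₗ[ℂ] ((Fin N → ℕ) → Y) :=
  f.compLeft (Fin N → ℕ)

lemma bpw_apply (f : X →ₗ[ℂ] Y) (F : (Fin N → ℕ) → X) (I) : bpw f F I = f (F I) := rfl
lemma bpw_by (f : X →ₗ[ℂ] Y) (a : Fin N) (F : (Fin N → ℕ) → X) :
    bpw f (by' a F) = by' a (bpw f F) := by
  ext I; simp only [bpw_apply, by_apply]; simp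
lemma bpw_bd (f : X →ₗ[ℂ] Y) (a : Fin N) (F : (Fin N → ℕ) → X) :
    bpw f (bd a F) = bd a (bpw f F) := by
  ext I; simp only [bpw_apply, bd_apply]

lemma nbos_apply (F : (Fin N → ℕ) → X) (k) :
    (∑ a, by' a (bd a F)) k = ((∑ a, k a : ℕ) : ℂ) • F k := by
  rw [Finset.sum_apply, Nat.cast_sum, Finset.sum_smul]
  refine sum_congr rfl fun a _ => ?_
  simp only [by_apply, bd_apply]
  by_cases h : k a = 0
  · simp [h]
  · congr 2
    ext c; by_cases hc : c = a
    · subst hc; simp; omega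
    · simp [hc]

end Bose
end XXXAux

namespace XXXAux
open Finset

section Alg
variable {N : ℕ} {A : Type*} [Ring A] [Algebra ℂ A]

/-- fermionic relations -/
structure FRel (p s : Fin N → A) : Prop where
  pp : ∀ a b, p a * p b = - (p b * p a)
  sp : ∀ a b, s a * p b = (if a = b then 1 else 0) - p b * s a
  ss : ∀ a b, s a * s b = - (s b * s a)

/-- bosonic relations -/
structure BRel (y d : Fin N → A) : Prop where
  dy : ∀ a b, d a * y b = (if a = b then 1 else 0) + y b * d a
  dd : ∀ a b, d a * d b = d b * d a
  yy : ∀ a b, y a * y b = y b * y a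

/-- matrix unit relations -/
def URel (e : Fin N → Fin N → A) : Prop :=
  ∀ a b c d, e a b * e c d = if b = c then e a d else 0

/-- Casimir tensor -/
def Om (e : Fin N → Fin N → A) (p s : Fin N → A) : A := ∑ b, ∑ a, e b a * (p b * s a)

lemma Om_p {e : Fin N → Fin N → A} {p s : Fin N → A} (F : FRel p s)
    (hp : ∀ a b c, Commute (e a b) (p c)) (c : Fin N) :
    Om e p s * p c = ∑ b, e b c * p b + p c * Om e p s := by
  have key : ∀ b a, e b a * (p b * s a) * p c = (if a = c then e b a * p b else 0)
      + p c * (e b a * (p b * s a)) := by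
    intro b a
    have h1 : e b a * (p b * s a) * p c = e b a * (p b * (s a * p c)) := by noncomm_ring
    have h2 : p c * (e b a * (p b * s a)) = e b a * (p c * p b * s a) := by
      rw [← mul_assoc, ← (hp b a c).eq]; noncomm_ring
    rw [h1, h2, F.sp, F.pp c b]
    split_ifs <;> noncomm_ring
  simp only [Om, Finset.sum_mul, Finset.mul_sum, key, Finset.sum_add_distrib, Finset.sum_ite_eq',
    Finset.mem_univ, if_true]

lemma sum4 {f : Fin N → Fin N → A} {g : Fin N → Fin N → A} {h : Fin N → Fin N → Fin N → A}
    (H : ∀ b a b' a', f b a * g b' a' = if a = b' then h b a a' else 0) :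
    (∑ b, ∑ a, f b a) * (∑ b, ∑ a, g b a) = ∑ b, ∑ a', ∑ a, h b a a' := by
  calc _ = ∑ b, ∑ a, ∑ b', ∑ a', f b a * g b' a' := by
        simp only [Finset.sum_mul]
        refine sum_congr rfl fun b _ => sum_congr rfl fun a _ => ?_
        simp only [Finset.mul_sum]
    _ = ∑ b, ∑ a, ∑ a', h b a a' := by
        refine sum_congr rfl fun b _ => sum_congr rfl fun a _ => ?_
        rw [Finset.sum_comm]
        simp [H]
    _ = _ := by
        refine sum_congr rfl fun b _ => ?_
        rw [Finset.sum_comm]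

lemma e_p_Om {e : Fin N → Fin N → A} {p s : Fin N → A} (F : FRel p s) (U : URel e)
    (hp : ∀ a b c, Commute (e a b) (p c)) (a : Fin N) :
    (∑ b, e b a * p b) * Om e p s = - (p a * Om e p s) := by
  have key : ∀ b d c, e b a * p b * (e d c * (p d * s c)) = if a = d then
      - (p a * (e b c * (p b * s c))) else 0 := by
    intro b d c
    have h1 : e b a * p b * (e d c * (p d * s c)) = e b a * e d c * (p b * p d * s c) := by
      have := (hp d c b).eq
      calc _ = e b a * (p b * e d c) * (p d * s c) := by noncomm_ring
        _ = _ := by rw [← this]; noncomm_ring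
    rw [h1, U]
    split_ifs with h
    · subst h
      have h3 : p a * (e b c * (p b * s c)) = e b c * (p a * p b * s c) := by
        rw [← mul_assoc, ← (hp b c a).eq]; noncomm_ring
      rw [F.pp b a, h3]; noncomm_ring
    · simp
  have h2 : (∑ b, e b a * p b) * Om e p s = ∑ b, ∑ c, ∑ d, e b a * p b * (e d c * (p d * s c)) := by
    rw [Finset.sum_mul]
    refine sum_congr rfl fun b _ => ?_
    rw [Om, Finset.sum_comm]
    simp only [Finset.mul_sum]
  rw [h2]
  simp only [key, Finset.sum_ite_eq, Finset.mem_univ, if_true, Finset.sum_neg_distrib, Om, Finset.mul_sum]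

/-- the basic exchange relation -/
lemma claimA_single {e : Fin N → Fin N → A} {p s : Fin N → A} (F : FRel p s) (U : URel e)
    (hp : ∀ a b c, Commute (e a b) (p c)) (a : Fin N) (t t' : ℂ) (ht : t' - t * t' = t) :
    (∑ b, ((if a = b then 1 else 0) + t • e b a) * p b) * (1 + t' • Om e p s)
      = (1 + t • Om e p s) * p a := by
  have h1 : (∑ b, ((if a = b then 1 else 0) + t • e b a) * p b) = p a + t • ∑ b, e b a * p b := by
    simp [add_mul, Finset.sum_add_distrib, Finset.smul_sum]
  rw [h1, add_mul 1, one_mul, smul_mul_assoc, Om_p F hp, mul_add, mul_one, add_mul, smul_mul_assoc,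
    mul_smul_comm, mul_smul_comm, e_p_Om F U hp]
  have h5 : t' • (p a * Om e p s) + t • t' • -(p a * Om e p s) = t • (p a * Om e p s) := by
    conv_rhs => rw [← ht]
    module
  rw [smul_add, ← h5]; abel

lemma koszul_single {e : Fin N → Fin N → A} {p s y d : Fin N → A} (F : FRel p s) (B : BRel y d)
    (U : URel e)
    (hp : ∀ a b c, Commute (e a b) (p c)) (hs : ∀ a b c, Commute (e a b) (s c))
    (hy : ∀ a b c, Commute (e a b) (y c)) (hd : ∀ a b c, Commute (e a b) (d c))
    (py : ∀ a b, Commute (p a) (y b)) (pd : ∀ a b, Commute (p a) (d b))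
    (sy : ∀ a b, Commute (s a) (y b)) (sd : ∀ a b, Commute (s a) (d b)) (c : ℂ) :
    Commute ((algebraMap ℂ A c + (∑ a, p a * s a + ∑ a, y a * d a) + Om e p s) *
      (algebraMap ℂ A (c + 1) + Om e y d)) (∑ a, p a * d a) := by
  set n := ∑ a, p a * s a + ∑ a, y a * d a with hn
  set D := ∑ a, p a * d a with hD
  set K := ∑ b, ∑ a, e b a * (p b * d a) with hK
  -- relations
  have h1 : Om e p s * D = K + D * Om e p s := by
    rw [hD, Finset.mul_sum, Finset.sum_mul]
    have : ∀ a, Om e p s * (p a * d a) = ∑ b, e b a * (p b * d a) + p a * d a * Om e p s := by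
      intro a
      have hc : Commute (Om e p s) (d a) := by
        unfold Om
        refine Commute.sum_left _ _ _ fun i _ => Commute.sum_left _ _ _ fun j _ => ?_
        exact (hd _ _ _).mul_left ((pd _ _).mul_left (sd _ _))
      rw [← mul_assoc, Om_p F hp, add_mul, mul_assoc (p a), hc.eq, Finset.sum_mul]
      simp only [mul_assoc]
    simp only [this, Finset.sum_add_distrib]
    rw [Finset.sum_comm]
  have h2 : D * Om e y d = K + Om e y d * D := by
    have key : ∀ b a a', p a' * d a' * (e b a * (y b * d a)) =
        (if a' = b then e b a * (p b * d a) else 0) + e b a * (y b * d a) * (p a' * d a') := by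
      intro b a a'
      have e1 : p a' * d a' * (e b a * (y b * d a)) = e b a * p a' * (d a' * y b) * d a := by
        have hc : Commute (p a' * d a') (e b a) := ((hp _ _ _).symm.mul_left (hd _ _ _).symm)
        rw [← mul_assoc, hc.eq]; noncomm_ring
      have e2 : e b a * (y b * d a) * (p a' * d a') = e b a * p a' * (y b * d a') * d a := by
        have hc : Commute (y b * d a) (p a') := (py _ _).symm.mul_left (pd _ _).symm
        have : e b a * (y b * d a) * (p a' * d a') = e b a * ((y b * d a) * p a') * d a' := by
          noncomm_ring
        rw [this, hc.eq]
        have h3 := B.dd a a'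
        have : e b a * (p a' * (y b * d a)) * d a' = e b a * (p a' * (y b * (d a * d a'))) := by
          noncomm_ring
        rw [this, h3]; noncomm_ring
      rw [e1, e2, B.dy]
      split_ifs with h
      · subst h; noncomm_ring
      · noncomm_ring
    have e1 : D * Om e y d = ∑ b, ∑ a, ∑ a', p a' * d a' * (e b a * (y b * d a)) := by
      rw [Om, Finset.mul_sum]
      refine sum_congr rfl fun b _ => ?_
      rw [Finset.mul_sum]
      refine sum_congr rfl fun a _ => ?_
      rw [hD, Finset.sum_mul]
    rw [e1]
    simp only [key, Finset.sum_add_distrib, Finset.sum_ite_eq', Finset.mem_univ, if_true, hK]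
    congr 1
    rw [Om, Finset.sum_mul]
    refine sum_congr rfl fun b _ => ?_
    rw [Finset.sum_mul]
    refine sum_congr rfl fun a _ => ?_
    rw [hD, Finset.mul_sum]
  have h3 : Om e p s * K = ∑ b, ∑ a, e b a * (p b * ((N : A) - ∑ c, p c * s c) * d a) := by
    have key : ∀ b a b' a', e b a * (p b * s a) * (e b' a' * (p b' * d a')) =
        if a = b' then e b a' * (p b * (1 - p a * s a) * d a') else 0 := by
      intro b a b' a'
      have hc : Commute (p b * s a) (e b' a') := (hp _ _ _).symm.mul_left (hs _ _ _).symm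
      have e1 : e b a * (p b * s a) * (e b' a' * (p b' * d a')) =
        (e b a * e b' a') * (p b * (s a * p b') * d a') := by
        have : e b a * (p b * s a) * (e b' a' * (p b' * d a')) =
          e b a * ((p b * s a) * e b' a') * (p b' * d a') := by noncomm_ring
        rw [this, hc.eq]; noncomm_ring
      rw [e1, U]
      split_ifs with h
      · subst h; rw [F.sp, if_pos rfl]
      · simp
    have hNs : ((N : A) - ∑ c, p c * s c) = ∑ c, (1 - p c * s c) := by
      simp [Finset.sum_sub_distrib]
    rw [hNs, hK]
    rw [Om, sum4 key]
    refine sum_congr rfl fun b _ => sum_congr rfl fun a _ => ?_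
    simp only [Finset.mul_sum, Finset.sum_mul]
  have h4 : K * Om e y d = ∑ b, ∑ a, e b a * (p b * ((N : A) + ∑ c, y c * d c) * d a) := by
    have key : ∀ b a b' a', e b a * (p b * d a) * (e b' a' * (y b' * d a')) =
        if a = b' then e b a' * (p b * (1 + y a * d a) * d a') else 0 := by
      intro b a b' a'
      have hc : Commute (p b * d a) (e b' a') := (hp _ _ _).symm.mul_left (hd _ _ _).symm
      have e1 : e b a * (p b * d a) * (e b' a' * (y b' * d a')) =
        (e b a * e b' a') * (p b * (d a * y b') * d a') := by
        have : e b a * (p b * d a) * (e b' a' * (y b' * d a')) =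
          e b a * ((p b * d a) * e b' a') * (y b' * d a') := by noncomm_ring
        rw [this, hc.eq]; noncomm_ring
      rw [e1, U]
      split_ifs with h
      · subst h; rw [B.dy, if_pos rfl]
      · simp
    have hNs : ((N : A) + ∑ c, y c * d c) = ∑ c, (1 + y c * d c) := by
      simp [Finset.sum_add_distrib]
    rw [hNs, hK, Om, sum4 key]
    refine sum_congr rfl fun b _ => sum_congr rfl fun a _ => ?_
    simp only [Finset.mul_sum, Finset.sum_mul]
  have np : ∀ b, (∑ c, p c * s c) * p b = p b * (1 + ∑ c, p c * s c) := by
    intro b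
    have : ∀ c, p c * s c * p b = (if c = b then p c else 0) + p b * (p c * s c) := by
      intro c
      rw [mul_assoc, F.sp, ← mul_assoc (p b), F.pp b c]
      split_ifs <;> noncomm_ring
    simp [Finset.sum_mul, this, Finset.sum_add_distrib, mul_add, Finset.mul_sum]
  have h5 : n * K = ∑ b, ∑ a, e b a * (p b * (1 + ∑ c, p c * s c + ∑ c, y c * d c) * d a) := by
    have hne : ∀ b a, Commute n (e b a) := by
      intro b a
      refine Commute.add_left (Commute.sum_left _ _ _ fun c _ => ?_) (Commute.sum_left _ _ _ fun c _ => ?_)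
      · exact (hp _ _ _).symm.mul_left (hs _ _ _).symm
      · exact (hy _ _ _).symm.mul_left (hd _ _ _).symm
    have hyp : ∀ b, Commute (∑ c, y c * d c) (p b) := fun b =>
      Commute.sum_left _ _ _ fun c _ => (py _ _).symm.mul_left (pd _ _).symm
    rw [hK]
    simp only [Finset.mul_sum]
    refine sum_congr rfl fun b _ => sum_congr rfl fun a _ => ?_
    rw [← mul_assoc, (hne b a).eq, mul_assoc, ← mul_assoc n, hn, add_mul, np, (hyp b).eq, ← mul_add]
  have hAK : (algebraMap ℂ A c + n + Om e p s) * K = K * (algebraMap ℂ A (c + 1) + Om e y d) := by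
    rw [add_mul, add_mul, mul_add, h3, h4, h5, map_add, map_one, mul_add, mul_one,
      (Algebra.commutes c K), add_assoc, add_assoc (K * _)]
    congr 1
    rw [hK]
    simp only [← Finset.sum_add_distrib]
    refine sum_congr rfl fun b _ => sum_congr rfl fun a _ => ?_
    noncomm_ring
  have hnD : n * D = D * n := by
    have hy1 : ∀ a, d a * (∑ c, y c * d c) = (1 + ∑ c, y c * d c) * d a := by
      intro a
      have : ∀ c, d a * (y c * d c) = (if a = c then d c else 0) + y c * d c * d a := by
        intro c
        rw [← mul_assoc, B.dy, mul_assoc (y c), ← B.dd a c]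
        split_ifs <;> noncomm_ring
      simp [Finset.sum_mul, this, Finset.sum_add_distrib, add_mul, Finset.mul_sum]
    rw [hD, Finset.mul_sum, Finset.sum_mul]
    refine sum_congr rfl fun a _ => ?_
    have hyp : Commute (∑ c, y c * d c) (p a) :=
      Commute.sum_left _ _ _ fun c _ => (py _ _).symm.mul_left (pd _ _).symm
    have hsd : Commute (∑ c, p c * s c) (d a) :=
      Commute.sum_left _ _ _ fun c _ => (pd _ _).mul_left (sd _ _)
    calc n * (p a * d a) = ((∑ c, p c * s c) * p a) * d a + ((∑ c, y c * d c) * p a) * d a := by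
          rw [hn]; noncomm_ring
      _ = p a * d a + p a * ((∑ c, p c * s c) * d a) + p a * (∑ c, y c * d c) * d a := by
          rw [np, hyp.eq]; noncomm_ring
      _ = p a * (d a * (∑ c, p c * s c)) + p a * ((1 + ∑ c, y c * d c) * d a) := by
          rw [hsd.eq]; noncomm_ring
      _ = p a * d a * n := by rw [← hy1, hn]; noncomm_ring
  have hAD : (algebraMap ℂ A c + n + Om e p s) * D = D * (algebraMap ℂ A c + n + Om e p s) + K := by
    rw [add_mul, add_mul, mul_add, mul_add, h1, hnD, Algebra.commutes]; abel
  have hBD : D * (algebraMap ℂ A (c + 1) + Om e y d) = (algebraMap ℂ A (c + 1) + Om e y d) * D + K := by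
    rw [add_mul, mul_add, h2, Algebra.commutes]; abel
  show _ * _ = _ * _
  generalize algebraMap ℂ A c + n + Om e p s = P at *
  generalize algebraMap ℂ A (c + 1) + Om e y d = Q at *
  calc P * Q * D = P * (Q * D + K) - P * K := by noncomm_ring
    _ = (P * D) * Q - K * Q := by rw [← hBD, hAK]; noncomm_ring
    _ = D * (P * Q) := by rw [hAD]; noncomm_ring

lemma dd_delta {p s y d : Fin N → A} (F : FRel p s) (B : BRel y d)
    (py : ∀ a b, Commute (p a) (y b)) (pd : ∀ a b, Commute (p a) (d b))
    (sy : ∀ a b, Commute (s a) (y b)) (sd : ∀ a b, Commute (s a) (d b)) :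
    (∑ a, p a * d a) * (∑ a, y a * s a) + (∑ a, y a * s a) * (∑ a, p a * d a)
      = ∑ a, p a * s a + ∑ a, y a * d a := by
  rw [Finset.sum_mul_sum, Finset.sum_mul_sum, Finset.sum_comm (s := univ) (t := univ)
    (f := fun a b => y a * s a * (p b * d b))]
  simp only [← Finset.sum_add_distrib]
  refine sum_congr rfl fun a _ => ?_
  have : ∀ b, p a * d a * (y b * s b) + y b * s b * (p a * d a) =
      if a = b then p a * s a + y a * d a else 0 := by
    intro b
    have e1 : p a * d a * (y b * s b) = p a * s b * (if a = b then 1 else 0) + y b * (p a * s b) * d a := by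
      calc p a * d a * (y b * s b) = p a * (d a * y b) * s b := by noncomm_ring
        _ = p a * (if a = b then 1 else 0) * s b + (p a * y b) * (d a * s b) := by
          rw [B.dy]; noncomm_ring
        _ = _ := by
          rw [(py a b).eq, ← (sd b a).eq]; split_ifs <;> noncomm_ring
    have e2 : y b * s b * (p a * d a) = y b * (if b = a then 1 else 0) * d a - y b * (p a * s b) * d a := by
      calc _ = y b * (s b * p a) * d a := by noncomm_ring
        _ = _ := by rw [F.sp]; noncomm_ring
    rw [e1, e2]
    by_cases h : a = b
    · subst h; simp
    · simp [h, Ne.symm h]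
  simp [this]

lemma FRel.n_comm {p s : Fin N → A} (F : FRel p s) (b a : Fin N) :
    Commute (∑ c, p c * s c) (p b * s a) := by
  have np : (∑ c, p c * s c) * p b = p b * (1 + ∑ c, p c * s c) := by
    have : ∀ c, p c * s c * p b = (if c = b then p c else 0) + p b * (p c * s c) := by
      intro c
      rw [mul_assoc, F.sp, ← mul_assoc (p b), F.pp b c]
      split_ifs <;> noncomm_ring
    simp [Finset.sum_mul, this, Finset.sum_add_distrib, mul_add, Finset.mul_sum]
  have ns : s a * (∑ c, p c * s c) = (1 + ∑ c, p c * s c) * s a := by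
    have : ∀ c, s a * (p c * s c) = (if a = c then s c else 0) + p c * s c * s a := by
      intro c
      rw [← mul_assoc, F.sp, sub_mul, mul_assoc (p c) (s a), F.ss a c]
      split_ifs <;> noncomm_ring
    simp [Finset.sum_mul, this, Finset.sum_add_distrib, add_mul, Finset.mul_sum]
  show _ * _ = _ * _
  rw [mul_assoc (p b), ns, ← mul_assoc, np]; noncomm_ring

lemma BRel.n_comm {y d : Fin N → A} (F : BRel y d) (b a : Fin N) :
    Commute (∑ c, y c * d c) (y b * d a) := by
  have np : (∑ c, y c * d c) * y b = y b * (1 + ∑ c, y c * d c) := by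
    have : ∀ c, y c * d c * y b = (if c = b then y c else 0) + y b * (y c * d c) := by
      intro c
      rw [mul_assoc, F.dy, ← mul_assoc (y b), F.yy b c]
      split_ifs <;> noncomm_ring
    simp [Finset.sum_mul, this, Finset.sum_add_distrib, mul_add, Finset.mul_sum]
  have ns : d a * (∑ c, y c * d c) = (1 + ∑ c, y c * d c) * d a := by
    have : ∀ c, d a * (y c * d c) = (if a = c then d c else 0) + y c * d c * d a := by
      intro c
      rw [← mul_assoc, F.dy, add_mul, mul_assoc (y c) (d a), F.dd a c]
      split_ifs <;> noncomm_ring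
    simp [Finset.sum_mul, this, Finset.sum_add_distrib, add_mul, Finset.mul_sum]
  show _ * _ = _ * _
  rw [mul_assoc (y b), ns, ← mul_assoc, np]; noncomm_ring

/-- gl-invariance of the bosonic Casimir tensor -/
lemma e_sub_yd_comm {e : Fin N → Fin N → A} {y d : Fin N → A} (B : BRel y d) (U : URel e)
    (hy : ∀ a b c, Commute (e a b) (y c)) (hd : ∀ a b c, Commute (e a b) (d c)) (c f : Fin N) :
    Commute (e c f - y f * d c) (Om e y d) := by
  have h1 : e c f * Om e y d = ∑ a, e c a * (y f * d a) := by
    have U' := U; unfold URel at U'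
    simp only [Om, Finset.mul_sum, ← mul_assoc, U', ite_mul, zero_mul]
    rw [Finset.sum_comm]; simp
  have h2 : Om e y d * e c f = ∑ b, e b f * (y b * d c) := by
    have : ∀ b a, e b a * (y b * d a) * e c f = if a = c then e b f * (y b * d c) else 0 := by
      intro b a
      have hc : Commute (y b * d a) (e c f) := (hy _ _ _).symm.mul_left (hd _ _ _).symm
      rw [mul_assoc, hc.eq, ← mul_assoc, U]
      split_ifs with h
      · subst h; rfl
      · simp
    simp only [Om, Finset.sum_mul, this]; simp
  have key : ∀ b a, y f * d c * (e b a * (y b * d a)) = (if c = b then e b a * (y f * d a) else 0)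
      - (if a = f then e b a * (y b * d c) else 0) + e b a * (y b * d a) * (y f * d c) := by
    intro b a
    have hc : Commute (y f * d c) (e b a) := (hy _ _ _).symm.mul_left (hd _ _ _).symm
    have e1 : y f * d c * (e b a * (y b * d a)) = e b a * (y f * (d c * y b) * d a) := by
      rw [← mul_assoc, hc.eq]; noncomm_ring
    have e2 : e b a * (y b * d a) * (y f * d c) = e b a * (y b * (d a * y f) * d c) := by
      noncomm_ring
    rw [e1, e2, B.dy, B.dy]
    have e3 : y f * y b * (d c * d a) = y b * y f * (d a * d c) := by rw [B.yy, B.dd]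
    have e4 : e b a * (y f * (y b * d c) * d a) = e b a * (y b * (y f * d a) * d c) := by
      have : e b a * (y f * (y b * d c) * d a) = e b a * (y f * y b * (d c * d a)) := by noncomm_ring
      rw [this, e3]; noncomm_ring
    have e5 : ∀ P Q : A, e b a * (y f * (P + y b * d c) * d a) = e b a * (y f * P * d a) + e b a * (y f * (y b * d c) * d a) := by
      intro P Q; noncomm_ring
    rw [e5 _ 0, e4]
    split_ifs <;> noncomm_ring
  have h3 : y f * d c * Om e y d = ∑ a, e c a * (y f * d a) - ∑ b, e b f * (y b * d c) +
      Om e y d * (y f * d c) := by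
    simp only [Om, Finset.mul_sum, Finset.sum_mul, key, Finset.sum_add_distrib, Finset.sum_sub_distrib]
    congr 2
    · rw [Finset.sum_comm]; simp
    · simp
  show _ * _ = _ * _
  rw [sub_mul, mul_sub, h1, h2, h3]; abel

end Alg

/-- reversed product along a list -/
def cal {Q A : Type*} [Monoid A] (F : Q → A) : List Q → A
  | [] => 1
  | q :: qs => cal F qs * F q

lemma cal_comm {Q A : Type*} [Monoid A] {F : Q → A} {X : A} {qs : List Q}
    (h : ∀ q ∈ qs, Commute (F q) X) : Commute (cal F qs) X := by
  induction qs with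
  | nil => exact Commute.one_left _
  | cons q qs ih =>
    exact (ih fun q hq => h q (by simp [hq])).mul_left (h q (by simp))

lemma cal_mul {Q A : Type*} [Monoid A] {F G : Q → A} {qs : List Q} (hn : qs.Nodup)
    (h : ∀ q q', q ≠ q' → Commute (F q) (G q')) :
    cal (fun q => F q * G q) qs = cal F qs * cal G qs := by
  induction qs with
  | nil => simp [cal]
  | cons q qs ih =>
    rw [List.nodup_cons] at hn
    have hc : Commute (cal G qs) (F q) :=
      cal_comm fun q' hq' => (h q q' (by rintro rfl; exact hn.1 hq')).symm
    rw [cal, ih hn.2, cal, cal]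
    calc cal F qs * cal G qs * (F q * G q) = cal F qs * (cal G qs * F q) * G q := by
          simp only [mul_assoc]
      _ = _ := by rw [hc.eq]; simp only [mul_assoc]

lemma cal_map {Q A B : Type*} [Monoid A] [Monoid B] (f : A →* B) (F : Q → A) (qs : List Q) :
    f (cal F qs) = cal (fun q => f (F q)) qs := by
  induction qs with
  | nil => simp [cal]
  | cons q qs ih => simp [cal, ih]

end XXXAux

namespace XXXAux
open Finset

section Sp
variable {N : ℕ} {X R Q : Type*} [AddCommGroup X] [Module ℂ X] [AddCommGroup R] [Module ℂ R]

lemma frel : FRel (A := Module.End ℂ (Finset (Fin N) → X)) psi psis where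
  pp a b := LinearMap.ext fun F => psi_psi a b F
  ss a b := LinearMap.ext fun F => psis_psis a b F
  sp a b := by
    refine LinearMap.ext fun F => ?_
    simp only [Module.End.mul_apply, LinearMap.sub_apply, psis_psi]
    split_ifs <;> rfl

lemma brel : BRel (A := Module.End ℂ ((Fin N → ℕ) → X)) by' bd where
  dd a b := LinearMap.ext fun F => bd_bd a b F
  yy a b := LinearMap.ext fun F => by_by a b F
  dy a b := by
    refine LinearMap.ext fun F => ?_
    simp only [Module.End.mul_apply, LinearMap.add_apply, bd_by]
    split_ifs <;> rfl

/-- pointwise action as an algebra map -/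
def pwA : Module.End ℂ X →ₐ[ℂ] Module.End ℂ (Finset (Fin N) → X) where
  toFun f := pw f
  map_one' := rfl
  map_mul' _ _ := rfl
  map_zero' := rfl
  map_add' _ _ := rfl
  commutes' _ := rfl

/-- pointwise action as an algebra map -/
def bpwA : Module.End ℂ X →ₐ[ℂ] Module.End ℂ ((Fin N → ℕ) → X) where
  toFun f := bpw f
  map_one' := rfl
  map_mul' _ _ := rfl
  map_zero' := rfl
  map_add' _ _ := rfl
  commutes' _ := rfl

lemma pwA_apply (f : Module.End ℂ X) (F : Finset (Fin N) → X) (I) : pwA f F I = f (F I) := rfl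
lemma bpwA_apply (f : Module.End ℂ X) (F : (Fin N → ℕ) → X) (I) : bpwA f F I = f (F I) := rfl

lemma pwA_psi (f : Module.End ℂ X) (a : Fin N) : Commute (pwA f) (psi a) :=
  LinearMap.ext fun F => pw_psi f a F
lemma pwA_psis (f : Module.End ℂ X) (a : Fin N) : Commute (pwA f) (psis a) :=
  LinearMap.ext fun F => pw_psis f a F
lemma bpwA_by (f : Module.End ℂ X) (a : Fin N) : Commute (bpwA f) (by' a) :=
  LinearMap.ext fun F => bpw_by f a F
lemma bpwA_bd (f : Module.End ℂ X) (a : Fin N) : Commute (bpwA f) (bd a) :=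
  LinearMap.ext fun F => bpw_bd f a F

lemma BRel.map {A B : Type*} [Ring A] [Algebra ℂ A] [Ring B] [Algebra ℂ B] {y d : Fin N → A}
    (h : BRel y d) (f : A →ₐ[ℂ] B) : BRel (fun a => f (y a)) (fun a => f (d a)) where
  dd a b := by rw [← map_mul, h.dd, map_mul]
  yy a b := by rw [← map_mul, h.yy, map_mul]
  dy a b := by
    rw [← map_mul, h.dy, map_add, map_mul]; split_ifs <;> simp

lemma URel.map {A B : Type*} [Ring A] [Algebra ℂ A] [Ring B] [Algebra ℂ B] {e : Fin N → Fin N → A}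
    (h : URel e) (f : A →ₐ[ℂ] B) : URel (fun a b => f (e a b)) := by
  intro a b c d
  rw [← map_mul, h]; split_ifs <;> simp

lemma Om_map {A B : Type*} [Ring A] [Algebra ℂ A] [Ring B] [Algebra ℂ B] {e : Fin N → Fin N → A}
    {y d : Fin N → A} (f : A →ₐ[ℂ] B) :
    f (Om e y d) = Om (fun a b => f (e a b)) (fun a => f (y a)) (fun a => f (d a)) := by
  simp [Om]

/-- A family of commuting matrix units -/
structure UnitFam (e : Q → Fin N → Fin N → Module.End ℂ R) : Prop where
  rel : ∀ q, URel (e q)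
  comm : ∀ q q', q ≠ q' → ∀ a b c d, Commute (e q a b) (e q' c d)

variable (e : Q → Fin N → Fin N → Module.End ℂ R)

/-- fermionic Casimir -/
def OmF (q : Q) : Module.End ℂ (Finset (Fin N) → R) := Om (fun a b => pwA (e q a b)) psi psis
/-- bosonic Casimir -/
def OmB (q : Q) : Module.End ℂ ((Fin N → ℕ) → R) := Om (fun a b => bpwA (e q a b)) by' bd

/-- full space -/
abbrev Sp (N : ℕ) (R : Type*) := Finset (Fin N) → (Fin N → ℕ) → R

/-- fermionic Casimir on the full space -/
def OmFS (q : Q) : Module.End ℂ (Sp N R) := Om (fun a b => pwA (bpwA (e q a b))) psi psis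

/-- fermion number etc. -/
def nop : Module.End ℂ (Sp N R) := ∑ a, psi a * psis a + ∑ a, pwA (by' a) * pwA (bd a)

/-- Koszul differential -/
def kos : Module.End ℂ (Sp N R) := ∑ a, psi a * pwA (bd a)
/-- Koszul homotopy -/
def hos : Module.End ℂ (Sp N R) := ∑ a, pwA (by' a) * psis a

lemma nop_apply (F : Sp N R) (I k) : nop F I k = ((#I + ∑ a, k a : ℕ) : ℂ) • F I k := by
  have h1 := congrFun (npsi_apply F I) k
  have h2 := nbos_apply (F I) k
  simp only [nop, LinearMap.add_apply, LinearMap.sum_apply, Module.End.mul_apply, Pi.add_apply]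
  rw [h1, Finset.sum_apply, Nat.cast_add, add_smul, Pi.smul_apply]
  congr 1

lemma kos_hos : (kos : Module.End ℂ (Sp N R)) * hos + hos * kos = nop :=
  dd_delta (frel (X := (Fin N → ℕ) → R)) ((brel (N := N) (X := R)).map (pwA (N := N))) (fun a b => (pwA_psi _ _).symm) (fun a b => (pwA_psi _ _).symm)
    (fun a b => (pwA_psis _ _).symm) (fun a b => (pwA_psis _ _).symm)

lemma cop_kos (U : UnitFam e) (q : Q) (c : ℂ) :
    Commute ((algebraMap ℂ (Module.End ℂ (Sp N R)) c + nop + OmFS e q) *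
      (algebraMap ℂ _ (c + 1) + pwA (OmB e q))) kos := by
  have := koszul_single (e := fun a b => pwA (bpwA (e q a b))) (N := N) (frel (X := (Fin N → ℕ) → R)) ((brel (N := N) (X := R)).map (pwA (N := N)))
    (((U.rel q).map (bpwA (N := N))).map (pwA (N := N))) (fun a b c => pwA_psi _ _) (fun a b c => pwA_psis _ _)
    (fun a b c => (bpwA_by _ _).map pwA) (fun a b c => (bpwA_bd _ _).map pwA)
    (fun a b => (pwA_psi _ _).symm) (fun a b => (pwA_psi _ _).symm)
    (fun a b => (pwA_psis _ _).symm) (fun a b => (pwA_psis _ _).symm) c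
  rw [OmB, Om_map]
  exact this

lemma nop_comm_OmFS (q : Q) : Commute nop (OmFS e q) := by
  unfold OmFS Om
  refine Commute.sum_right _ _ _ fun b _ => Commute.sum_right _ _ _ fun a _ => ?_
  refine Commute.mul_right ?_ ?_
  · refine Commute.add_left (Commute.sum_left _ _ _ fun c _ => ?_) (Commute.sum_left _ _ _ fun c _ => ?_)
    · exact ((pwA_psi _ _).mul_right (pwA_psis _ _)).symm
    · exact ((bpwA_by _ _).symm.map pwA).mul_left ((bpwA_bd _ _).symm.map pwA)
  · refine Commute.add_left (frel.n_comm _ _) (Commute.sum_left _ _ _ fun c _ => ?_)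
    refine Commute.mul_left ?_ ?_
    · exact (pwA_psi _ _).mul_right (pwA_psis _ _)
    · exact (pwA_psi _ _).mul_right (pwA_psis _ _)

lemma nop_comm_OmB (q : Q) : Commute nop (pwA (OmB e q)) := by
  refine Commute.add_left (Commute.sum_left _ _ _ fun c _ => ?_) ?_
  · exact ((pwA_psi _ _).mul_right (pwA_psis _ _)).symm
  · have : (∑ a, pwA (N := N) (by' a) * pwA (bd a)) = pwA (N := N) (∑ a, by' a * bd a : Module.End ℂ ((Fin N → ℕ) → R)) := by
      simp
    rw [this]
    refine Commute.map ?_ pwA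
    unfold OmB Om
    refine Commute.sum_right _ _ _ fun b _ => Commute.sum_right _ _ _ fun a _ => ?_
    refine Commute.mul_right ?_ (brel.n_comm _ _)
    exact Commute.sum_left _ _ _ fun c _ => (bpwA_by _ _).symm.mul_left (bpwA_bd _ _).symm

lemma OmFS_comm_OmB (U : UnitFam e) {q q' : Q} (h : q ≠ q') : Commute (OmFS e q) (pwA (OmB e q')) := by
  unfold OmFS
  rw [OmB, Om_map]
  unfold Om
  refine Commute.sum_left _ _ _ fun b _ => Commute.sum_left _ _ _ fun a _ => ?_
  refine Commute.sum_right _ _ _ fun b' _ => Commute.sum_right _ _ _ fun a' _ => ?_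
  refine Commute.mul_right ?_ (Commute.mul_right ?_ ?_)
  · refine Commute.mul_left ?_ ?_
    · exact ((U.comm _ _ h _ _ _ _).map bpwA).map pwA
    · exact ((pwA_psi _ _).mul_right (pwA_psis _ _)).symm
  · refine Commute.mul_left ?_ ?_
    · exact (bpwA_by _ _).map pwA
    · exact ((pwA_psi _ _).mul_right (pwA_psis _ _)).symm
  · refine Commute.mul_left ?_ ?_
    · exact (bpwA_bd _ _).map pwA
    · exact ((pwA_psi _ _).mul_right (pwA_psis _ _)).symm

/-- delta vector -/
def dl (I : Finset (Fin N)) (k : Fin N → ℕ) (r : R) : Sp N R := Pi.single I (Pi.single k r)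

/-- index set -/
def idx (N s : ℕ) : Finset (Finset (Fin N) × (Fin N → ℕ)) :=
  ((univ : Finset (Finset (Fin N))) ×ˢ Fintype.piFinset fun _ => range (s + 1)).filter
    fun p => #p.1 + ∑ a, p.2 a = s

lemma mem_idx {s : ℕ} {p : Finset (Fin N) × (Fin N → ℕ)} : p ∈ idx N s ↔ #p.1 + ∑ a, p.2 a = s := by
  simp only [idx, mem_filter, mem_product, mem_univ, true_and, Fintype.mem_piFinset, mem_range,
    and_iff_right_iff_imp]
  intro h a
  have := Finset.single_le_sum (f := p.2) (fun _ _ => Nat.zero_le _) (mem_univ a)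
  omega

/-- supertrace -/
def str (s : ℕ) (O : Module.End ℂ (Sp N R)) (r : R) : R :=
  ∑ p ∈ idx N s, ((-1 : ℂ) ^ #p.1) • O (dl p.1 p.2 r) p.1 p.2

lemma bd_single (a : Fin N) (k : Fin N → ℕ) (r : R) :
    bd a (Pi.single k r) = if k a = 0 then 0 else Pi.single (k - eb a) r := by
  ext j
  rw [bd_apply]
  split_ifs with h
  · rw [Pi.single_eq_of_ne]; · rfl
    rintro rfl; simp at h
  · by_cases hj : j = k - eb a
    · subst hj
      have : k - eb a + eb a = k := by
        ext c; by_cases hc : c = a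
        · subst hc; simp; omega
        · simp [hc]
      rw [this]; simp
    · rw [Pi.single_eq_of_ne hj, Pi.single_eq_of_ne]
      rintro rfl; simp at hj

lemma str_kos (s : ℕ) (O : Module.End ℂ (Sp N R)) (r : R) :
    str s (kos * O) r = - str s (O * kos) r := by
  have h1 : ∀ I k, ((kos * O : Module.End ℂ (Sp N R)) (dl I k r)) I k = ∑ a, if a ∈ I then
      sg a I • O (dl I k r) (I.erase a) (k + eb a) else 0 := by
    intro I k
    simp only [kos, Module.End.mul_apply, LinearMap.sum_apply, Finset.sum_apply]
    refine sum_congr rfl fun a _ => ?_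
    rw [psi_apply]
    split_ifs with h
    · rfl
    · rfl
  have h2 : ∀ I k, ((O * kos : Module.End ℂ (Sp N R)) (dl I k r)) I k = ∑ a, if a ∉ I ∧ k a ≠ 0 then
      sg a I • O (dl (insert a I) (k - eb a) r) I k else 0 := by
    intro I k
    simp only [kos, Module.End.mul_apply, LinearMap.sum_apply, Finset.sum_apply, map_sum]
    refine sum_congr rfl fun a _ => ?_
    have : psi a (pwA (bd a) (dl I k r)) = if a ∉ I ∧ k a ≠ 0 then
        sg a I • dl (insert a I) (k - eb a) r else 0 := by
      have e1 : pwA (bd a) (dl I k r) = Pi.single I (bd a (Pi.single k r)) := by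
        ext J : 1
        rw [pwA_apply, dl]
        by_cases hJ : J = I
        · subst hJ; simp
        · simp [Pi.single_eq_of_ne hJ]
      rw [e1, psi_single, bd_single, dl]
      by_cases h1 : a ∈ I <;> by_cases h2 : k a = 0 <;> simp [h1, h2]
    rw [this]; split_ifs <;> simp
  unfold str
  simp only [h1, h2, Finset.smul_sum]
  rw [Finset.sum_comm, Finset.sum_comm (s := idx N s), ← Finset.sum_neg_distrib]
  refine sum_congr rfl fun a _ => ?_
  simp only [smul_ite, smul_zero, ← Finset.sum_filter, ← Finset.sum_neg_distrib]
  refine Finset.sum_nbij' (fun p => (p.1.erase a, p.2 + eb a)) (fun p => (insert a p.1, p.2 - eb a)) ?_ ?_ ?_ ?_ ?_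
  · rintro ⟨I, k⟩ h
    simp only [mem_filter, mem_idx] at h ⊢
    obtain ⟨h, ha⟩ := h
    have := card_erase_of_mem ha
    have hc : 0 < #I := card_pos.2 ⟨a, ha⟩
    refine ⟨?_, by simp, by simp⟩
    simp only [Pi.add_apply, sum_add_distrib, Finset.sum_pi_single', mem_univ, if_true, this]
    omega
  · rintro ⟨I, k⟩ h
    simp only [mem_filter, mem_idx] at h ⊢
    obtain ⟨h, ha, hk⟩ := h
    refine ⟨?_, by simp⟩
    have e1 : ∑ c, (k - eb a) c + 1 = ∑ c, k c := by
      have : ∑ c, k c = ∑ c, ((k - eb a) c + eb a c) := by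
        refine sum_congr rfl fun c _ => ?_
        by_cases hc : c = a
        · subst hc; simp; omega
        · simp [hc]
      rw [this, sum_add_distrib]; simp
    rw [card_insert_of_notMem ha]; omega
  · rintro ⟨I, k⟩ h
    simp only [mem_filter, mem_idx] at h
    simp [insert_erase h.2]
  · rintro ⟨I, k⟩ h
    simp only [mem_filter, mem_idx] at h
    obtain ⟨h, ha, hk⟩ := h
    simp only [erase_insert ha, Prod.mk.injEq, true_and]
    ext c; by_cases hc : c = a
    · subst hc; simp; omega
    · simp [hc]
  · rintro ⟨I, k⟩ h
    simp only [mem_filter, mem_idx] at h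
    obtain ⟨h, ha⟩ := h
    simp only [insert_erase ha, add_tsub_cancel_right, sg_erase_self, smul_smul]
    rw [← neg_smul]; congr 1
    have : #I = #(I.erase a) + 1 := by
      rw [card_erase_of_mem ha]; have : 0 < #I := card_pos.2 ⟨a, ha⟩; omega
    rw [this, pow_succ]; ring

lemma str_add (s : ℕ) (O O' : Module.End ℂ (Sp N R)) (r : R) :
    str s (O + O') r = str s O r + str s O' r := by
  simp [str, sum_add_distrib]

lemma nop_dl {I : Finset (Fin N)} {k : Fin N → ℕ} {r : R} :
    nop (dl I k r) = ((#I + ∑ a, k a : ℕ) : ℂ) • dl I k r := by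
  ext J j
  rw [nop_apply, Pi.smul_apply, Pi.smul_apply]
  by_cases hJ : J = I
  · subst hJ
    by_cases hj : j = k
    · subst hj; rfl
    · simp [dl, Pi.single_eq_of_ne hj]
  · simp [dl, Pi.single_eq_of_ne hJ]

lemma str_nop (s : ℕ) (O : Module.End ℂ (Sp N R)) (r : R) :
    str s (O * nop) r = (s : ℂ) • str s O r := by
  unfold str
  rw [Finset.smul_sum]
  refine sum_congr rfl fun p hp => ?_
  rw [mem_idx] at hp
  rw [Module.End.mul_apply, nop_dl, hp, map_smul, Pi.smul_apply, Pi.smul_apply, smul_comm]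

lemma str_zero {s : ℕ} (hs : s ≠ 0) (O : Module.End ℂ (Sp N R)) (h : Commute O kos) (r : R) :
    str s O r = 0 := by
  have h1 : (s : ℂ) • str s O r = 0 := by
    rw [← str_nop, ← kos_hos, mul_add, ← mul_assoc, h.eq, str_add, mul_assoc, str_kos, ← mul_assoc]
    simp
  exact (smul_eq_zero.1 h1).resolve_left (by exact_mod_cast hs)

variable (w : Q → ℂ) (qs : List Q)

/-- fermionic transfer operator (polynomial normalization) -/
def calF (u : ℂ) : Module.End ℂ (Finset (Fin N) → R) :=
  cal (fun q => algebraMap ℂ _ (u - w q) + OmF e q) qs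
/-- bosonic transfer operator -/
def calB (x : ℂ) : Module.End ℂ ((Fin N → ℕ) → R) :=
  cal (fun q => algebraMap ℂ _ (x + 1 - w q) + OmB e q) qs

/-- traces over symmetric powers -/
def symT (x : ℂ) (s : ℕ) (r : R) : R :=
  ∑ k ∈ piAntidiag (univ : Finset (Fin N)) s, calB e w qs x (Pi.single k r) k

lemma cal_n (s x : ℂ) (qs : List Q) : ∀ v : Sp N R, nop v = s • v →
    cal (A := Module.End ℂ (Sp N R)) (fun q => ((algebraMap ℂ (Module.End ℂ (Sp N R)) (x - w q) + nop + OmFS e q) *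
      (algebraMap ℂ _ (x - w q + 1) + pwA (OmB e q)))) qs v =
    cal (A := Module.End ℂ (Sp N R)) (fun q => ((algebraMap ℂ (Module.End ℂ (Sp N R)) (x + s - w q) + OmFS e q) *
      (algebraMap ℂ _ (x + 1 - w q) + pwA (OmB e q)))) qs v := by
  induction qs with
  | nil => intro v _; rfl
  | cons q qs ih =>
    intro v hv
    rw [cal, cal]
    set B : Module.End ℂ (Sp N R) := algebraMap ℂ _ (x + 1 - w q) + pwA (OmB e q) with hB
    have hB' : algebraMap ℂ _ (x - w q + 1) + pwA (OmB e q) = B := by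
      rw [hB]; congr 2; ring
    rw [hB']
    have c1 : Commute nop B := (Algebra.commute_algebraMap_right _ _).add_right (nop_comm_OmB e q)
    have hBv : nop (B v) = s • B v := by
      rw [← Module.End.mul_apply, c1.eq, Module.End.mul_apply, hv, map_smul]
    have e1 : ((algebraMap ℂ (Module.End ℂ (Sp N R)) (x - w q) + nop + OmFS e q) * B : Module.End ℂ (Sp N R)) v =
       ((algebraMap ℂ (Module.End ℂ (Sp N R)) (x + s - w q) + OmFS e q) * B : Module.End ℂ (Sp N R)) v := by
      simp only [Module.End.mul_apply, LinearMap.add_apply, hBv, Module.algebraMap_end_apply]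
      rw [← add_smul]; congr 2; ring
    refine (congrArg (DFunLike.coe (F := Module.End ℂ (Sp N R)) _) e1).trans ?_
    refine ih _ ?_
    have c2 : Commute nop ((algebraMap ℂ (Module.End ℂ (Sp N R)) (x + s - w q) + OmFS e q) * B) :=
      ((Algebra.commute_algebraMap_right _ _).add_right (nop_comm_OmFS e q)).mul_right c1
    rw [← Module.End.mul_apply, c2.eq, Module.End.mul_apply, hv, map_smul]

/-- evaluation at `k` intertwines fermionic operators -/
lemma pw_cal (k : Fin N → ℕ) (u : ℂ) (F : Sp N R) :
    pw (LinearMap.proj k) (cal (A := Module.End ℂ (Sp N R)) (fun q => algebraMap ℂ (Module.End ℂ (Sp N R)) (u - w q) + OmFS e q) qs F)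
      = calF e w qs u (pw (LinearMap.proj k) F) := by
  have h1 : ∀ q (F : Sp N R), pw (LinearMap.proj k) (OmFS e q F) = OmF e q (pw (LinearMap.proj k) F) := by
    intro q F
    simp only [OmFS, OmF, Om, LinearMap.sum_apply, map_sum, Module.End.mul_apply]
    refine sum_congr rfl fun b _ => sum_congr rfl fun a _ => ?_
    rw [← pw_psis, ← pw_psi]
    rfl
  unfold calF
  induction qs generalizing F with
  | nil => rfl
  | cons q qs ih =>
    simp only [cal, Module.End.mul_apply]
    rw [ih]
    congr 1
    simp only [LinearMap.add_apply, map_add, h1, Module.algebraMap_end_apply, map_smul]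

lemma pwA_single (f : Module.End ℂ X) (I : Finset (Fin N)) (r : X) :
    pwA f (Pi.single I r) = Pi.single I (f r) := by
  ext J : 1
  rw [pwA_apply]
  by_cases hJ : J = I
  · subst hJ; simp
  · simp [Pi.single_eq_of_ne hJ]

lemma pw_single {Y : Type*} [AddCommGroup Y] [Module ℂ Y] (f : X →ₗ[ℂ] Y) (I : Finset (Fin N)) (r : X) :
    pw f (Pi.single I r) = Pi.single I (f r) := by
  ext J : 1
  rw [pw_apply]
  by_cases hJ : J = I
  · subst hJ; simp
  · simp [Pi.single_eq_of_ne hJ]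

/-- the main Koszul identity -/
theorem koszul (U : UnitFam e) (hq : qs.Nodup) (x : ℂ) {s : ℕ} (hs : s ≠ 0) (r : R) :
    ∑ I : Finset (Fin N), ((-1 : ℂ) ^ #I) • (if #I ≤ s then
      calF e w qs (x + s) (Pi.single I (symT e w qs x (s - #I) r)) I else 0) = 0 := by
  have h0 := str_zero (N := N) hs (cal (A := Module.End ℂ (Sp N R)) (fun q => ((algebraMap ℂ (Module.End ℂ (Sp N R)) (x - w q) + nop + OmFS e q) *
      (algebraMap ℂ _ (x - w q + 1) + pwA (OmB e q)))) qs) (cal_comm fun q _ => cop_kos e U q _) r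
  have h1 : ∀ I k, #I + ∑ a, k a = s → cal (A := Module.End ℂ (Sp N R)) (fun q => ((algebraMap ℂ (Module.End ℂ (Sp N R)) (x - w q) + nop + OmFS e q) *
      (algebraMap ℂ _ (x - w q + 1) + pwA (OmB e q)))) qs (dl I k r) I k =
      calF e w qs (x + s) (Pi.single I (calB e w qs x (Pi.single k r) k)) I := by
    intro I k h
    rw [cal_n e w (s : ℂ) x qs (dl I k r) (by rw [nop_dl, h]), cal_mul hq]
    · rw [Module.End.mul_apply]
      have h2 : cal (A := Module.End ℂ (Sp N R)) (fun q => algebraMap ℂ (Module.End ℂ (Sp N R)) (x + 1 - w q) + pwA (OmB e q)) qs = pwA (calB e w qs x) := by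
        have := cal_map (pwA (N := N) : _ →ₐ[ℂ] Module.End ℂ (Sp N R)).toMonoidHom
          (fun q => algebraMap ℂ _ (x + 1 - w q) + OmB e q) qs
        refine Eq.trans ?_ this.symm
        congr 1
      rw [h2, dl, pwA_single]
      have := congrFun (pw_cal e w qs k (x + s) (Pi.single I (calB e w qs x (Pi.single k r)))) I
      rw [pw_single] at this
      exact this
    · intro q q' h
      refine Commute.add_left (Algebra.commutes _ _) (Commute.add_right (Algebra.commutes _ _).symm ?_)
      exact OmFS_comm_OmB e U h
  have h3 : str s (cal (A := Module.End ℂ (Sp N R)) (fun q => ((algebraMap ℂ (Module.End ℂ (Sp N R)) (x - w q) + nop + OmFS e q) *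
      (algebraMap ℂ _ (x - w q + 1) + pwA (OmB e q)))) qs) r = ∑ p ∈ idx N s, ((-1 : ℂ) ^ #p.1) •
        calF e w qs (x + s) (Pi.single p.1 (calB e w qs x (Pi.single p.2 r) p.2)) p.1 :=
    sum_congr rfl fun p hp => by rw [h1 _ _ (mem_idx.1 hp)]
  rw [h3] at h0
  refine Eq.trans ?_ h0
  refine Eq.trans ?_ (Finset.sum_fiberwise_of_maps_to (s := idx N s) (t := univ) (g := Prod.fst) (fun _ _ => mem_univ _) _)
  refine sum_congr rfl fun I _ => ?_
  split_ifs with h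
  · have : calF e w qs (x + s) (Pi.single I (symT e w qs x (s - #I) r)) I =
      ∑ k ∈ piAntidiag (univ : Finset (Fin N)) (s - #I), calF e w qs (x + s) (Pi.single I (calB e w qs x (Pi.single k r) k)) I := by
      have := map_sum ((LinearMap.proj I : (Finset (Fin N) → R) →ₗ[ℂ] R) ∘ₗ calF e w qs (x + s) ∘ₗ LinearMap.single ℂ (fun _ => R) I)
        (fun k => calB e w qs x (Pi.single k r) k) (piAntidiag (univ : Finset (Fin N)) (s - #I))
      exact this
    rw [this, Finset.smul_sum]
    refine Finset.sum_nbij' (fun k => (I, k)) (fun p => p.2) ?_ ?_ ?_ ?_ ?_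
    · intro k hk
      simp only [mem_piAntidiag] at hk
      simp only [mem_filter, mem_idx]
      refine ⟨?_, trivial⟩
      have h5 : ∑ a, k a = s - #I := hk.1
      omega
    · rintro ⟨J, k⟩ hp
      simp only [mem_filter, mem_idx] at hp
      obtain ⟨hp, rfl⟩ := hp
      simp only [mem_piAntidiag]
      have hp' : #J + ∑ a, k a = s := hp
      refine ⟨?_, by simp⟩
      show ∑ a, k a = _
      omega
    · intro k _; rfl
    · rintro ⟨J, k⟩ hp
      simp only [mem_filter, mem_idx] at hp
      rw [hp.2]
    · intro k _; rfl
  · rw [smul_zero]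
    symm
    apply Finset.sum_eq_zero
    rintro ⟨J, k⟩ hp
    simp only [mem_filter, mem_idx] at hp
    obtain ⟨hp, rfl⟩ := hp
    have hp' : #J + ∑ a, k a = s := hp
    exact absurd (show #J ≤ s by omega) h

end Sp
end XXXAux

namespace XXXAux
open Finset

section PhiS
variable {N : ℕ} {R M Q : Type*} [AddCommGroup R] [Module ℂ R] [AddCommGroup M] [Module ℂ M]

/-- fermionic contraction of a row of a matrix -/
def PsiT (T : Matrix (Fin N) (Fin N) (Module.End ℂ R)) (a : Fin N) :
    Module.End ℂ (Finset (Fin N) → R) := ∑ b, psi b * pwA (T a b)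

/-- ordered product of rows -/
def Phi (T : ℂ → Matrix (Fin N) (Fin N) (Module.End ℂ R)) :
    List (Fin N) → ℂ → Module.End ℂ (Finset (Fin N) → R)
  | [], _ => 1
  | a :: l, u => PsiT (T u) a * Phi T l (u - 1)

/-- vacuum -/
def vac (r : R) : Finset (Fin N) → R := Pi.single ∅ r

/-- the expanded difference operator -/
def Dgen (T : ℂ → Matrix (Fin N) (Fin N) (Module.End ℂ R)) (f : ℂ → R) (u : ℂ) : R :=
  ∑ I : Finset (Fin N), ((-1 : ℂ) ^ #I) • Phi T (I.sort (· ≤ ·)) u (vac (f (u - #I))) I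

lemma pw_PsiT (ι : M →ₗ[ℂ] R) (T : Matrix (Fin N) (Fin N) (Module.End ℂ R))
    (T' : Matrix (Fin N) (Fin N) (Module.End ℂ M)) (h : ∀ a b v, ι (T' a b v) = T a b (ι v)) (a : Fin N)
    (F : Finset (Fin N) → M) : pw ι (PsiT T' a F) = PsiT T a (pw ι F) := by
  simp only [PsiT, LinearMap.sum_apply, map_sum, Module.End.mul_apply]
  refine sum_congr rfl fun b _ => ?_
  rw [pw_psi]
  congr 1
  ext I
  exact h a b (F I)

lemma pw_Phi (ι : M →ₗ[ℂ] R) (T : ℂ → Matrix (Fin N) (Fin N) (Module.End ℂ R))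
    (T' : ℂ → Matrix (Fin N) (Fin N) (Module.End ℂ M)) (l : List (Fin N)) : ∀ (u : ℂ)
    (h : ∀ j < l.length, ∀ a b v, ι (T' (u - j) a b v) = T (u - j) a b (ι v))
    (F : Finset (Fin N) → M), pw ι (Phi T' l u F) = Phi T l u (pw ι F) := by
  induction l with
  | nil => intro u h F; rfl
  | cons a l ih =>
    intro u h F
    simp only [Phi, Module.End.mul_apply]
    rw [pw_PsiT ι (T u) (T' u) (by simpa using h 0 (by simp)), ih]
    intro j hj
    have := h (j + 1) (by simpa using hj)
    push_cast at this
    rwa [show u - 1 - (j : ℂ) = u - (j + 1) by ring]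

variable (e : Q → Fin N → Fin N → Module.End ℂ R) (w : Q → ℂ) (qs : List Q)

/-- L-matrix of one box -/
def LR (q : Q) (u : ℂ) : Matrix (Fin N) (Fin N) (Module.End ℂ R) :=
  fun a b => (if a = b then 1 else 0) + (u - w q)⁻¹ • e q b a

/-- monodromy -/
def TR (u : ℂ) : Matrix (Fin N) (Fin N) (Module.End ℂ R) := (qs.map fun q => LR e w q u).prod

/-- normalized transfer operator -/
def calL (u : ℂ) : Module.End ℂ (Finset (Fin N) → R) :=
  cal (fun q => 1 + (u - w q)⁻¹ • OmF e q) qs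

lemma pwA_OmF (U : UnitFam e) {q q' : Q} (h : q ≠ q') (a b : Fin N) :
    Commute (OmF e q') (pwA (e q a b)) := by
  unfold OmF Om
  refine Commute.sum_left _ _ _ fun c _ => Commute.sum_left _ _ _ fun d _ => ?_
  refine Commute.mul_left ?_ (Commute.mul_left ?_ ?_)
  · exact (U.comm _ _ h.symm _ _ _ _).map pwA
  · exact (pwA_psi _ _).symm
  · exact (pwA_psis _ _).symm

lemma claimA (U : UnitFam e) {qs : List Q} (hq : qs.Nodup) (u : ℂ)
    (hu : ∀ q ∈ qs, u ≠ w q ∧ u - 1 ≠ w q) (a : Fin N) :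
    PsiT (TR e w qs u) a * calL e w qs (u - 1) = calL e w qs u * psi a := by
  induction qs generalizing a with
  | nil =>
    simp only [PsiT, TR, calL, cal, List.map_nil, List.prod_nil, mul_one, one_mul, Matrix.one_apply]
    rw [Finset.sum_eq_single a]
    · simp
    · intro b _ hb; simp [hb.symm]
    · simp
  | cons q qs ih =>
    rw [List.nodup_cons] at hq
    have ih := ih hq.2 (fun q' hq' => hu q' (by simp [hq']))
    have h1 : PsiT (TR e w (q :: qs) u) a = ∑ c, pwA (LR e w q u a c) * PsiT (TR e w qs u) c := by
      simp only [PsiT, TR, List.map_cons, List.prod_cons, Matrix.mul_apply, map_sum, map_mul, Finset.mul_sum]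
      rw [Finset.sum_comm]
      refine sum_congr rfl fun c _ => sum_congr rfl fun b _ => ?_
      rw [← mul_assoc, ← mul_assoc, (pwA_psi _ _).eq]
    have h2 : ∀ c, Commute (pwA (LR e w q u a c)) (calL e w qs u) := by
      intro c
      refine (cal_comm fun q' hq' => ?_).symm
      refine Commute.add_left (Commute.one_left _) (Commute.smul_left ?_ _)
      unfold LR
      rw [map_add, map_smul]
      refine Commute.add_right ?_ (Commute.smul_right (pwA_OmF e U ?_ _ _) _)
      · split_ifs <;> simp
      · rintro rfl; exact hq.1 hq'
    have h3 := claimA_single (e := fun a b => pwA (e q a b)) frel ((U.rel q).map pwA)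
      (fun a b c => pwA_psi (N := N) _ _) a (u - w q)⁻¹ (u - 1 - w q)⁻¹ (by
        have := hu q (by simp)
        have h1 : u - w q ≠ 0 := sub_ne_zero.2 this.1
        have h2 : u - 1 - w q ≠ 0 := sub_ne_zero.2 this.2
        field_simp; ring)
    have h4 : ∀ c, pwA (N := N) (LR e w q u a c) = (if a = c then 1 else 0) + (u - w q)⁻¹ • pwA (e q c a) := by
      intro c; unfold LR; rw [map_add, map_smul]; split_ifs <;> simp
    calc _ = (∑ c, pwA (LR e w q u a c) * (PsiT (TR e w qs u) c * calL e w qs (u - 1))) *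
          (1 + (u - 1 - w q)⁻¹ • OmF e q) := by
          rw [h1]; simp only [calL, cal, ← mul_assoc, Finset.sum_mul]
      _ = calL e w qs u * ((∑ c, pwA (LR e w q u a c) * psi c) * (1 + (u - 1 - w q)⁻¹ • OmF e q)) := by
          rw [← mul_assoc, Finset.mul_sum]; congr 1
          refine sum_congr rfl fun c _ => ?_
          rw [ih, ← mul_assoc, (h2 c).eq, mul_assoc]
      _ = _ := by
          simp only [h4]
          rw [show OmF e q = Om (fun a b => pwA (e q a b)) psi psis from rfl, h3]
          simp only [calL, cal, ← mul_assoc]; rfl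

lemma OmF_vac (q : Q) (r : R) : OmF e q (vac r) = 0 := by
  simp [OmF, Om, Module.End.mul_apply, vac, psis_vac]

lemma calL_vac (u : ℂ) (r : R) : calL e w qs u (vac r) = vac r := by
  unfold calL
  induction qs with
  | nil => rfl
  | cons q qs ih => simp [cal, Module.End.mul_apply, OmF_vac, ih]

lemma calF_eq (u : ℂ) (hu : ∀ q ∈ qs, u ≠ w q) :
    calF e w qs u = (qs.map fun q => u - w q).prod • calL e w qs u := by
  unfold calF calL
  induction qs with
  | nil => simp [cal]
  | cons q qs ih =>
    have h1 : u - w q ≠ 0 := sub_ne_zero.2 (hu q (by simp))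
    simp only [cal, List.map_cons, List.prod_cons]
    rw [ih fun q hq => hu q (by simp [hq])]
    have : algebraMap ℂ (Module.End ℂ (Finset (Fin N) → R)) (u - w q) + OmF e q
       = (u - w q) • (1 + (u - w q)⁻¹ • OmF e q) := by
      rw [smul_add, smul_smul, mul_inv_cancel₀ h1, one_smul, Algebra.algebraMap_eq_smul_one]
    rw [this, smul_mul_smul_comm, mul_comm]

/-- ordered creation -/
def psil (l : List (Fin N)) : Module.End ℂ (Finset (Fin N) → R) := (l.map psi).prod

lemma Phi_eq (U : UnitFam e) {qs : List Q} (hq : qs.Nodup) (l : List (Fin N)) (r : R) : ∀ (u : ℂ)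
    (hu : ∀ q ∈ qs, ∀ j : ℕ, j ≤ l.length → u - j ≠ w q),
    Phi (TR e w qs) l u (vac r) = calL e w qs u (psil l (vac r)) := by
  induction l with
  | nil => intro u hu; exact (calL_vac e w qs u r).symm
  | cons a l ih =>
    intro u hu
    have h := claimA e w U hq u (fun q hq => ⟨by simpa using hu q hq 0 (by simp),
      by simpa using hu q hq 1 (by simp)⟩) a
    rw [Phi, Module.End.mul_apply, ih, ← Module.End.mul_apply, h]
    · simp [psil, Module.End.mul_apply]
    · intro q hq j hj
      have := hu q hq (j + 1) (by simpa using hj)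
      push_cast at this
      rwa [show u - 1 - (j : ℂ) = u - (j + 1) by ring]

lemma psil_sorted (l : List (Fin N)) (hl : l.Pairwise (· < ·)) (r : R) :
    psil l (vac r) = Pi.single l.toFinset r := by
  induction l with
  | nil => rfl
  | cons a l ih =>
    rw [List.pairwise_cons] at hl
    have h1 : psil (a :: l) (vac r) = psi a (psil l (vac r)) := by
      simp [psil, Module.End.mul_apply]
    rw [h1, ih hl.2, psi_single, if_neg]
    · have : sg a l.toFinset = 1 := by
        unfold sg
        rw [filter_false_of_mem]; · simp
        intro b hb
        exact (hl.1 b (by simpa using hb)).not_gt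
      rw [this, one_smul, List.toFinset_cons]
    · intro h
      exact lt_irrefl _ (hl.1 a (by simpa using h))

lemma psil_sort (I : Finset (Fin N)) (r : R) : psil (I.sort (· ≤ ·)) (vac r) = Pi.single I r := by
  rw [psil_sorted _ (by exact I.sortedLT_sort.pairwise), sort_toFinset]

lemma Phi_sort (U : UnitFam e) {qs : List Q} (hq : qs.Nodup) (I : Finset (Fin N)) (r : R) (u : ℂ)
    (hu : ∀ q ∈ qs, ∀ j : ℕ, j ≤ #I → u - j ≠ w q) :
    Phi (TR e w qs) (I.sort (· ≤ ·)) u (vac r) = calL e w qs u (Pi.single I r) := by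
  rw [Phi_eq e w U hq _ r u (by simpa using hu), psil_sort]

/-- recursion for symT -/
lemma symT_rec (U : UnitFam e) (hq : qs.Nodup) (x : ℂ) (hx : ∀ q ∈ qs, ∀ j : ℤ, x + j ≠ w q)
    {s : ℕ} (hs : s ≠ 0) (r : R) :
    ∑ I : Finset (Fin N), ((-1 : ℂ) ^ #I) • (if #I ≤ s then
      Phi (TR e w qs) (I.sort (· ≤ ·)) (x + s) (vac (symT e w qs x (s - #I) r)) I else 0) = 0 := by
  have h := koszul e w qs U hq x hs r
  have hne : (qs.map fun q => x + s - w q).prod ≠ 0 := by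
    rw [Ne, List.prod_eq_zero_iff]
    intro h
    simp only [List.mem_map] at h
    obtain ⟨q, hq, h⟩ := h
    have := hx q hq s
    push_cast at this
    exact this (sub_eq_zero.1 h)
  rw [← smul_right_injective R hne |>.eq_iff, smul_zero, Finset.smul_sum]
  refine Eq.trans ?_ h
  refine sum_congr rfl fun I _ => ?_
  rw [smul_comm]
  congr 1
  split_ifs with hI
  · rw [calF_eq e w qs (x + s) (fun q hq => by simpa using hx q hq s), Phi_sort e w U hq I]
    · rfl
    · intro q hq j hj
      have := hx q hq (s - j)
      push_cast at this
      rwa [add_sub_assoc]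
  · simp

end PhiS
end XXXAux

namespace XXXAux
open Finset

section PFs
variable {X Y : Type*} [AddCommGroup X] [Module ℂ X] [AddCommGroup Y] [Module ℂ Y]

/-- vector valued polynomial functions -/
def PF (X : Type*) [AddCommGroup X] [Module ℂ X] : Submodule ℂ (ℂ → X) :=
  Submodule.span ℂ {f | ∃ (p : Polynomial ℂ) (v : X), f = fun u => p.eval u • v}

lemma PF_mk (p : Polynomial ℂ) (v : X) : (fun u => p.eval u • v) ∈ PF X :=
  Submodule.subset_span ⟨p, v, rfl⟩

lemma PF_const (v : X) : (fun _ : ℂ => v) ∈ PF X := by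
  simpa using PF_mk (1 : Polynomial ℂ) v

/-- induction -/
lemma PF_map {f : ℂ → X} (hf : f ∈ PF X) (L : (ℂ → X) →ₗ[ℂ] (ℂ → Y))
    (h : ∀ (p : Polynomial ℂ) v, L (fun u => p.eval u • v) ∈ PF Y) : L f ∈ PF Y := by
  have : PF X ≤ (PF Y).comap L := by
    refine Submodule.span_le.2 ?_
    rintro _ ⟨p, v, rfl⟩
    exact h p v
  exact this hf

lemma PF_comp {f : ℂ → X} (hf : f ∈ PF X) (L : X →ₗ[ℂ] Y) : (fun u => L (f u)) ∈ PF Y := by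
  refine PF_map hf (L.compLeft ℂ) fun p v => ?_
  convert PF_mk p (L v) using 2
  simp

lemma PF_shift {f : ℂ → X} (hf : f ∈ PF X) (c : ℂ) : (fun u => f (u + c)) ∈ PF X := by
  refine PF_map hf (LinearMap.funLeft ℂ X (fun u => u + c)) fun p v => ?_
  convert PF_mk (p.comp (Polynomial.X + Polynomial.C c)) v using 2
  simp [LinearMap.funLeft]

lemma PF_smul {f : ℂ → X} (hf : f ∈ PF X) (q : Polynomial ℂ) : (fun u => q.eval u • f u) ∈ PF X := by
  let L : (ℂ → X) →ₗ[ℂ] (ℂ → X) :=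
    { toFun := fun f u => q.eval u • f u
      map_add' := fun f g => by ext; simp
      map_smul' := fun c f => by ext; simp [smul_comm c] }
  refine PF_map hf L fun p v => ?_
  convert PF_mk (q * p) v using 2
  simp [L, smul_smul]

lemma PF_scalar {f : ℂ → ℂ} (hf : f ∈ PF ℂ) : ∃ p : Polynomial ℂ, ∀ u, f u = p.eval u := by
  unfold PF at hf
  induction hf using Submodule.span_induction with
  | mem f hf => obtain ⟨p, v, rfl⟩ := hf; exact ⟨p * Polynomial.C v, fun u => by simp⟩
  | zero => exact ⟨0, by simp⟩
  | add f g _ _ hf hg =>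
    obtain ⟨p, hp⟩ := hf; obtain ⟨q, hq⟩ := hg
    exact ⟨p + q, fun u => by simp [hp, hq]⟩
  | smul c f _ hf =>
    obtain ⟨p, hp⟩ := hf
    exact ⟨Polynomial.C c * p, fun u => by simp [hp]⟩

lemma PF_coeffs {f : ℂ → X} (hf : f ∈ PF X) : ∃ (d : ℕ) (c : ℕ → X), (∀ t, d ≤ t → c t = 0) ∧
    ∀ u, f u = ∑ t ∈ range d, u ^ t • c t := by
  unfold PF at hf
  induction hf using Submodule.span_induction with
  | mem f hf =>
    obtain ⟨p, v, rfl⟩ := hf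
    refine ⟨p.natDegree + 1, fun t => p.coeff t • v, ?_, fun u => ?_⟩
    · intro t ht; beta_reduce; rw [Polynomial.coeff_eq_zero_of_natDegree_lt (by omega), zero_smul]
    · beta_reduce; rw [Polynomial.eval_eq_sum_range, Finset.sum_smul]
      refine sum_congr rfl fun t _ => ?_
      rw [smul_smul, mul_comm]
  | zero => exact ⟨0, 0, by simp, by simp⟩
  | add f g _ _ hf hg =>
    obtain ⟨d, c, hc, hf⟩ := hf; obtain ⟨d', c', hc', hg⟩ := hg
    have key : ∀ (d : ℕ) (c : ℕ → X), (∀ t, d ≤ t → c t = 0) → ∀ D, d ≤ D → ∀ u : ℂ,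
        ∑ t ∈ range d, u ^ t • c t = ∑ t ∈ range D, u ^ t • c t := by
      intro d c hc D hD u
      refine Finset.sum_subset (by simpa using hD) fun t _ ht => ?_
      rw [hc t (by simpa using ht), smul_zero]
    refine ⟨max d d', c + c', fun t ht => ?_, fun u => ?_⟩
    · simp [hc t (le_trans (le_max_left _ _) ht), hc' t (le_trans (le_max_right _ _) ht)]
    · rw [Pi.add_apply, hf, hg, key d c hc _ (le_max_left d d') u, key d' c' hc' _ (le_max_right d d') u,
        ← sum_add_distrib]
      simp
  | smul a f _ hf =>
    obtain ⟨d, c, hc, hf⟩ := hf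
    refine ⟨d, a • c, fun t ht => by simp [hc t ht], fun u => ?_⟩
    rw [Pi.smul_apply, hf, Finset.smul_sum]
    refine sum_congr rfl fun t _ => ?_
    rw [Pi.smul_apply, smul_comm]

lemma PF_eq_zero {f : ℂ → X} (hf : f ∈ PF X) (S : Set ℂ) (hS : S.Infinite) (h : ∀ u ∈ S, f u = 0) :
    ∀ u, f u = 0 := by
  intro u
  rw [← Module.forall_dual_apply_eq_zero_iff ℂ]
  intro ℓ
  obtain ⟨p, hp⟩ := PF_scalar (PF_comp hf ℓ)
  have : p = 0 := Polynomial.eq_zero_of_infinite_isRoot p (hS.mono fun v hv => by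
    show p.eval v = 0
    rw [← hp, h v hv, map_zero])
  rw [hp, this]; simp

lemma inf_shift (x : ℂ) (n : ℕ) : {u : ℂ | ∃ s : ℕ, n ≤ s ∧ u = x + s}.Infinite := by
  have : Set.Infinite ((fun s : ℕ => x + (s : ℂ)) '' {s | n ≤ s}) := by
    refine Set.Infinite.image ?_ (Set.infinite_of_not_bddAbove ?_)
    · intro a _ b _ h; simpa using h
    · rintro ⟨b, hb⟩
      have := hb (show n ≤ max n (b + 1) from le_max_left _ _)
      omega
  refine this.mono ?_
  rintro _ ⟨s, hs, rfl⟩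
  exact ⟨s, hs, rfl⟩

end PFs

section Poly
variable {N : ℕ}

/-- coordinates -/
def co (a : Fin N) : (Fin N → ℤ) → ℂ := fun k => k a
/-- polynomial functions on the lattice -/
def PolyL (N : ℕ) : Subalgebra ℂ ((Fin N → ℤ) → ℂ) := Algebra.adjoin ℂ (Set.range co)

lemma PolyL_co (a : Fin N) : co a ∈ PolyL N := Algebra.subset_adjoin ⟨a, rfl⟩

lemma PolyL_shift {p : (Fin N → ℤ) → ℂ} (hp : p ∈ PolyL N) (γ : Fin N → ℤ) :
    (fun k => p (k + γ)) ∈ PolyL N := by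
  let f : ((Fin N → ℤ) → ℂ) →ₐ[ℂ] ((Fin N → ℤ) → ℂ) :=
    { toFun := fun p k => p (k + γ)
      map_one' := rfl
      map_mul' := fun _ _ => rfl
      map_zero' := rfl
      map_add' := fun _ _ => rfl
      commutes' := fun _ => rfl }
  have : PolyL N ≤ (PolyL N).comap f := by
    refine Algebra.adjoin_le ?_
    rintro _ ⟨a, rfl⟩
    show f (co a) ∈ PolyL N
    have : f (co a) = co a + algebraMap ℂ _ (γ a : ℂ) := by
      ext k
      show (((k + γ) a : ℤ) : ℂ) = _
      simp [co]
    rw [this]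
    exact add_mem (PolyL_co a) (algebraMap_mem _ _)
  exact this hp

/-- binomial functions -/
def bf (c : ℕ) (k : ℂ) : ℂ := (∏ j ∈ range c, (k + 1 + j)) / c.factorial

lemma bf_nat (c n : ℕ) : bf c n = ((n + c).choose c : ℂ) := by
  have h : ∏ j ∈ range c, ((n : ℂ) + 1 + j) = ((n + 1).ascFactorial c : ℕ) := by
    rw [Nat.ascFactorial_eq_prod_range]; push_cast; rfl
  rw [bf, h, Nat.ascFactorial_eq_factorial_mul_choose]
  push_cast
  rw [mul_div_cancel_left₀]
  exact_mod_cast Nat.factorial_ne_zero c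

lemma bf_succ (c : ℕ) (k : ℂ) : k * bf c k = (c + 1) * bf (c + 1) k - (c + 1) * bf c k := by
  have h : (c.factorial : ℂ) ≠ 0 := by exact_mod_cast Nat.factorial_ne_zero c
  have h2 : (c : ℂ) + 1 ≠ 0 := by exact_mod_cast Nat.succ_ne_zero c
  rw [bf, bf, prod_range_succ, Nat.factorial_succ]
  push_cast
  field_simp
  ring

lemma sum_choose (c : Fin N → ℕ) (q : ℕ) :
    ∑ k ∈ piAntidiag (univ : Finset (Fin N)) q, ∏ a, ((k a + c a).choose (c a) : ℂ) =
    PowerSeries.coeff q ((PowerSeries.mk 1 : PowerSeries ℂ) ^ (∑ a, (c a + 1))) := by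
  rw [← prod_pow_eq_pow_sum, PowerSeries.coeff_prod]
  refine Finset.sum_nbij' (fun k => Finsupp.equivFunOnFinite.symm k) (fun k => ⇑k) ?_ ?_ ?_ ?_ ?_
  · intro k hk; rw [mem_piAntidiag] at hk
    rw [mem_finsuppAntidiag]; exact ⟨by simpa using hk.1, by simp⟩
  · intro k hk; rw [mem_finsuppAntidiag] at hk
    rw [mem_piAntidiag]; exact ⟨hk.1, by simp⟩
  · intro k _; rfl
  · intro k _; ext; rfl
  · intro k _
    refine prod_congr rfl fun a _ => ?_
    rw [PowerSeries.mk_one_pow_eq_mk_choose_add, PowerSeries.coeff_mk, add_comm]; rfl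

/-- good sequences -/
def GS (N : ℕ) (X : Type*) [AddCommGroup X] [Module ℂ X] : Submodule ℂ (ℕ → X) where
  carrier := {g | ∃ P ∈ PF X, (∀ q : ℕ, P q = g q) ∧ ∀ i : ℕ, 1 ≤ i → i < N → P (-i) = 0}
  zero_mem' := ⟨0, zero_mem _, by simp, by simp⟩
  add_mem' := by
    rintro g h ⟨P, hP, h1, h2⟩ ⟨P', hP', h1', h2'⟩
    exact ⟨P + P', add_mem hP hP', fun q => by simp [h1, h1'], fun i a b => by simp [h2 i a b, h2' i a b]⟩
  smul_mem' := by
    rintro c g ⟨P, hP, h1, h2⟩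
    exact ⟨c • P, Submodule.smul_mem _ _ hP, fun q => by simp [h1], fun i a b => by simp [h2 i a b]⟩

lemma GS_smul {g : ℕ → ℂ} (hg : g ∈ GS N ℂ) {X : Type*} [AddCommGroup X] [Module ℂ X] (v : X) :
    (fun q => g q • v) ∈ GS N X := by
  obtain ⟨P, hP, h1, h2⟩ := hg
  refine ⟨fun u => P u • v, ?_, fun q => by simp [h1], fun i a b => by simp [h2 i a b]⟩
  exact PF_comp hP (LinearMap.toSpanSingleton ℂ X v)

lemma bf_PF (c : ℕ) : bf c ∈ PF ℂ := by
  have := PF_mk (∏ j ∈ range c, (Polynomial.X + Polynomial.C (1 + j : ℂ))) ((c.factorial : ℂ)⁻¹)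
  convert this using 2 with u
  rw [bf, div_eq_mul_inv, Polynomial.eval_prod, smul_eq_mul]
  simp [add_assoc]

/-- tensor binomial functions -/
def BF (c : Fin N → ℕ) : (Fin N → ℤ) → ℂ := fun k => ∏ a, bf (c a) (k a)

lemma PolyL_le (hN : 1 ≤ N) {p : (Fin N → ℤ) → ℂ} (hp : p ∈ PolyL N) :
    p ∈ Submodule.span ℂ (Set.range (BF (N := N))) := by
  set S := Submodule.span ℂ (Set.range (BF (N := N))) with hS
  let St : Subalgebra ℂ ((Fin N → ℤ) → ℂ) :=
    { carrier := {f | ∀ s ∈ S, f * s ∈ S}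
      mul_mem' := fun {f g} hf hg s hs => by rw [mul_assoc]; exact hf _ (hg _ hs)
      add_mem' := fun {f g} hf hg s hs => by rw [add_mul]; exact add_mem (hf _ hs) (hg _ hs)
      algebraMap_mem' := fun c s hs => by
        rw [← Algebra.smul_def]; exact S.smul_mem _ hs }
  have h1 : PolyL N ≤ St := by
    refine Algebra.adjoin_le ?_
    rintro _ ⟨a, rfl⟩ s hs
    have : S ≤ S.comap (LinearMap.mulLeft ℂ (co a)) := by
      refine Submodule.span_le.2 ?_
      rintro _ ⟨c, rfl⟩
      show co a * BF c ∈ S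
      have : co a * BF c = ((c a : ℂ) + 1) • BF (Function.update c a (c a + 1)) - ((c a : ℂ) + 1) • BF c := by
        ext k
        simp only [Pi.mul_apply, co, BF, Pi.sub_apply, Pi.smul_apply, smul_eq_mul]
        rw [← mul_prod_erase univ _ (mem_univ a), ← mul_assoc, bf_succ,
          ← mul_prod_erase univ (fun x => bf (Function.update c a (c a + 1) x) (k x)) (mem_univ a)]
        have : ∏ x ∈ univ.erase a, bf (Function.update c a (c a + 1) x) (k x) = ∏ x ∈ univ.erase a, bf (c x) (k x) := by
          refine prod_congr rfl fun x hx => ?_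
          rw [Function.update_of_ne (ne_of_mem_erase hx)]
        rw [this, Function.update_self]
        ring
      rw [this]
      exact sub_mem (S.smul_mem _ (Submodule.subset_span ⟨_, rfl⟩)) (S.smul_mem _ (Submodule.subset_span ⟨_, rfl⟩))
    exact this hs
  have h2 : (1 : (Fin N → ℤ) → ℂ) ∈ S := Submodule.subset_span ⟨0, by ext k; simp [BF, bf]⟩
  simpa using h1 hp 1 h2

lemma PolyL_sum (hN : 1 ≤ N) {p : (Fin N → ℤ) → ℂ} (hp : p ∈ PolyL N) :
    (fun q : ℕ => ∑ k ∈ piAntidiag (univ : Finset (Fin N)) q, p (fun a => (k a : ℤ))) ∈ GS N ℂ := by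
  let L : ((Fin N → ℤ) → ℂ) →ₗ[ℂ] (ℕ → ℂ) :=
    { toFun := fun p q => ∑ k ∈ piAntidiag (univ : Finset (Fin N)) q, p (fun a => (k a : ℤ))
      map_add' := fun p p' => by ext; simp [sum_add_distrib]
      map_smul' := fun c p => by ext; simp [mul_sum] }
  have : Submodule.span ℂ (Set.range (BF (N := N))) ≤ (GS N ℂ).comap L := by
    refine Submodule.span_le.2 ?_
    rintro _ ⟨c, rfl⟩
    obtain ⟨C, hC⟩ : ∃ C, ∑ a, (c a + 1) = C + 1 := by
      refine ⟨∑ a, (c a + 1) - 1, ?_⟩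
      have : 1 ≤ ∑ a, (c a + 1) := by
        rw [sum_add_distrib]; simp; omega
      omega
    have hCN : N ≤ C + 1 := by
      rw [← hC, sum_add_distrib]; simp
    refine ⟨bf C, bf_PF C, fun q => ?_, fun i h1 h2 => ?_⟩
    · show _ = ∑ k ∈ piAntidiag (univ : Finset (Fin N)) q, BF c (fun a => (k a : ℤ))
      have h := sum_choose c q
      rw [hC, PowerSeries.mk_one_pow_eq_mk_choose_add, PowerSeries.coeff_mk] at h
      rw [bf_nat, add_comm, ← h]
      refine sum_congr rfl fun k _ => ?_
      unfold BF
      refine prod_congr rfl fun a _ => ?_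
      rw [← bf_nat]; simp
    · have : ∏ j ∈ range C, (-(i : ℂ) + 1 + j) = 0 := by
        refine prod_eq_zero (i := i - 1) (by simp; omega) ?_
        rw [Nat.cast_sub h1]; push_cast; ring
      rw [bf, this, zero_div]
  exact this (PolyL_le hN hp)

end Poly
end XXXAux

namespace XXXAux
open Finset

section MainR
variable {N : ℕ} {R M Q : Type*} [AddCommGroup R] [Module ℂ R] [AddCommGroup M] [Module ℂ M]

/-- matrix elements -/
def kerE (B : Module.End ℂ ((Fin N → ℕ) → R)) (k k' : Fin N → ℕ) : Module.End ℂ R :=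
  (LinearMap.proj k) ∘ₗ B ∘ₗ (LinearMap.single ℂ (fun _ => R) k')

lemma kerE_apply (B : Module.End ℂ ((Fin N → ℕ) → R)) (k k' : Fin N → ℕ) (r : R) :
    kerE B k k' r = B (Pi.single k' r) k := rfl

/-- elementary kernels -/
def kap (p : (Fin N → ℤ) → ℂ) (O : Module.End ℂ R) (γ : Fin N → ℤ) :
    (Fin N → ℕ) → (Fin N → ℕ) → Module.End ℂ R :=
  fun k k' => if (fun a => (k' a : ℤ)) = (fun a => (k a : ℤ)) + γ then p (fun a => k a) • O else 0

/-- polynomial kernels -/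
def KS (N : ℕ) (R : Type*) [AddCommGroup R] [Module ℂ R] :
    Submodule ℂ ((Fin N → ℕ) → (Fin N → ℕ) → Module.End ℂ R) :=
  Submodule.span ℂ {K | ∃ p ∈ PolyL N, ∃ O γ, K = kap p O γ}

lemma KS_one : kerE (1 : Module.End ℂ ((Fin N → ℕ) → R)) ∈ KS N R := by
  refine Submodule.subset_span ⟨1, one_mem _, 1, 0, ?_⟩
  ext k k' r
  rw [kerE_apply, kap, Module.End.one_apply]
  by_cases h : k = k'
  · subst h; simp
  · rw [Pi.single_eq_of_ne h, if_neg]; · rfl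
    intro h'
    apply h
    ext a
    have := congrFun h' a
    simp at this
    exact this.symm

/-- action on kernels -/
def kT (O : Module.End ℂ R) (b a : Fin N) : ((Fin N → ℕ) → (Fin N → ℕ) → Module.End ℂ R) →ₗ[ℂ]
    ((Fin N → ℕ) → (Fin N → ℕ) → Module.End ℂ R) where
  toFun K k k' := (k b : ℂ) • (O * K (k - eb b + eb a) k')
  map_add' K K' := by ext; simp [mul_add]
  map_smul' c K := by ext; simp [smul_comm c]

lemma KS_kT (O : Module.End ℂ R) (b a : Fin N) {K} (hK : K ∈ KS N R) : kT O b a K ∈ KS N R := by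
  have : KS N R ≤ (KS N R).comap (kT O b a) := by
    refine Submodule.span_le.2 ?_
    rintro _ ⟨p, hp, O', γ, rfl⟩
    let δ : Fin N → ℤ := fun c => (eb a c : ℤ) - eb b c
    refine Submodule.subset_span ⟨co b * (fun k => p (k + δ)), mul_mem (PolyL_co b) (PolyL_shift hp δ), O * O', δ + γ, ?_⟩
    funext k k'
    show (k b : ℂ) • (O * kap p O' γ (k - eb b + eb a) k') = _
    by_cases hb : k b = 0
    · rw [hb]; simp only [kap, Pi.mul_apply, co, hb]; simp
    · have h1 : (fun c => (((k - eb b + eb a) c : ℕ) : ℤ)) = (fun c => (k c : ℤ)) + δ := by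
        ext c
        simp only [Pi.add_apply, Pi.sub_apply, δ]
        have : eb b c ≤ k c := by
          by_cases hc : c = b
          · subst hc; simp; omega
          · simp [hc]
        rw [Nat.cast_add, Nat.cast_sub this]; ring
      simp only [kap, h1, add_assoc]
      split_ifs with h
      · simp [co, smul_smul]
      · simp
  exact this hK

variable (e : Q → Fin N → Fin N → Module.End ℂ R) (w : Q → ℂ) (qs : List Q)

lemma cal_concat {A : Type*} [Monoid A] (F : Q → A) (qs : List Q) (q : Q) :
    cal F (qs ++ [q]) = F q * cal F qs := by
  induction qs with
  | nil => simp [cal]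
  | cons q' qs ih => simp [cal, ih, mul_assoc]

lemma OmB_apply (q : Q) (F : (Fin N → ℕ) → R) (k) :
    OmB e q F k = ∑ b, ∑ a, (k b : ℂ) • e q b a (F (k - eb b + eb a)) := by
  simp only [OmB, Om, LinearMap.sum_apply, Finset.sum_apply, Module.End.mul_apply, bpwA_apply, by_apply,
    bd_apply, map_smul]

lemma KS_calB (x : ℂ) : kerE (calB e w qs x) ∈ KS N R := by
  unfold calB
  induction qs using List.reverseRecOn with
  | nil => exact KS_one
  | append_singleton qs q ih =>
    rw [cal_concat]
    set B := cal (fun q => algebraMap ℂ (Module.End ℂ ((Fin N → ℕ) → R)) (x + 1 - w q) + OmB e q) qs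
    have : kerE ((algebraMap ℂ _ (x + 1 - w q) + OmB e q) * B) =
        (x + 1 - w q) • kerE B + ∑ b, ∑ a, kT (e q b a) b a (kerE B) := by
      ext k k' r
      simp only [kerE_apply, Module.End.mul_apply, LinearMap.add_apply, Pi.add_apply, OmB_apply,
        Module.algebraMap_end_apply, Pi.smul_apply, LinearMap.smul_apply, Finset.sum_apply, LinearMap.sum_apply]
      rfl
    rw [this]
    exact add_mem (Submodule.smul_mem _ _ ih) (sum_mem fun b _ => sum_mem fun a _ => KS_kT _ _ _ ih)

lemma KS_trace (hN : 1 ≤ N) {K} (hK : K ∈ KS N R) :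
    (fun q : ℕ => ∑ k ∈ piAntidiag (univ : Finset (Fin N)) q, K k k) ∈ GS N (Module.End ℂ R) := by
  let L : ((Fin N → ℕ) → (Fin N → ℕ) → Module.End ℂ R) →ₗ[ℂ] (ℕ → Module.End ℂ R) :=
    { toFun := fun K q => ∑ k ∈ piAntidiag (univ : Finset (Fin N)) q, K k k
      map_add' := fun p p' => by ext; simp [sum_add_distrib]
      map_smul' := fun c p => by ext; simp [smul_sum] }
  have : KS N R ≤ (GS N (Module.End ℂ R)).comap L := by
    refine Submodule.span_le.2 ?_
    rintro _ ⟨p, hp, O, γ, rfl⟩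
    show (fun q : ℕ => ∑ k ∈ piAntidiag (univ : Finset (Fin N)) q, kap p O γ k k) ∈ GS N (Module.End ℂ R)
    by_cases h : γ = 0
    · subst h
      have := GS_smul (PolyL_sum hN hp) O
      convert this using 2 with q
      rw [sum_smul]
      refine sum_congr rfl fun k _ => ?_
      simp [kap]
    · convert zero_mem (GS N (Module.End ℂ R)) using 1
      ext q : 1
      refine sum_eq_zero fun k _ => ?_
      rw [kap, if_neg]
      intro h'
      apply h
      exact (left_eq_add.1 h')
  exact this hK

lemma symT_eq (x : ℂ) (s : ℕ) (r : R) :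
    symT e w qs x s r = (∑ k ∈ piAntidiag (univ : Finset (Fin N)) s, kerE (calB e w qs x) k k) r := by
  rw [LinearMap.sum_apply]; rfl

theorem symT_poly (hN : 1 ≤ N) (x : ℂ) : ∃ P ∈ PF (Module.End ℂ R),
    (∀ (s : ℕ) r, P (x + s) r = symT e w qs x s r) ∧ ∀ i : ℕ, 1 ≤ i → i < N → P (x - i) = 0 := by
  obtain ⟨P, hP, h1, h2⟩ := KS_trace hN (KS_calB e w qs x)
  refine ⟨fun u => P (u + (-x)), PF_shift hP _, fun s r => ?_, fun i hi hi' => ?_⟩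
  · have := h1 s
    beta_reduce at this ⊢
    rw [symT_eq, ← this, show x + (s : ℂ) + -x = s by ring]
  · have := h2 i hi hi'
    beta_reduce at this ⊢
    rw [← this, show x - (i : ℂ) + -x = -i by ring]

lemma by_single (a : Fin N) (k : Fin N → ℕ) (r : R) :
    by' a (Pi.single k r) = ((k a : ℂ) + 1) • (Pi.single (k + eb a) r : (Fin N → ℕ) → R) := by
  ext j
  rw [by_apply, Pi.smul_apply]
  by_cases h : j = k + eb a
  · subst h; simp
  · rw [Pi.single_eq_of_ne h]
    by_cases hj : j a = 0
    · simp [hj]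
    · rw [Pi.single_eq_of_ne]; · simp
      intro h'
      apply h
      rw [← h']
      ext c; by_cases hc : c = a
      · subst hc; simp; omega
      · simp [hc]

lemma symT_cyc (B : Module.End ℂ ((Fin N → ℕ) → R)) (c f : Fin N) (s : ℕ) (r : R) :
    ∑ k ∈ piAntidiag (univ : Finset (Fin N)) s, B (by' f (bd c (Pi.single k r))) k =
    ∑ k ∈ piAntidiag (univ : Finset (Fin N)) s, by' f (bd c (B (Pi.single k r))) k := by
  have h1 : ∀ k : Fin N → ℕ, B (by' f (bd c (Pi.single k r))) k = if k c ≠ 0 then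
      (((k - eb c) f : ℂ) + 1) • B (Pi.single (k - eb c + eb f) r) k else 0 := by
    intro k
    rw [bd_single]
    by_cases h : k c = 0
    · simp [h]
    · rw [if_neg h, if_pos h, by_single, map_smul, Pi.smul_apply]
  have h2 : ∀ k : Fin N → ℕ, by' f (bd c (B (Pi.single k r))) k = if k f ≠ 0 then
      (k f : ℂ) • B (Pi.single k r) (k - eb f + eb c) else 0 := by
    intro k
    rw [by_apply, bd_apply]
    split_ifs with h
    · rfl
    · simp at h; simp [h]
  have aux : ∀ (k : Fin N → ℕ) (a b : Fin N), k a ≠ 0 → k - eb a + eb b - eb b + eb a = k := by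
    intro k a b h
    rw [add_tsub_cancel_right]
    ext c; by_cases hc : c = a
    · subst hc; simp; omega
    · simp [hc]
  have aux2 : ∀ (k : Fin N → ℕ) (a b : Fin N), k a ≠ 0 → ∑ c, (k - eb a + eb b) c = ∑ c, k c := by
    intro k a b h
    have e1 := congrArg (fun j => ∑ c, j c) (aux k a b h)
    simp only [add_tsub_cancel_right] at e1
    rw [← e1]
    simp only [Pi.add_apply, sum_add_distrib]
    simp
  simp only [h1, h2, ← sum_filter]
  refine Finset.sum_nbij' (fun k => k - eb c + eb f) (fun k => k - eb f + eb c) ?_ ?_ ?_ ?_ ?_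
  · intro k hk
    simp only [mem_filter, mem_piAntidiag] at hk ⊢
    refine ⟨⟨?_, by simp⟩, by simp⟩
    exact (aux2 k c f hk.2).trans hk.1.1
  · intro k hk
    simp only [mem_filter, mem_piAntidiag] at hk ⊢
    refine ⟨⟨?_, by simp⟩, by simp⟩
    exact (aux2 k f c hk.2).trans hk.1.1
  · intro k hk
    simp only [mem_filter] at hk
    exact aux k c f hk.2
  · intro k hk
    simp only [mem_filter] at hk
    exact aux k f c hk.2
  · intro k hk
    simp only [mem_filter] at hk
    rw [aux k c f hk.2]
    simp

lemma symT_inv [Fintype Q] (U : UnitFam e) (x : ℂ) (s : ℕ) (c f : Fin N) (r : R) :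
    symT e w qs x s ((∑ q, e q c f) r) = (∑ q, e q c f) (symT e w qs x s r) := by
  classical
  set E := ∑ q, e q c f with hE
  have h1 : ∀ q, Commute (bpwA E - by' f * bd c) (OmB e q) := by
    intro q
    have h2 := e_sub_yd_comm (e := fun a b => bpwA (e q a b)) (brel (X := R)) ((U.rel q).map bpwA)
      (fun a b c => bpwA_by _ _) (fun a b c => bpwA_bd _ _) c f
    have h3 : bpwA (N := N) E - by' f * bd c = (bpwA (e q c f) - by' f * bd c) + ∑ q' ∈ univ.erase q, bpwA (e q' c f) := by
      rw [hE, ← add_sum_erase univ _ (mem_univ q), map_add, map_sum]; abel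
    rw [h3]
    refine Commute.add_left h2 (Commute.sum_left _ _ _ fun q' hq' => ?_)
    unfold OmB Om
    refine Commute.sum_right _ _ _ fun b _ => Commute.sum_right _ _ _ fun a _ => ?_
    refine Commute.mul_right ?_ (Commute.mul_right (bpwA_by _ _) (bpwA_bd _ _))
    exact (U.comm _ _ (ne_of_mem_erase hq') _ _ _ _).map bpwA
  have h2 : Commute (calB e w qs x) (bpwA E - by' f * bd c) :=
    cal_comm fun q _ => (Algebra.commute_algebraMap_left _ _).add_left (h1 q).symm
  have h3 : ∀ F, calB e w qs x (bpwA E F) = bpwA E (calB e w qs x F) + calB e w qs x (by' f (bd c F)) -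
      by' f (bd c (calB e w qs x F)) := by
    intro F
    have := LinearMap.congr_fun h2.eq F
    simp only [Module.End.mul_apply, LinearMap.sub_apply, map_sub] at this
    rw [sub_eq_sub_iff_add_eq_add] at this
    rw [eq_sub_iff_add_eq, this]
  unfold symT
  rw [map_sum]
  have h4 : ∀ k, calB e w qs x (Pi.single k (E r)) k = E (calB e w qs x (Pi.single k r) k) +
     calB e w qs x (by' f (bd c (Pi.single k r))) k - by' f (bd c (calB e w qs x (Pi.single k r))) k := by
    intro k
    have : (Pi.single k (E r) : (Fin N → ℕ) → R) = bpwA E (Pi.single k r) := by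
      ext j
      rw [bpwA_apply]
      by_cases h : j = k
      · subst h; simp
      · simp [Pi.single_eq_of_ne h]
    rw [this, h3]; rfl
  simp only [h4, sum_sub_distrib, sum_add_distrib]
  rw [symT_cyc]; simp

lemma symT_zero (x : ℂ) (r : R) : symT e w qs x 0 r = (qs.map fun q => x + 1 - w q).prod • r := by
  have h : calB e w qs x (Pi.single 0 r) = (qs.map fun q => x + 1 - w q).prod • (Pi.single 0 r : (Fin N → ℕ) → R) := by
    unfold calB
    induction qs with
    | nil => simp [cal]
    | cons q qs ih =>
      have : OmB e q (Pi.single 0 r : (Fin N → ℕ) → R) = 0 := by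
        simp [OmB, Om, Module.End.mul_apply, bd_single]
      simp only [cal, Module.End.mul_apply, LinearMap.add_apply, this, Module.algebraMap_end_apply, add_zero,
        map_smul, ih, List.map_cons, List.prod_cons, smul_smul]
  have h0 : piAntidiag (univ : Finset (Fin N)) 0 = {0} := by
    ext k; simp [mem_piAntidiag, funext_iff]
  rw [symT, h0, sum_singleton, h]; simp

theorem main_R [Fintype Q] (hN : 1 ≤ N) (U : UnitFam e) (hq : qs.Nodup) (x : ℂ)
    (hx : ∀ q ∈ qs, ∀ j : ℤ, x + j ≠ w q) (ι : M →ₗ[ℂ] R) (hι : Function.Injective ι)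
    (T : ℂ → Matrix (Fin N) (Fin N) (Module.End ℂ M))
    (hT : ∀ j : ℤ, ∀ a b v, ι (T (x + j) a b v) = TR e w qs (x + j) a b (ι v))
    (G : Fin N → Fin N → Module.End ℂ M) (hG : ∀ a b v, ι (G a b v) = (∑ q, e q a b) (ι v)) :
    ∃ P ∈ PF (Module.End ℂ M), (∀ i : ℕ, 1 ≤ i → i < N → P (x - i) = 0) ∧
      (∃ c : ℂ, c ≠ 0 ∧ ∀ v, P x v = c • v) ∧
      (∀ s : ℕ, N ≤ s → ∀ v, Dgen T (fun u => P u v) (x + s) = 0) ∧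
      (∀ u a b, Commute (P u) (G a b)) := by
  obtain ⟨P, hP, hs, hv⟩ := symT_poly e w qs hN x
  obtain ⟨ρ, hρ⟩ := LinearMap.exists_leftInverse_of_injective ι (LinearMap.ker_eq_bot.2 hι)
  have hρ' : ∀ v, ρ (ι v) = v := fun v => LinearMap.congr_fun hρ v
  have vac_pw : ∀ v : M, pw ι (vac (N := N) v) = vac (ι v) := fun v => pw_single ι _ v
  have hPhi : ∀ (I : Finset (Fin N)) (s : ℕ) v, ι (Phi T (I.sort (· ≤ ·)) (x + s) (vac v) I) =
      Phi (TR e w qs) (I.sort (· ≤ ·)) (x + s) (vac (ι v)) I := by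
    intro I s v
    rw [← vac_pw, ← pw_Phi ι (TR e w qs) T]
    · rfl
    intro j _ a b v
    have := hT (s - j) a b v
    push_cast at this
    rwa [add_sub_assoc]
  have hst : ∀ s : ℕ, ∀ v : M, ∃ v', symT e w qs x s (ι v) = ι v' := by
    intro s
    induction s using Nat.strong_induction_on with
    | _ s ih =>
      intro v
      by_cases h0 : s = 0
      · subst h0; exact ⟨(qs.map fun q => x + 1 - w q).prod • v, by rw [symT_zero, map_smul]⟩
      · have h := symT_rec e w qs U hq x hx h0 (ι v)
        rw [← add_sum_erase univ _ (mem_univ ∅)] at h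
        have h1 : symT e w qs x s (ι v) = - ∑ I ∈ univ.erase (∅ : Finset (Fin N)), ((-1 : ℂ) ^ #I) • (if #I ≤ s then
      Phi (TR e w qs) (I.sort (· ≤ ·)) (x + s) (vac (symT e w qs x (s - #I) (ι v))) I else 0) := by
          rw [eq_neg_iff_add_eq_zero]
          convert h using 2
          simp [Phi, vac]
        have h2 : symT e w qs x s (ι v) ∈ LinearMap.range ι := by
          rw [h1]
          refine neg_mem (sum_mem fun I hI => Submodule.smul_mem _ _ ?_)
          have hI' : 0 < #I := card_pos.2 (nonempty_iff_ne_empty.2 (ne_of_mem_erase hI))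
          split_ifs with h5
          · obtain ⟨v', hv'⟩ := ih (s - #I) (by omega) v
            rw [hv', ← hPhi]
            exact LinearMap.mem_range_self _ _
          · exact zero_mem _
        obtain ⟨v', hv'⟩ := h2
        exact ⟨v', hv'.symm⟩
  let PM : ℂ → Module.End ℂ M := fun u => ρ ∘ₗ P u ∘ₗ ι
  have hPM : ∀ (s : ℕ) v, ι (PM (x + s) v) = symT e w qs x s (ι v) := by
    intro s v
    obtain ⟨v', hv'⟩ := hst s v
    show ι (ρ (P (x + s) (ι v))) = _
    rw [hs, hv', hρ']
  have hPF : PM ∈ PF (Module.End ℂ M) := by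
    let L : Module.End ℂ R →ₗ[ℂ] Module.End ℂ M :=
      { toFun := fun O => ρ ∘ₗ O ∘ₗ ι
        map_add' := fun O O' => by ext; simp
        map_smul' := fun O O' => by ext; simp }
    exact PF_comp hP L
  refine ⟨PM, hPF, ?_, ⟨(qs.map fun q => x + 1 - w q).prod, ?_, ?_⟩, ?_, ?_⟩
  · intro i h1 h2
    ext v
    simp [PM, hv i h1 h2]
  · rw [Ne, List.prod_eq_zero_iff]
    intro h
    simp only [List.mem_map] at h
    obtain ⟨q, hq, h⟩ := h
    have := hx q hq 1
    push_cast at this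
    exact this (sub_eq_zero.1 h)
  · intro v
    apply hι
    have := hPM 0 v
    simp only [Nat.cast_zero, add_zero] at this
    rw [this, symT_zero, map_smul]
  · intro s hsN v
    apply hι
    have h := symT_rec e w qs U hq x hx (by omega : s ≠ 0) (ι v)
    rw [map_zero, ← h, Dgen, map_sum]
    refine sum_congr rfl fun I _ => ?_
    have hI : #I ≤ s := le_trans (by simpa using card_le_univ I) hsN
    rw [if_pos hI, map_smul, hPhi]
    congr 4
    rw [← hPM, Nat.cast_sub hI, add_sub_assoc]
  · intro u a b
    have h1 : (fun u => PM u * G a b - G a b * PM u) ∈ PF (Module.End ℂ M) :=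
      PF_comp hPF (LinearMap.mulRight ℂ (G a b) - LinearMap.mulLeft ℂ (G a b))
    have := PF_eq_zero h1 _ (inf_shift x 0) (by
      rintro _ ⟨s, _, rfl⟩
      ext v
      apply hι
      simp only [LinearMap.sub_apply, Module.End.mul_apply, map_sub, hPM, hG, symT_inv e w qs U]
      simp) u
    exact sub_eq_zero.1 this

end MainR
end XXXAux

namespace XXXAux
open Finset

section Dexp
variable {N : ℕ} {R M : Type*} [AddCommGroup R] [Module ℂ R] [AddCommGroup M] [Module ℂ M]

/-- linear combination of creation operators -/
def psiv : (Fin N → ℂ) →ₗ[ℂ] Module.End ℂ (Finset (Fin N) → R) :=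
  ∑ b, (LinearMap.proj b : (Fin N → ℂ) →ₗ[ℂ] ℂ).smulRight (psi b : Module.End ℂ (Finset (Fin N) → R))

lemma psiv_apply (v : Fin N → ℂ) : psiv (R := R) v = ∑ b, v b • psi b := by
  simp [psiv]

lemma psiv_single (b : Fin N) : psiv (R := R) (Pi.single b 1) = psi b := by
  rw [psiv_apply, Finset.sum_eq_single b]
  · simp
  · intro c _ h; simp [Pi.single_eq_of_ne h]
  · simp

lemma psiv_sq (v : Fin N → ℂ) : psiv (R := R) v * psiv v = 0 := by
  have h : psiv (R := R) v * psiv v = - (psiv (R := R) v * psiv v) := by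
    simp only [psiv_apply, Finset.sum_mul_sum]
    conv_rhs => rw [Finset.sum_comm]
    simp only [← Finset.sum_neg_distrib]
    refine sum_congr rfl fun b _ => sum_congr rfl fun c _ => ?_
    rw [smul_mul_smul_comm, smul_mul_smul_comm, frel.pp b c, smul_neg, mul_comm]
  have h2 : (2 : ℂ) • (psiv (R := R) v * psiv v) = 0 := by
    rw [two_smul]; nth_rewrite 1 [h]; simp
  exact (smul_eq_zero.1 h2).resolve_left two_ne_zero

/-- alternating map -/
def psialt (N : ℕ) (R : Type*) [AddCommGroup R] [Module ℂ R] :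
    (Fin N → ℂ) [⋀^Fin N]→ₗ[ℂ] Module.End ℂ (Finset (Fin N) → R) :=
  (ExteriorAlgebra.lift ℂ ⟨psiv, psiv_sq⟩).toLinearMap.compAlternatingMap (ExteriorAlgebra.ιMulti ℂ N)

lemma psialt_apply (b : Fin N → Fin N) :
    psialt N R (fun i => Pi.single (b i) 1) = psil (List.ofFn b) := by
  simp only [psialt, LinearMap.compAlternatingMap_apply, ExteriorAlgebra.ιMulti_apply, AlgHom.toLinearMap_apply,
    map_list_prod, List.map_ofFn, psil]
  congr 2
  ext i : 1
  simp [psiv_single]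

lemma psil_univ (σ : Equiv.Perm (Fin N)) (r : R) :
    psil (List.ofFn σ) (vac r) univ = (Equiv.Perm.sign σ : ℤ) • r := by
  have h := (psialt N R).map_perm (fun i => Pi.single i 1) σ
  have h1 := psialt_apply (R := R) σ
  have h2 := psialt_apply (R := R) (id : Fin N → Fin N)
  have h3 : ((fun i => Pi.single i 1 : Fin N → Fin N → ℂ) ∘ ⇑σ) = fun i => Pi.single (σ i) 1 := rfl
  rw [h3, h1] at h
  simp only [id] at h2
  rw [h, h2]
  have h4 : psil (List.ofFn fun i : Fin N => i) (vac r) = Pi.single univ r := by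
    rw [psil_sorted]
    · congr 1; ext i; simp
    · rw [List.pairwise_ofFn]; exact fun _ _ h => h
  rw [Units.smul_def]
  show (((Equiv.Perm.sign σ : ℤˣ) : ℤ) • (psil (List.ofFn fun i : Fin N => i)) (vac r)) univ = _
  rw [h4, Pi.smul_apply]; simp

lemma psil_zero (b : Fin N → Fin N) (hb : ¬ Function.Injective b) :
    psil (R := R) (List.ofFn b) = 0 := by
  rw [← psialt_apply]
  apply AlternatingMap.map_eq_zero_of_not_injective
  intro h
  apply hb
  intro i j hij
  apply h
  simp [hij]

lemma prod_PsiT {n : ℕ} (X : Fin n → Fin N → Module.End ℂ R) :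
    (List.ofFn fun i => ∑ b, psi b * pwA (X i b)).prod =
      ∑ b : Fin n → Fin N, psil (List.ofFn b) * pwA (List.ofFn fun i => X i (b i)).prod := by
  induction n with
  | zero => simp [psil]
  | succ n ih =>
    rw [List.ofFn_succ, List.prod_cons, ih, Finset.sum_mul_sum, ← (Fin.consEquiv fun _ => Fin N).sum_comp,
      Fintype.sum_prod_type]
    refine sum_congr rfl fun c _ => sum_congr rfl fun b _ => ?_
    have h : Commute (pwA (X 0 c)) (psil (List.ofFn b)) := by
      refine Commute.list_prod_right _ _ fun y hy => ?_
      simp only [List.mem_map] at hy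
      obtain ⟨a, _, rfl⟩ := hy
      exact pwA_psi _ _
    simp only [Fin.consEquiv_apply, List.ofFn_succ, Fin.cons_zero, Fin.cons_succ, List.prod_cons, map_mul]
    rw [mul_assoc, ← mul_assoc (pwA (X 0 c)), h.eq]
    simp [psil, mul_assoc]

lemma cdet (X : Matrix (Fin N) (Fin N) (Module.End ℂ R)) (r : R) :
    (List.ofFn fun a => PsiT X a).prod (vac r) univ =
      ∑ σ : Equiv.Perm (Fin N), (Equiv.Perm.sign σ : ℤ) • (List.ofFn fun a => X a (σ a)).prod r := by
  have h := prod_PsiT (fun a b => X a b)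
  simp only [PsiT]
  rw [h, LinearMap.sum_apply, Finset.sum_apply]
  have h1 : ∀ b : Fin N → Fin N, (psil (List.ofFn b) * pwA (List.ofFn fun i => X i (b i)).prod :
      Module.End ℂ (Finset (Fin N) → R)) (vac r) univ =
      psil (List.ofFn b) (vac ((List.ofFn fun i => X i (b i)).prod r)) univ := by
    intro b
    rw [Module.End.mul_apply, vac, pwA_single]; rfl
  simp only [h1]
  symm
  refine Finset.sum_of_injOn (fun σ : Equiv.Perm (Fin N) => (σ : Fin N → Fin N)) ?_ ?_ ?_ ?_
  · intro σ _ τ _ h; exact DFunLike.coe_injective h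
  · intro _ _; simp
  · intro b _ hb
    rw [psil_zero]; · rfl
    intro hi
    apply hb
    exact ⟨Equiv.ofBijective b (Finite.injective_iff_bijective.1 hi), by simp, rfl⟩
  · intro σ _
    rw [psil_univ]

/-- expansion data -/
def expL : List (Fin N) → List (ℂ × List (Fin N) × List (Fin N))
  | [] => [(1, [], [])]
  | a :: L => (expL L).map (fun t => (t.1, a :: t.2.1, t.2.2)) ++
      (expL L).map (fun t => (-(-1) ^ t.2.1.length * t.1, t.2.1, a :: t.2.2))

lemma list_sum_mul_left' {A ι : Type*} [Ring A] (x : A) (l : List ι) (f : ι → A) :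
    x * (l.map f).sum = (l.map fun i => x * f i).sum := by
  induction l with
  | nil => simp
  | cons a l ih => simp [mul_add, ih]

section
variable {A : Type*} [Ring A] [Algebra ℂ A] (p Y : Fin N → A)

lemma anti_prod (h : ∀ a b, Y a * p b = - (p b * Y a)) (a : Fin N) (C : List (Fin N)) :
    Y a * (C.map p).prod = ((-1 : ℂ) ^ C.length) • ((C.map p).prod * Y a) := by
  induction C with
  | nil => simp
  | cons b C ih =>
    simp only [List.map_cons, List.prod_cons, List.length_cons, pow_succ]
    rw [← mul_assoc, h, neg_mul, mul_assoc, ih, mul_smul_comm, ← smul_neg, mul_assoc]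
    rw [mul_smul]
    simp

lemma exp_prod (h : ∀ a b, Y a * p b = - (p b * Y a)) (L : List (Fin N)) :
    (L.map fun a => p a - Y a).prod =
      ((expL L).map fun t => t.1 • ((t.2.1.map p).prod * (t.2.2.map Y).prod)).sum := by
  induction L with
  | nil => simp [expL]
  | cons a L ih =>
    simp only [List.map_cons, List.prod_cons, ih, expL, List.map_append, List.sum_append, List.map_map]
    rw [sub_mul, list_sum_mul_left', sub_eq_add_neg]
    congr 1
    · congr 1
      refine List.map_congr_left fun t _ => ?_
      simp [mul_assoc]
    · rw [← neg_mul, list_sum_mul_left']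
      congr 1
      refine List.map_congr_left fun t _ => ?_
      simp only [Function.comp, List.map_cons, List.prod_cons]
      rw [mul_smul_comm, neg_mul, ← mul_assoc, anti_prod p Y h, smul_mul_assoc, mul_assoc, smul_neg, smul_smul,
        ← neg_smul]
      congr 1; ring

lemma exp_p (h : ∀ a b, p a * p b = - (p b * p a)) (L : List (Fin N)) : ∀ t ∈ expL L,
    t.1 • ((t.2.1.map p).prod * (t.2.2.map p).prod) = ((-1 : ℂ) ^ t.2.2.length) • (L.map p).prod := by
  induction L with
  | nil => simp [expL]
  | cons a L ih =>
    intro t ht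
    simp only [expL, List.mem_append, List.mem_map] at ht
    rcases ht with ⟨t, ht, rfl⟩ | ⟨t, ht, rfl⟩
    · simp only [List.map_cons, List.prod_cons]
      rw [mul_assoc, ← mul_smul_comm, ih t ht, mul_smul_comm]
    · simp only [List.map_cons, List.prod_cons, List.length_cons, pow_succ]
      have h1 := anti_prod p p h a t.2.1
      have h2 : (t.2.1.map p).prod * p a = ((-1 : ℂ) ^ t.2.1.length) • (p a * (t.2.1.map p).prod) := by
        rw [h1, smul_smul, ← mul_pow]; simp
      rw [← mul_assoc, h2, smul_mul_assoc, smul_smul, mul_assoc (p a)]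
      have h3 : -(-1 : ℂ) ^ t.2.1.length * t.1 * (-1) ^ t.2.1.length = (-1) * t.1 := by
        have : (-1 : ℂ) ^ t.2.1.length * (-1) ^ t.2.1.length = 1 := by rw [← mul_pow]; simp
        linear_combination (-t.1) * this
      rw [h3, mul_smul, ← mul_smul_comm, ih t ht, mul_smul_comm, smul_smul, mul_comm]
end

lemma exp_sub (L : List (Fin N)) : ∀ t ∈ expL L, t.2.1.Sublist L ∧ t.2.2.Sublist L ∧
    L.Perm (t.2.1 ++ t.2.2) := by
  induction L with
  | nil => simp [expL]
  | cons a L ih =>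
    intro t ht
    simp only [expL, List.mem_append, List.mem_map] at ht
    rcases ht with ⟨t, ht, rfl⟩ | ⟨t, ht, rfl⟩
    · obtain ⟨h1, h2, h3⟩ := ih t ht
      exact ⟨h1.cons_cons a, h2.cons a, by simpa using h3⟩
    · obtain ⟨h1, h2, h3⟩ := ih t ht
      exact ⟨h1.cons a, h2.cons_cons a, (List.Perm.cons a h3).trans List.perm_middle.symm⟩

lemma exp_map (L : List (Fin N)) : (expL L).map (fun t => t.2.2) = L.sublists' := by
  induction L with
  | nil => simp [expL]
  | cons a L ih =>
    rw [List.sublists'_cons, ← ih]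
    simp [expL, List.map_map, Function.comp_def]

lemma sub_sum {X : Type*} [AddCommMonoid X] (g : Finset (Fin N) → X) (L : List (Fin N)) (hL : L.Nodup) :
    (L.sublists'.map fun l => g l.toFinset).sum = ∑ I ∈ L.toFinset.powerset, g I := by
  induction L generalizing g with
  | nil => simp
  | cons a L ih =>
    rw [List.nodup_cons] at hL
    rw [List.sublists'_cons, List.toFinset_cons, sum_powerset_insert (by simpa using hL.1), ← ih g hL.2,
      ← ih (fun I => g (insert a I)) hL.2]
    simp [List.map_map, Function.comp_def]

/-- sign of removing a list -/
def kp : List (Fin N) → Finset (Fin N) → ℂ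
  | [], _ => 1
  | a :: C, K => sg a K * kp C (K.erase a)

lemma psil_kp (C : List (Fin N)) (hC : C.Nodup) : ∀ (K : Finset (Fin N)) (hK : ∀ a ∈ C, a ∈ K)
    (G : Finset (Fin N) → R), psil C G K = kp C K • G (K \ C.toFinset) := by
  induction C with
  | nil => intro K _ G; simp [psil, kp]
  | cons a C ih =>
    intro K hK G
    rw [List.nodup_cons] at hC
    have h1 : psil (a :: C) G = psi a (psil C G) := by
      simp [psil, Module.End.mul_apply]
    rw [h1, psi_apply, if_pos (hK a (by simp)), ih hC.2, kp, mul_smul]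
    · congr 3
      ext x; simp; tauto
    · intro b hb
      rw [mem_erase]
      exact ⟨by rintro rfl; exact hC.1 hb, hK b (by simp [hb])⟩

lemma PsiT_psi (Y : Matrix (Fin N) (Fin N) (Module.End ℂ R)) (a b : Fin N) :
    PsiT Y a * psi b = - (psi b * PsiT Y a) := by
  simp only [PsiT, Finset.sum_mul, Finset.mul_sum, ← Finset.sum_neg_distrib]
  refine sum_congr rfl fun c _ => ?_
  rw [mul_assoc, (pwA_psi _ _).eq, ← mul_assoc, ← mul_assoc, frel.pp]
  first | rfl | exact neg_mul (psi b * psi c) (pwA (Y a c)) | exact neg_mul (psi c * psi b) (pwA (Y a c)) | simp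

lemma expand_univ (Y : Matrix (Fin N) (Fin N) (Module.End ℂ R)) (r : R) :
    (((List.finRange N).map fun a => psi a - PsiT Y a).prod : Module.End ℂ (Finset (Fin N) → R)) (vac r) univ =
      ∑ I : Finset (Fin N), ((-1 : ℂ) ^ #I) •
        (((I.sort (· ≤ ·)).map (PsiT Y)).prod : Module.End ℂ (Finset (Fin N) → R)) (vac r) I := by
  rw [exp_prod psi (PsiT Y) (PsiT_psi Y)]
  have hsort : (List.finRange N).Pairwise (· < ·) := List.pairwise_lt_finRange N
  have h1 : ∀ t ∈ expL (List.finRange N), (t.1 • ((t.2.1.map psi).prod * (t.2.2.map (PsiT Y)).prod) :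
      Module.End ℂ (Finset (Fin N) → R)) (vac r) univ =
      (fun I : Finset (Fin N) => ((-1 : ℂ) ^ #I) • ((I.sort (· ≤ ·)).map (PsiT Y)).prod (vac r) I) t.2.2.toFinset := by
    intro t ht
    obtain ⟨hc, hi, hp⟩ := exp_sub _ t ht
    have hnc : t.2.1.Nodup := hc.nodup (List.nodup_finRange N)
    have hni : t.2.2.Nodup := hi.nodup (List.nodup_finRange N)
    have hsi : t.2.2.Pairwise (· < ·) := hsort.sublist hi
    have hsort' : t.2.2.toFinset.sort (· ≤ ·) = t.2.2 :=
      List.toFinset_sort (· ≤ ·) hni |>.2 (hsi.imp le_of_lt)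
    have hdiff : univ \ t.2.1.toFinset = t.2.2.toFinset := by
      have hnd : (t.2.1 ++ t.2.2).Nodup := hp.nodup_iff.1 (List.nodup_finRange N)
      rw [List.nodup_append'] at hnd
      ext x
      have hx : x ∈ t.2.1 ++ t.2.2 := hp.mem_iff.1 (List.mem_finRange x)
      simp only [mem_sdiff, mem_univ, true_and, List.mem_toFinset]
      rw [List.mem_append] at hx
      constructor
      · intro h; exact hx.resolve_left h
      · intro h h'; exact hnd.2.2 h' h
    have hcoef : t.1 * kp t.2.1 univ = (-1) ^ t.2.2.length := by
      have := exp_p psi (frel (N := N) (X := ℂ)).pp _ t ht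
      have := congrFun (LinearMap.congr_fun this (vac 1)) univ
      have e1 : ((List.finRange N).map psi).prod (vac (1 : ℂ)) (univ : Finset (Fin N)) = 1 := by
        have := psil_sorted (R := ℂ) _ hsort 1
        rw [psil] at this
        rw [this]; simp
      have e2 := psil_kp (R := ℂ) t.2.1 hnc univ (by simp) (psil t.2.2 (vac 1))
      rw [psil_sorted _ hsi, hdiff, Pi.single_eq_same, ← psil_sorted (R := ℂ) _ hsi] at e2
      simp only [LinearMap.smul_apply, Pi.smul_apply, Module.End.mul_apply, smul_eq_mul] at this e2
      rw [e1] at this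
      simp only [psil, mul_one] at e2 this
      rw [e2] at this
      exact this
    have e3 := psil_kp t.2.1 hnc univ (by simp) ((t.2.2.map (PsiT Y)).prod (vac r))
    simp only [LinearMap.smul_apply, Pi.smul_apply, Module.End.mul_apply, hsort']
    rw [psil] at e3
    rw [e3, smul_smul, hcoef, hdiff, List.toFinset_card_of_nodup hni]
  have h2 : ((((expL (List.finRange N)).map fun t => t.1 • ((t.2.1.map psi).prod * (t.2.2.map (PsiT Y)).prod)).sum :
      Module.End ℂ (Finset (Fin N) → R)) (vac r)) univ =
      ((expL (List.finRange N)).map fun t => (t.1 • ((t.2.1.map psi).prod * (t.2.2.map (PsiT Y)).prod) :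
      Module.End ℂ (Finset (Fin N) → R)) (vac r) univ).sum := by
    generalize expL (List.finRange N) = l
    induction l with
    | nil => rfl
    | cons t l ih => simp only [List.map_cons, List.sum_cons, LinearMap.add_apply, Pi.add_apply, ih]
  rw [h2, List.map_congr_left h1]
  have h3 := sub_sum (fun I : Finset (Fin N) => ((-1 : ℂ) ^ #I) • ((I.sort (· ≤ ·)).map (PsiT Y)).prod (vac r) I)
    (List.finRange N) (List.nodup_finRange N)
  rw [← exp_map, List.map_map] at h3
  refine Eq.trans ?_ (h3.trans ?_)
  · rfl
  · congr 1
    ext I; simp [Finset.subset_iff]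

/-- shift operators on functions -/
def Ymat (T : ℂ → Matrix (Fin N) (Fin N) (Module.End ℂ M)) : Matrix (Fin N) (Fin N) (Module.End ℂ (ℂ → M)) :=
  fun a b =>
  { toFun := fun f u => T u a b (f (u - 1))
    map_add' := fun f g => by ext; simp
    map_smul' := fun c g => by ext; simp }

lemma Y_Phi (T : ℂ → Matrix (Fin N) (Fin N) (Module.End ℂ M)) (l : List (Fin N)) (f : ℂ → M) : ∀ u I,
    (l.map (PsiT (Ymat T))).prod (vac f) I u = Phi T l u (vac (f (u - l.length))) I := by
  induction l with
  | nil =>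
    intro u I
    simp only [List.map_nil, List.prod_nil, Module.End.one_apply, Phi, vac]
    by_cases h : I = ∅
    · subst h; simp
    · simp [Pi.single_eq_of_ne h]
  | cons a l ih =>
    intro u I
    simp only [List.map_cons, List.prod_cons, Module.End.mul_apply, Phi, List.length_cons]
    set F := (l.map (PsiT (Ymat T))).prod (vac f)
    have h1 : ∀ (F : Finset (Fin N) → ℂ → M) , PsiT (Ymat T) a F I u = PsiT (T u) a (fun J => F J (u - 1)) I := by
      intro F
      simp only [PsiT, LinearMap.sum_apply, Finset.sum_apply, Module.End.mul_apply, psi_apply]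
      refine sum_congr rfl fun b _ => ?_
      split_ifs
      · rfl
      · rfl
    rw [h1]
    refine congrFun (congrArg (PsiT (T u) a) ?_) I
    funext J
    rw [ih (u - 1) J]
    congr 3
    push_cast; ring_nf

lemma foldr_prod (l : List (Module.End ℂ R)) : ⇑l.prod = (l.map (fun g : Module.End ℂ R => (⇑g : R → R))).foldr (· ∘ ·) id := by
  induction l with
  | nil => rfl
  | cons g l ih => simp only [List.prod_cons, List.map_cons, List.foldr_cons, ← ih]; rfl

theorem Dgen_eq (T : ℂ → Matrix (Fin N) (Fin N) (Module.End ℂ M)) (Xo : Fin N → Fin N → (ℂ → M) → ℂ → M)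
    (hX : ∀ a b f u, Xo a b f u = (if a = b then f u else 0) - T u a b (f (u - 1))) (f : ℂ → M) (u : ℂ) :
    ∑ σ : Equiv.Perm (Fin N), ((Equiv.Perm.sign σ : ℤˣ) : ℤ) •
      (((List.ofFn fun a : Fin N => Xo a (σ a)).foldr (· ∘ ·) id) f u) = Dgen T f u := by
  let X : Matrix (Fin N) (Fin N) (Module.End ℂ (ℂ → M)) := fun a b => (if a = b then 1 else 0) - Ymat T a b
  have hX' : ∀ a b, Xo a b = ⇑(X a b) := by
    intro a b
    ext f u
    rw [hX]
    simp only [X, LinearMap.sub_apply, Pi.sub_apply]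
    congr 1
    split_ifs <;> rfl
  have h1 : ∀ σ : Equiv.Perm (Fin N), ((List.ofFn fun a : Fin N => Xo a (σ a)).foldr (· ∘ ·) id) f =
      (List.ofFn fun a => X a (σ a)).prod f := by
    intro σ
    rw [foldr_prod, List.map_ofFn]
    simp only [hX']
    rfl
  have h2 := cdet X f
  have h3 : ∀ a, PsiT X a = psi a - PsiT (Ymat T) a := by
    intro a
    simp only [PsiT, X, map_sub, mul_sub, sum_sub_distrib]
    congr 1
    rw [Finset.sum_eq_single a]
    · simp
    · intro b _ h; simp [h.symm]
    · simp
  simp only [h1]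
  have h4 : (∑ σ : Equiv.Perm (Fin N), (Equiv.Perm.sign σ : ℤ) • (List.ofFn fun a => X a (σ a)).prod f) u =
     ∑ σ : Equiv.Perm (Fin N), (Equiv.Perm.sign σ : ℤ) • (List.ofFn fun a => X a (σ a)).prod f u := by
    rw [Finset.sum_apply]; rfl
  rw [← h4, ← h2]
  simp only [h3, List.ofFn_eq_map]
  rw [expand_univ, Finset.sum_apply, Dgen]
  refine sum_congr rfl fun I _ => ?_
  rw [Pi.smul_apply, Y_Phi]
  simp

end Dexp
end XXXAux

namespace XXXAux
open Finset

section Fusion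
variable {N : ℕ} {R Q : Type*} [AddCommGroup R] [Module ℂ R]
variable (e : Q → Fin N → Fin N → Module.End ℂ R)

/-- permutation operator -/
def Pm (j l : Q) : Module.End ℂ R := ∑ x, ∑ y, e j x y * e l y x

variable {e}

lemma e_Pm (U : UnitFam e) {j l : Q} (h : j ≠ l) (a b : Fin N) :
    e l a b * Pm e j l = ∑ x, e j x b * e l a x := by
  have key : ∀ x y, e l a b * (e j x y * e l y x) = if b = y then e j x y * e l a x else 0 := by
    intro x y
    rw [← mul_assoc, (U.comm l j h.symm a b x y).eq, mul_assoc, U.rel l a b y x]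
    split_ifs <;> simp
  simp only [Pm, Finset.mul_sum, key]
  refine sum_congr rfl fun x _ => ?_
  simp

lemma Pm_e (U : UnitFam e) {j l : Q} (h : j ≠ l) (a b : Fin N) :
    Pm e j l * e j a b = e l a b * Pm e j l := by
  rw [e_Pm U h]
  have key : ∀ x y, (e j x y * e l y x) * e j a b = if y = a then e j x b * e l y x else 0 := by
    intro x y
    rw [mul_assoc, ← (U.comm j l h a b y x).eq, ← mul_assoc, U.rel j x y a b]
    split_ifs <;> simp
  simp only [Pm, Finset.sum_mul, key]
  refine sum_congr rfl fun x _ => ?_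
  simp

lemma Pm_symm (U : UnitFam e) {j l : Q} (h : j ≠ l) : Pm e j l = Pm e l j := by
  rw [Pm, Pm, Finset.sum_comm]
  refine sum_congr rfl fun x _ => sum_congr rfl fun y _ => (U.comm j l h _ _ _ _).eq

lemma Pm_comm (U : UnitFam e) {j l q : Q} (hj : q ≠ j) (hl : q ≠ l) (a b : Fin N) :
    Commute (Pm e j l) (e q a b) := by
  refine Commute.sum_left _ _ _ fun x _ => Commute.sum_left _ _ _ fun y _ => ?_
  exact (U.comm j q hj.symm _ _ _ _).mul_left (U.comm l q hl.symm _ _ _ _)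

lemma Pm_tot [Fintype Q] (U : UnitFam e) {j l : Q} (h : j ≠ l) (a b : Fin N) :
    Commute (Pm e j l) (∑ q, e q a b) := by
  classical
  rw [← Finset.sum_erase_add univ _ (Finset.mem_univ l),
    ← Finset.sum_erase_add _ _ (Finset.mem_erase.2 ⟨h, Finset.mem_univ j⟩), add_assoc]
  refine Commute.add_right (Commute.sum_right _ _ _ fun q hq => ?_) ?_
  · simp only [mem_erase, mem_univ, and_true] at hq
    exact Pm_comm U hq.1 hq.2 a b
  · show _ * _ = _ * _
    have h2 := Pm_e U h.symm a b
    rw [← Pm_symm U h] at h2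
    rw [mul_add, add_mul, Pm_e U h, h2, add_comm]

variable (e)
/-- Jucys-Murphy eigenvector condition -/
def JM (c : Q → ℂ) : List Q → R → Prop
  | [], _ => True
  | l :: L, v => JM c L v ∧ (L.map fun j => Pm e j l).sum v = c l • v

lemma JM_of_comm (c : Q → ℂ) (L : List Q) (v : R) (A : Module.End ℂ R)
    (hA : ∀ j ∈ L, ∀ l ∈ L, j ≠ l → Commute (Pm e j l) A) (hL : L.Nodup) (h : JM e c L v) : JM e c L (A v) := by
  induction L with
  | nil => trivial
  | cons l L ih =>
    rw [List.nodup_cons] at hL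
    refine ⟨ih (fun j hj l hl => hA j (by simp [hj]) l (by simp [hl])) hL.2 h.1, ?_⟩
    have hc : Commute (L.map fun j => Pm e j l).sum A := by
      refine Commute.list_sum_left _ _ fun y hy => ?_
      simp only [List.mem_map] at hy
      obtain ⟨j, hj, rfl⟩ := hy
      exact hA j (by simp [hj]) l (by simp) (by rintro rfl; exact hL.1 hj)
    rw [← Module.End.mul_apply, hc.eq, Module.End.mul_apply, h.2, map_smul]

lemma JM_lin (c : Q → ℂ) (L : List Q) : ∃ S : Submodule ℂ R, ∀ v, v ∈ S ↔ JM e c L v := by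
  induction L with
  | nil => exact ⟨⊤, fun v => by simp [JM]⟩
  | cons l L ih =>
    obtain ⟨S, hS⟩ := ih
    refine ⟨S ⊓ LinearMap.ker ((L.map fun j => Pm e j l).sum - c l • 1), fun v => ?_⟩
    rw [Submodule.mem_inf, hS, JM, LinearMap.mem_ker, LinearMap.sub_apply, sub_eq_zero]
    rfl

variable {e}

theorem fusion (U : UnitFam e) (c : Q → ℂ) (u : ℂ) (hu : u ≠ 0) (L : List Q) (hL : L.Nodup)
    (hc : ∀ l ∈ L, u + c l ≠ 0) (v : R) (h : JM e c L v) (a b : Fin N) :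
    (L.reverse.map fun q => LR e (fun q => - c q) q u).prod a b v =
      (if a = b then v else 0) + u⁻¹ • (L.map fun q => e q b a).sum v := by
  induction L generalizing v a b with
  | nil =>
    simp only [List.reverse_nil, List.map_nil, List.prod_nil, List.sum_nil, LinearMap.zero_apply, smul_zero, add_zero,
      Matrix.one_apply]
    split_ifs <;> rfl
  | cons l L ih =>
    rw [List.nodup_cons] at hL
    have hc' := fun l hl => hc l (List.mem_cons_of_mem _ hl)
    have hJ : ∀ x y, JM e c L (e l x y v) := fun x y => JM_of_comm e c L v (e l x y)
      (fun j hj k hk _ => Pm_comm U (by rintro rfl; exact hL.1 hj) (by rintro rfl; exact hL.1 hk) x y) hL.2 h.1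
    have hLc : ∀ c', (LR e (fun q => - c q) l u c' b) v = (if c' = b then v else 0) + (u + c l)⁻¹ • e l b c' v := by
      intro c'
      simp only [LR, LinearMap.add_apply, LinearMap.smul_apply, sub_neg_eq_add]
      congr 1
      split_ifs <;> rfl
    simp only [List.reverse_cons, List.map_append, List.prod_append, List.map_cons, List.map_nil, List.prod_cons,
      List.prod_nil, mul_one, List.sum_cons]
    rw [Matrix.mul_apply, LinearMap.sum_apply]
    simp only [Module.End.mul_apply, hLc, map_add, map_smul]
    rw [sum_add_distrib]
    have h1 : ∑ x, ((L.reverse.map fun q => LR e (fun q => - c q) q u).prod a x) (if x = b then v else 0) =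
        (if a = b then v else 0) + u⁻¹ • (L.map fun q => e q b a).sum v := by
      rw [Finset.sum_eq_single b]
      · rw [if_pos rfl, ih hL.2 hc' v h.1]
      · intro x _ hx; rw [if_neg hx, map_zero]
      · simp
    rw [h1]
    have h2 : ∀ x, ((L.reverse.map fun q => LR e (fun q => - c q) q u).prod a x) (e l b x v) =
       (if a = x then e l b x v else 0) + u⁻¹ • (L.map fun q => e q x a).sum (e l b x v) :=
      fun x => ih hL.2 hc' _ (hJ b x) a x
    simp only [h2]
    have h3 : ∑ x, (L.map fun q => e q x a).sum (e l b x v) = c l • e l b a v := by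
      rw [← map_smul, ← h.2, ← Module.End.mul_apply]
      have : ∑ x, (L.map fun q => e q x a).sum * (e l b x) = e l b a * (L.map fun j => Pm e j l).sum := by
        have hl := hL.1
        clear h hJ ih h1 h2 hc hc' hLc
        have hL2 := hL.2
        clear hL
        induction L with
        | nil => simp
        | cons j L ih' =>
          simp only [List.map_cons, List.sum_cons, add_mul, mul_add, sum_add_distrib]
          simp only [List.mem_cons, not_or] at hl
          rw [List.nodup_cons] at hL2
          rw [ih' hl.2 hL2.2, e_Pm U (Ne.symm hl.1)]
      rw [← this, LinearMap.sum_apply]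
      rfl
    simp only [smul_add, sum_add_distrib, ← Finset.smul_sum, h3]
    rw [Finset.sum_ite_eq univ a]
    simp only [mem_univ, if_true, LinearMap.add_apply, smul_add]
    have hne := hc l (by simp)
    have h4 : u⁻¹ = (u + c l)⁻¹ + (u + c l)⁻¹ * (u⁻¹ * c l) := by field_simp
    have h5 : u⁻¹ • e l b a v = (u + c l)⁻¹ • e l b a v + (u + c l)⁻¹ • u⁻¹ • c l • e l b a v := by
      rw [smul_smul, smul_smul, ← add_smul, mul_assoc, ← h4]
    rw [h5]
    abel

end Fusion
end XXXAux

namespace XXXAux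
open Finset

section Col
variable {N : ℕ}

lemma tot_rel {R Q : Type*} [AddCommGroup R] [Module ℂ R] [Fintype Q] {e : Q → Fin N → Fin N → Module.End ℂ R}
    (U : UnitFam e) (a b c d : Fin N) :
    (∑ q, e q a b) * (∑ q, e q c d) - (∑ q, e q c d) * (∑ q, e q a b) =
      (if b = c then (1 : ℂ) else 0) • (∑ q, e q a d) - (if d = a then (1 : ℂ) else 0) • (∑ q, e q c b) := by
  classical
  rw [Finset.sum_mul_sum, Finset.sum_mul_sum]
  rw [Finset.sum_comm (f := fun i j => e i c d * e j a b), ← Finset.sum_sub_distrib]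
  simp only [← Finset.sum_sub_distrib, Finset.smul_sum]
  refine sum_congr rfl fun q _ => ?_
  rw [Finset.sum_eq_single q]
  · rw [U.rel, U.rel]
    split_ifs <;> simp
  · intro q' _ h
    rw [(U.comm q q' h.symm a b c d).eq, sub_self]
  · simp

variable {B : Type} [Fintype B] [DecidableEq B]

/-- elementary operators on the tensor power, in coordinates -/
def eC (l : B) (a b : Fin N) : Module.End ℂ ((B → Fin N) → ℂ) where
  toFun w := fun i => if i l = a then w (Function.update i l b) else 0
  map_add' x y := by ext i; simp only [Pi.add_apply]; split_ifs <;> simp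
  map_smul' c x := by ext i; simp only [Pi.smul_apply, RingHom.id_apply]; split_ifs <;> simp

lemma eC_apply (l : B) (a b : Fin N) (w : (B → Fin N) → ℂ) (i : B → Fin N) :
    eC l a b w i = if i l = a then w (Function.update i l b) else 0 := rfl

lemma eC_fam : UnitFam (eC : B → Fin N → Fin N → Module.End ℂ ((B → Fin N) → ℂ)) where
  rel q a b c d := by
    refine LinearMap.ext fun w => ?_
    funext i
    rw [Module.End.mul_apply, eC_apply, eC_apply]
    simp only [Function.update_self, Function.update_idem]
    split_ifs with h1 h2 h2
    · rw [eC_apply, if_pos h1]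
    · rfl
    · rw [eC_apply, if_neg h1]
    · rfl
  comm q q' h a b c d := by
    show _ * _ = _ * _
    refine LinearMap.ext fun w => ?_
    funext i
    simp only [Module.End.mul_apply, eC_apply, Function.update_of_ne h, Function.update_of_ne h.symm,
      Function.update_comm h]
    split_ifs <;> rfl

lemma Pm_apply {j l : B} (h : j ≠ l) (w : (B → Fin N) → ℂ) (i : B → Fin N) :
    Pm eC j l w i = w (i ∘ Equiv.swap j l) := by
  simp only [Pm, LinearMap.sum_apply, Finset.sum_apply, Module.End.mul_apply, eC_apply, Function.update_of_ne h.symm]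
  rw [Finset.sum_eq_single (i j), Finset.sum_eq_single (i l)]
  · simp only [if_true]
    congr 1
    ext x
    by_cases hx : x = l
    · subst hx; simp
    · rw [Function.update_of_ne hx]
      by_cases hx' : x = j
      · subst hx'; simp
      · rw [Function.update_of_ne hx']; simp [Equiv.swap_apply_of_ne_of_ne hx' hx]
  · intro y _ hy; simp [hy.symm]
  · simp
  · intro x _ hx; simp [hx.symm]
  · simp

lemma eC_trace (l : B) (w : (B → Fin N) → ℂ) : ∑ x, eC l x x w = w := by
  funext i
  simp only [Finset.sum_apply, eC_apply]
  rw [Finset.sum_eq_single (i l)]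
  · simp
  · intro x _ hx; simp [hx.symm]
  · simp

variable (lam : Fin N → ℕ) (r : ℕ)

/-- boxes of the diagram -/
abbrev Box := Σ i : Fin r, {p : Fin N // i.1 < lam p}

variable {lam r}
/-- column matrix -/
def cA (f : Box lam r → Fin N) (i : Fin r) : Matrix {p : Fin N // i.1 < lam p} {p : Fin N // i.1 < lam p} ℂ :=
  fun p q => if f ⟨i, p⟩ = q.1 then 1 else 0

variable (lam r)
/-- highest weight vector -/
def wv (f : Box lam r → Fin N) : ℂ := ∏ i, (cA f i).det
variable {lam r}

lemma cA_update_ne (f : Box lam r → Fin N) {i i' : Fin r} (h : i' ≠ i) (p : {p : Fin N // i.1 < lam p}) (c : Fin N) :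
    cA (Function.update f ⟨i, p⟩ c) i' = cA f i' := by
  ext x y
  simp only [cA]
  rw [Function.update_of_ne]
  intro h'
  exact h (congrArg Sigma.fst h')

lemma cA_update (f : Box lam r → Fin N) (i : Fin r) (p : {p : Fin N // i.1 < lam p}) (c : Fin N) :
    cA (Function.update f ⟨i, p⟩ c) i = (cA f i).updateRow p (fun q => if c = q.1 then 1 else 0) := by
  ext x y
  by_cases h : x = p
  · subst h; simp [cA]
  · rw [Matrix.updateRow_ne h]
    simp only [cA]
    rw [Function.update_of_ne]
    intro h'
    simp only [Sigma.mk.injEq, heq_eq_eq, true_and] at h'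
    exact h h'

lemma wv_update (f : Box lam r → Fin N) (i : Fin r) (p : {p : Fin N // i.1 < lam p}) (c : Fin N) :
    wv lam r (Function.update f ⟨i, p⟩ c) =
      ((cA f i).updateRow p (fun q => if c = q.1 then 1 else 0)).det * ∏ i' ∈ univ.erase i, (cA f i').det := by
  rw [wv, ← Finset.mul_prod_erase univ _ (mem_univ i), cA_update]
  congr 1
  refine prod_congr rfl fun i' hi' => ?_
  rw [cA_update_ne _ (mem_erase.1 hi').1]

lemma wv_two (i : Fin r) (p : {p : Fin N // i.1 < lam p}) (a b : Fin N) (hb : ¬ i.1 < lam b) :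
    eC (⟨i, p⟩ : Box lam r) a b (wv lam r) = 0 := by
  funext f
  rw [eC_apply]
  split_ifs
  · rw [wv_update, Matrix.det_eq_zero_of_row_eq_zero p, zero_mul]; rfl
    intro q
    rw [Matrix.updateRow_self, if_neg]
    rintro rfl
    exact hb q.2
  · rfl

lemma wv_one (i : Fin r) (a b : Fin N) (ha : i.1 < lam a) :
    ∑ p, eC (⟨i, p⟩ : Box lam r) a b (wv lam r) = if a = b then wv lam r else 0 := by
  by_cases hb : i.1 < lam b
  · funext f
    simp only [Finset.sum_apply, eC_apply, wv_update]
    have h1 : ∀ p : {p : Fin N // i.1 < lam p}, (if f ⟨i, p⟩ = a then ((cA f i).updateRow p (fun q => if b = q.1 then 1 else 0)).det *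
        ∏ i' ∈ univ.erase i, (cA f i').det else 0) =
        ((cA f i).adjugate ⟨b, hb⟩ p * (cA f i) p ⟨a, ha⟩) * ∏ i' ∈ univ.erase i, (cA f i').det := by
      intro p
      have h2 : (fun q : {p : Fin N // i.1 < lam p} => if b = q.1 then (1 : ℂ) else 0) = Pi.single ⟨b, hb⟩ 1 := by
        ext q
        simp only [Pi.single_apply]
        congr 1
        rw [Subtype.ext_iff]
        exact propext eq_comm
      rw [Matrix.adjugate_apply, h2]
      simp only [cA]
      split_ifs <;> simp
    simp only [h1]
    rw [← Finset.sum_mul, ← Matrix.mul_apply, Matrix.adjugate_mul, Matrix.smul_apply, Matrix.one_apply]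
    by_cases hab : a = b
    · subst hab
      simp only [if_true, smul_eq_mul, mul_one]
      rw [Finset.mul_prod_erase univ (fun i => (cA f i).det) (mem_univ i)]
      rfl
    · rw [if_neg (by simpa using Ne.symm hab), if_neg hab]; simp
  · rw [if_neg (by rintro rfl; exact hb ha)]
    exact Finset.sum_eq_zero fun p _ => wv_two i p a b hb

lemma wv_three (i : Fin r) (p p' : {p : Fin N // i.1 < lam p}) (h : p' ≠ p) :
    Pm eC (⟨i, p'⟩ : Box lam r) ⟨i, p⟩ (wv lam r) = - wv lam r := by
  have hne : (⟨i, p'⟩ : Box lam r) ≠ ⟨i, p⟩ := by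
    intro h'
    simp only [Sigma.mk.injEq, heq_eq_eq, true_and] at h'
    exact h h'
  funext f
  rw [Pm_apply hne, Pi.neg_apply, wv, wv, ← Finset.mul_prod_erase univ _ (mem_univ i),
    ← Finset.mul_prod_erase univ (fun i => (cA f i).det) (mem_univ i), ← neg_mul]
  congr 1
  · have : cA (f ∘ Equiv.swap (⟨i, p'⟩ : Box lam r) ⟨i, p⟩) i = (cA f i).submatrix (Equiv.swap p' p) id := by
      ext x y
      simp only [cA, Function.comp, Matrix.submatrix_apply, id]
      congr 3
      by_cases h1 : x = p'
      · subst h1; simp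
      · by_cases h2 : x = p
        · subst h2; simp
        · rw [Equiv.swap_apply_of_ne_of_ne, Equiv.swap_apply_of_ne_of_ne h1 h2]
          · simpa using h1
          · simpa using h2
    rw [this, Matrix.det_permute, Equiv.Perm.sign_swap h]
    simp
  · refine prod_congr rfl fun i' hi' => ?_
    congr 1
    ext x y
    simp only [cA, Function.comp]
    have hi := (mem_erase.1 hi').1
    have hs : Equiv.swap (⟨i, p'⟩ : Box lam r) ⟨i, p⟩ ⟨i', x⟩ = ⟨i', x⟩ := by
      apply Equiv.swap_apply_of_ne_of_ne
      · intro h'; exact hi (congrArg Sigma.fst h')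
      · intro h'; exact hi (congrArg Sigma.fst h')
    simp only [hs]

lemma wv_ne : wv lam r ≠ 0 := by
  intro h
  have h1 := congrFun h (fun l => l.2.1)
  have h2 : ∀ i : Fin r, cA (fun l : Box lam r => l.2.1) i = 1 := by
    intro i
    ext p q
    simp only [cA, Matrix.one_apply, Subtype.ext_iff]
  simp only [wv, h2, Matrix.det_one, prod_const_one, Pi.zero_apply] at h1
  exact one_ne_zero h1

lemma wv_four (i i' : Fin r) (hi : i' < i) (p : {p : Fin N // i.1 < lam p}) :
    ∑ p' : {p : Fin N // i'.1 < lam p}, Pm eC (⟨i', p'⟩ : Box lam r) ⟨i, p⟩ (wv lam r) = wv lam r := by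
  have h1 : ∀ p' : {p : Fin N // i'.1 < lam p}, Pm eC (⟨i', p'⟩ : Box lam r) ⟨i, p⟩ (wv lam r) =
      ∑ x, ∑ y, eC (⟨i, p⟩ : Box lam r) y x (eC (⟨i', p'⟩ : Box lam r) x y (wv lam r)) := by
    intro p'
    have hne : (⟨i', p'⟩ : Box lam r) ≠ ⟨i, p⟩ := by
      intro h'; exact hi.ne (congrArg Sigma.fst h')
    simp only [Pm, LinearMap.sum_apply]
    refine sum_congr rfl fun x _ => sum_congr rfl fun y _ => ?_
    rw [(eC_fam.comm _ _ hne x y y x).eq]; rfl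
  simp only [h1]
  rw [Finset.sum_comm]
  conv_lhs => enter [2, x]; rw [Finset.sum_comm]
  simp only [← map_sum]
  have h2 : ∀ x, ∑ y, eC (⟨i, p⟩ : Box lam r) y x (∑ p', eC (⟨i', p'⟩ : Box lam r) x y (wv lam r)) =
      eC (⟨i, p⟩ : Box lam r) x x (wv lam r) := by
    intro x
    by_cases hx : i'.1 < lam x
    · simp only [wv_one i' x _ hx]
      rw [Finset.sum_eq_single x]
      · simp
      · intro y _ hy; rw [if_neg (Ne.symm hy), map_zero]
      · simp
    · have hx' : ¬ i.1 < lam x := fun h => hx (lt_trans hi h)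
      rw [wv_two i p x x hx']
      refine Finset.sum_eq_zero fun y _ => ?_
      rw [map_sum]
      refine Finset.sum_eq_zero fun p' _ => ?_
      have hne : (⟨i', p'⟩ : Box lam r) ≠ ⟨i, p⟩ := by
        intro h'; exact hi.ne (congrArg Sigma.fst h')
      rw [← Module.End.mul_apply, ← (eC_fam.comm _ _ hne x y y x).eq, Module.End.mul_apply, wv_two i p y x hx', map_zero]
  simp only [h2]
  exact eC_trace _ _

lemma JM_of_set {R Q : Type*} [AddCommGroup R] [Module ℂ R] [Fintype Q] (e : Q → Fin N → Fin N → Module.End ℂ R)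
    (key : Q → ℕ) (c : Q → ℂ) (v : R) (h : ∀ l, ∑ j with key j < key l, Pm e j l v = c l • v) (L : List Q)
    (hL : L.Pairwise fun x y => key y < key x) (hlow : ∀ x ∈ L, ∀ y, key y < key x → y ∈ L) : JM e c L v := by
  classical
  induction L with
  | nil => trivial
  | cons l L ih =>
    rw [List.pairwise_cons] at hL
    refine ⟨ih hL.2 ?_, ?_⟩
    · intro x hx y hy
      have := hlow x (by simp [hx]) y hy
      simp only [List.mem_cons] at this
      rcases this with rfl | h'
      · exact absurd (hL.1 x hx) (by omega)
      · exact h'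
    · rw [← h l]
      have hnd : L.Nodup := by
        refine hL.2.imp ?_
        rintro a b hab rfl
        omega
      have : (univ.filter fun j => key j < key l) = L.toFinset := by
        ext j
        simp only [mem_filter, mem_univ, true_and, List.mem_toFinset]
        refine ⟨fun hj => ?_, fun hj => hL.1 j hj⟩
        have := hlow l (by simp) j hj
        simp only [List.mem_cons] at this
        rcases this with rfl | h'
        · exact absurd hj (by omega)
        · exact h'
      rw [this, List.sum_toFinset _ hnd]
      clear h ih hL hlow this hnd
      induction L with
      | nil => simp
      | cons j L ih => simp [ih]

lemma exists_list {Q : Type*} [Fintype Q] (key : Q → ℕ) (hk : Function.Injective key) :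
    ∃ L : List Q, L.Pairwise (fun x y => key y < key x) ∧ ∀ x, x ∈ L := by
  classical
  letI : LinearOrder Q := LinearOrder.lift' key hk
  refine ⟨((univ : Finset Q).sort (· ≤ ·)).reverse, ?_, by simp⟩
  rw [List.pairwise_reverse]
  have := (univ : Finset Q).sortedLT_sort.pairwise
  exact this

theorem column_space (hN : 1 ≤ N) (lam : Fin N → ℕ) (hdom : ∀ a b, a ≤ b → lam b ≤ lam a) :
    ∃ (B : Type) (_ : Fintype B) (e : B → Fin N → Fin N → Module.End ℂ ((B → Fin N) → ℂ)) (c : B → ℂ) (L : List B)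
      (w : (B → Fin N) → ℂ), UnitFam e ∧ L.Nodup ∧ (∀ x, x ∈ L) ∧ JM e c L w ∧ w ≠ 0 ∧
      (∀ a b, a < b → (∑ q, e q a b) w = 0) ∧ ∀ a, (∑ q, e q a a) w = (lam a : ℂ) • w := by
  classical
  set r := ∑ a, lam a with hr
  have hle : ∀ a, lam a ≤ r := fun a => Finset.single_le_sum (f := lam) (fun _ _ => Nat.zero_le _) (mem_univ a)
  let key : Box lam r → ℕ := fun l => l.1.1 * N + l.2.1.1
  have hkey : ∀ x y : Box lam r, key x < key y ↔ x.1 < y.1 ∨ (x.1 = y.1 ∧ x.2.1 < y.2.1) := by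
    intro x y
    have hx := x.2.1.2
    have hy := y.2.1.2
    simp only [key, Fin.lt_def, Fin.ext_iff]
    rcases lt_trichotomy x.1.1 y.1.1 with h | h | h
    · have : (x.1.1 + 1) * N ≤ y.1.1 * N := Nat.mul_le_mul_right N h
      rw [add_mul] at this
      constructor
      · intro _; exact Or.inl h
      · intro _; omega
    · have hh : x.1.1 * N = y.1.1 * N := congrArg (· * N) h
      omega
    · have : (y.1.1 + 1) * N ≤ x.1.1 * N := Nat.mul_le_mul_right N h
      rw [add_mul] at this
      constructor
      · intro _; omega
      · intro _; omega
  have hinj : Function.Injective key := by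
    intro x y hxy
    have h1 := hkey x y
    have h2 := hkey y x
    rw [hxy] at h1 h2
    simp only [lt_irrefl, false_iff, not_or, not_lt, not_and] at h1 h2
    obtain ⟨i, p⟩ := x
    obtain ⟨i', p'⟩ := y
    have hi : i = i' := le_antisymm h2.1 h1.1
    subst hi
    have : p = p' := Subtype.ext (le_antisymm (h2.2 rfl) (h1.2 rfl))
    rw [this]
  obtain ⟨L, hL, hall⟩ := exists_list key hinj
  refine ⟨Box lam r, inferInstance, eC, fun l => (l.1.1 : ℂ) - l.2.1.1, L, wv lam r, eC_fam, ?_, hall, ?_, wv_ne, ?_, ?_⟩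
  · refine hL.imp ?_
    rintro a b hab rfl
    exact lt_irrefl _ hab
  · refine JM_of_set eC key _ _ ?_ L hL (fun _ _ y _ => hall y)
    rintro ⟨i, p⟩
    rw [Finset.sum_filter, Fintype.sum_sigma]
    have h1 : ∀ i' : Fin r, ∑ p' : {p : Fin N // i'.1 < lam p}, (if key ⟨i', p'⟩ < key ⟨i, p⟩ then
        Pm eC (⟨i', p'⟩ : Box lam r) ⟨i, p⟩ (wv lam r) else 0) =
        (if i' < i then wv lam r else 0) + (if i' = i then (-(p.1.1 : ℂ)) • wv lam r else 0) := by
      intro i'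
      simp only [hkey]
      rcases lt_trichotomy i' i with h | h | h
      · simp only [h, true_or, if_true, h.ne, if_false, add_zero]
        exact wv_four i i' h p
      · subst h
        simp only [lt_irrefl, true_and, false_or, if_false, if_true, zero_add]
        have h3 : ∀ p' : {p : Fin N // i'.1 < lam p}, (if p'.1 < p.1 then Pm eC (⟨i', p'⟩ : Box lam r) ⟨i', p⟩ (wv lam r) else 0) =
            if p'.1 < p.1 then - wv lam r else 0 := by
          intro p'
          split_ifs with hlt
          · exact wv_three i' p p' (by rintro rfl; exact lt_irrefl _ hlt)
          · rfl
        simp only [h3]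
        rw [← Finset.sum_filter, Finset.sum_const]
        have h4 : #(univ.filter fun p' : {p : Fin N // i'.1 < lam p} => p'.1 < p.1) = p.1.1 := by
          have h5 : (univ.filter fun p' : {p : Fin N // i'.1 < lam p} => p'.1 < p.1).map (Function.Embedding.subtype _) =
              Finset.Iio p.1 := by
            ext x
            simp only [mem_map, mem_filter, mem_univ, true_and, Function.Embedding.subtype_apply, mem_Iio]
            constructor
            · rintro ⟨p', h, rfl⟩; exact h
            · intro h
              exact ⟨⟨x, lt_of_lt_of_le p.2 (hdom _ _ h.le)⟩, h, rfl⟩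
          rw [← Finset.card_map, h5, Fin.card_Iio]
        rw [h4, neg_smul, smul_neg, Nat.cast_smul_eq_nsmul]
      · have h' : ¬ i' < i := not_lt.2 h.le
        simp [h', h.ne']
    rw [Finset.sum_congr rfl fun i' _ => h1 i', Finset.sum_add_distrib, ← Finset.sum_filter, Finset.sum_const,
      Finset.sum_ite_eq' univ i]
    simp only [mem_univ, if_true]
    have : (univ.filter fun i' : Fin r => i' < i) = Finset.Iio i := by ext; simp
    rw [this, Fin.card_Iio, ← Nat.cast_smul_eq_nsmul ℂ, ← add_smul, sub_eq_add_neg]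
  · intro a b hab
    rw [LinearMap.sum_apply, Fintype.sum_sigma]
    refine Finset.sum_eq_zero fun i _ => ?_
    by_cases ha : i.1 < lam a
    · rw [wv_one i a b ha, if_neg hab.ne]
    · exact Finset.sum_eq_zero fun p _ => wv_two i p a b (fun h => ha (lt_of_lt_of_le h (hdom _ _ hab.le)))
  · intro a
    rw [LinearMap.sum_apply, Fintype.sum_sigma]
    have h1 : ∀ i : Fin r, ∑ p : {p : Fin N // i.1 < lam p}, eC (⟨i, p⟩ : Box lam r) a a (wv lam r) =
        if i.1 < lam a then wv lam r else 0 := by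
      intro i
      by_cases ha : i.1 < lam a
      · rw [wv_one i a a ha, if_pos rfl, if_pos ha]
      · rw [if_neg ha]; exact Finset.sum_eq_zero fun p _ => wv_two i p a a ha
    rw [Finset.sum_congr rfl fun i _ => h1 i, ← Finset.sum_filter, Finset.sum_const, Nat.cast_smul_eq_nsmul]
    congr 1
    have := Fin.card_filter_val_lt (n := r) (m := lam a)
    simpa [hle a] using this

end Col
end XXXAux

namespace XXXAux
open Finset

section Cyc
variable {N : ℕ} {Y : Type*} [AddCommGroup Y] [Module ℂ Y]

/-- commutation relations -/
def GLr (E : Fin N → Fin N → Module.End ℂ Y) : Prop := ∀ a b c d,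
  E a b * E c d - E c d * E a b =
    (if b = c then (1 : ℂ) else 0) • E a d - (if d = a then (1 : ℂ) else 0) • E c b

variable {E : Fin N → Fin N → Module.End ℂ Y}

lemma GLr.app (h : GLr E) (a b c d : Fin N) (x : Y) :
    E a b (E c d x) = E c d (E a b x) + (if b = c then E a d x else 0) - (if d = a then E c b x else 0) := by
  have := LinearMap.congr_fun (h a b c d) x
  simp only [LinearMap.sub_apply, Module.End.mul_apply, LinearMap.smul_apply] at this
  rw [sub_eq_iff_eq_add] at this
  rw [this]
  split_ifs <;> simp <;> abel

/-- lowering words -/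
inductive LW (E : Fin N → Fin N → Module.End ℂ Y) (Λ : Fin N → ℤ) (γ : Y) : (Fin N → ℤ) → Y → Prop
  | base : LW E Λ γ Λ γ
  | step (a b : Fin N) (h : b < a) (μ : Fin N → ℤ) (x : Y) : LW E Λ γ μ x →
      LW E Λ γ (μ + Pi.single a 1 - Pi.single b 1) (E a b x)

variable {Λ : Fin N → ℤ} {γ : Y}

lemma LW_wt (h : GLr E) (hw : ∀ a, E a a γ = (Λ a : ℂ) • γ) {μ : Fin N → ℤ} {x : Y} (hx : LW E Λ γ μ x) (c : Fin N) :
    E c c x = (μ c : ℂ) • x := by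
  induction hx with
  | base => exact hw c
  | step a b hab μ x _ ih =>
    rw [h.app, ih, map_smul]
    simp only [Pi.sub_apply, Pi.add_apply, Pi.single_apply, Int.cast_sub, Int.cast_add]
    by_cases h1 : c = a
    · subst h1
      have : c ≠ b := hab.ne'
      simp [this, this.symm, add_smul]
    · by_cases h2 : c = b
      · subst h2; simp [h1, sub_smul]
      · simp [h1, h2, Ne.symm h2]

lemma LW_kap (κ : Fin N → ℤ) (hκ : ∀ a b, a < b → κ b < κ a) {μ : Fin N → ℤ} {x : Y} (hx : LW E Λ γ μ x) :
    (∑ a, μ a * κ a < ∑ a, Λ a * κ a) ∨ (μ = Λ ∧ x = γ) := by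
  induction hx with
  | base => exact Or.inr ⟨rfl, rfl⟩
  | step a b hab μ x _ ih =>
    left
    have h1 : ∑ i, ((μ + Pi.single a 1 - Pi.single b 1 : Fin N → ℤ) i) * κ i = ∑ i, μ i * κ i + κ a - κ b := by
      simp only [Pi.sub_apply, Pi.add_apply, sub_mul, add_mul, sum_sub_distrib, sum_add_distrib]
      simp [Pi.single_apply]
    rw [h1]
    have h2 := hκ b a hab
    rcases ih with ih | ⟨rfl, _⟩
    · linarith
    · linarith

/-- span of lowering words -/
def Gam (E : Fin N → Fin N → Module.End ℂ Y) (Λ : Fin N → ℤ) (γ : Y) : Submodule ℂ Y :=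
  Submodule.span ℂ {x | ∃ μ, LW E Λ γ μ x}

lemma Gam_stable (h : GLr E) (hw : ∀ a, E a a γ = (Λ a : ℂ) • γ) (hs : ∀ a b, a < b → E a b γ = 0) (a b : Fin N) :
    ∀ x ∈ Gam E Λ γ, E a b x ∈ Gam E Λ γ := by
  have hlow : ∀ a b, b < a → ∀ x ∈ Gam E Λ γ, E a b x ∈ Gam E Λ γ := by
    intro a b hab x hx
    induction hx using Submodule.span_induction with
    | mem x hx => obtain ⟨μ, hx⟩ := hx; exact Submodule.subset_span ⟨_, LW.step a b hab μ x hx⟩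
    | zero => simp
    | add x y _ _ hx hy => rw [map_add]; exact add_mem hx hy
    | smul c x _ hx => rw [map_smul]; exact Submodule.smul_mem _ _ hx
  have key : ∀ μ x, LW E Λ γ μ x → ∀ a b, E a b x ∈ Gam E Λ γ := by
    intro μ x hx
    induction hx with
    | base =>
      intro a b
      have hγ : γ ∈ Gam E Λ γ := Submodule.subset_span ⟨_, LW.base⟩
      rcases lt_trichotomy a b with h1 | h1 | h1
      · rw [hs a b h1]; exact zero_mem _
      · subst h1; rw [hw]; exact Submodule.smul_mem _ _ hγ
      · exact hlow a b h1 _ hγ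
    | step c d hcd μ x _ ih =>
      intro a b
      rw [h.app]
      refine sub_mem (add_mem (hlow c d hcd _ (ih a b)) ?_) ?_
      · split_ifs
        · exact ih a d
        · exact zero_mem _
      · split_ifs
        · exact ih c b
        · exact zero_mem _
  intro x hx
  induction hx using Submodule.span_induction with
  | mem x hx => obtain ⟨μ, hx⟩ := hx; exact key μ x hx a b
  | zero => simp
  | add x y _ _ hx hy => rw [map_add]; exact add_mem hx hy
  | smul c x _ hx => rw [map_smul]; exact Submodule.smul_mem _ _ hx

lemma Gam_wt (h : GLr E) (hw : ∀ a, E a a γ = (Λ a : ℂ) • γ) (ν : Fin N → ℂ) (s : Y) (hs : s ∈ Gam E Λ γ)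
    (hν : ∀ a, E a a s = ν a • s) : s ∈ Submodule.span ℂ {x | ∃ μ : Fin N → ℤ, LW E Λ γ μ x ∧ ν = fun a => (μ a : ℂ)} := by
  let A : (Fin N → ℂ) → Submodule ℂ Y := fun χ =>
    Submodule.span ℂ {x | ∃ μ : Fin N → ℤ, LW E Λ γ μ x ∧ χ = fun a => (μ a : ℂ)}
  let W : (Fin N → ℂ) → Submodule ℂ Y := fun χ => ⨅ a, (E a a).maxGenEigenspace (χ a)
  have hcomm : ∀ a b, Commute (E a a) (E b b) := by
    intro a b
    have := h a a b b
    refine sub_eq_zero.1 (this.trans ?_)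
    by_cases hab : a = b
    · subst hab; simp
    · simp [hab, Ne.symm hab]
  have hW : iSupIndep W := Module.End.independent_iInf_maxGenEigenspace_of_forall_mapsTo (fun a => E a a)
    (fun a b φ => Module.End.mapsTo_maxGenEigenspace_of_comm (hcomm b a) φ)
  have memW : ∀ (χ : Fin N → ℂ) x, (∀ a, E a a x = χ a • x) → x ∈ W χ := by
    intro χ x hx
    rw [Submodule.mem_iInf]
    intro a
    have : x ∈ (E a a).eigenspace (χ a) := by rw [Module.End.mem_eigenspace_iff]; exact hx a
    exact (Module.End.genEigenspace (E a a) (χ a)).monotone (by simp) this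
  have hAW : ∀ χ, A χ ≤ W χ := by
    intro χ
    refine Submodule.span_le.2 ?_
    rintro x ⟨μ, hx, rfl⟩
    exact memW _ _ fun a => LW_wt h hw hx a
  have hle : Gam E Λ γ ≤ A ν ⊔ ⨆ (χ) (_ : χ ≠ ν), A χ := by
    refine Submodule.span_le.2 ?_
    rintro x ⟨μ, hx⟩
    have hxA : x ∈ A (fun a => (μ a : ℂ)) := Submodule.subset_span ⟨μ, hx, rfl⟩
    by_cases hμ : (fun a => (μ a : ℂ)) = ν
    · exact Submodule.mem_sup_left (hμ ▸ hxA)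
    · exact Submodule.mem_sup_right ((le_iSup₂ (f := fun χ (_ : χ ≠ ν) => A χ) _ hμ) hxA)
  obtain ⟨s1, hs1, s2, hs2, h12⟩ := Submodule.mem_sup.1 (hle hs)
  have hs2' : s2 ∈ W ν := by
    rw [show s2 = s - s1 by rw [← h12]; abel]
    exact sub_mem (memW _ _ hν) (hAW ν hs1)
  have hs2'' : s2 ∈ ⨆ (χ) (_ : χ ≠ ν), W χ := (iSup₂_mono fun χ _ => hAW χ) hs2
  have : s2 = 0 := by
    have := (hW ν).le_bot ⟨hs2', hs2''⟩
    simpa using this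
  rw [← h12, this, add_zero]
  exact hs1

/-- Common eigenvector of commuting operators -/
lemma common_eig [FiniteDimensional ℂ Y] (f : Fin N → Module.End ℂ Y) (hc : ∀ a b, Commute (f a) (f b)) (t : Finset (Fin N)) :
    ∀ S : Submodule ℂ Y, S ≠ ⊥ → (∀ a, ∀ x ∈ S, f a x ∈ S) →
    ∃ S' ≤ S, S' ≠ ⊥ ∧ (∀ a, ∀ x ∈ S', f a x ∈ S') ∧ ∀ a ∈ t, ∃ c : ℂ, ∀ x ∈ S', f a x = c • x := by
  induction t using Finset.induction_on with
  | empty => intro S h1 h2; exact ⟨S, le_rfl, h1, h2, by simp⟩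
  | insert a t ha ih =>
    intro S h1 h2
    obtain ⟨S', hle, hne, hst, hev⟩ := ih S h1 h2
    haveI : Nontrivial S' := (Submodule.nontrivial_iff_ne_bot).2 hne
    obtain ⟨c, hc'⟩ := Module.End.exists_eigenvalue ((f a).restrict (hst a))
    obtain ⟨x, hx⟩ := hc'.exists_hasEigenvector
    refine ⟨S' ⊓ LinearMap.ker (f a - c • 1), inf_le_left.trans hle, ?_, ?_, ?_⟩
    · intro hbot
      have hx1 := hx.apply_eq_smul
      have : (x : Y) ∈ S' ⊓ LinearMap.ker (f a - c • 1) := by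
        refine ⟨x.2, ?_⟩
        have := congrArg Subtype.val hx1
        simp only [LinearMap.restrict_coe_apply] at this
        rw [SetLike.mem_coe, LinearMap.mem_ker, LinearMap.sub_apply, this]
        simp
      rw [hbot] at this
      exact hx.2 (Subtype.ext (by simpa using this))
    · intro b x hx
      refine ⟨hst b x hx.1, ?_⟩
      have h3 := hx.2
      rw [SetLike.mem_coe, LinearMap.mem_ker, LinearMap.sub_apply, sub_eq_zero] at h3 ⊢
      rw [← Module.End.mul_apply, (hc a b).eq, Module.End.mul_apply, h3]
      simp
    · intro b hb
      rcases Finset.mem_insert.1 hb with rfl | hb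
      · refine ⟨c, fun x hx => ?_⟩
        have h3 := hx.2
        rw [SetLike.mem_coe, LinearMap.mem_ker, LinearMap.sub_apply, sub_eq_zero] at h3
        simpa using h3
      · obtain ⟨c', hc''⟩ := hev b hb
        exact ⟨c', fun x hx => hc'' x hx.1⟩

lemma exists_sing [FiniteDimensional ℂ Y] (h : GLr E) (S : Submodule ℂ Y) (hS : S ≠ ⊥) (hst : ∀ a b, ∀ x ∈ S, E a b x ∈ S) :
    ∃ s ∈ S, s ≠ 0 ∧ (∀ a b, a < b → E a b s = 0) ∧ ∃ ν : Fin N → ℂ, ∀ a, E a a s = ν a • s := by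
  have hcomm : ∀ a b, Commute (E a a) (E b b) := by
    intro a b
    refine sub_eq_zero.1 ((h a a b b).trans ?_)
    by_cases hab : a = b
    · subst hab; simp
    · simp [hab, Ne.symm hab]
  let D : Module.End ℂ Y := ∑ a : Fin N, (-(a : ℕ) : ℂ) • E a a
  have hD : ∀ x ∈ S, D x ∈ S := by
    intro x hx
    simp only [D, LinearMap.sum_apply, LinearMap.smul_apply]
    exact Submodule.sum_mem _ fun a _ => Submodule.smul_mem _ _ (hst a a x hx)
  have hDE : ∀ a b x, D (E a b x) = E a b (D x) + ((b : ℕ) - (a : ℕ) : ℂ) • E a b x := by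
    intro a b x
    have key : ∀ i, E i i (E a b x) = _ := fun i => h.app i i a b x
    simp only [D, LinearMap.sum_apply, LinearMap.smul_apply, map_sum, map_smul, key, smul_sub, smul_add, sum_sub_distrib,
      sum_add_distrib, smul_ite, smul_zero]
    rw [Finset.sum_ite_eq' univ a, Finset.sum_ite_eq univ b]
    simp only [mem_univ, if_true]
    rw [sub_smul, neg_smul, neg_smul]; abel
  haveI : Nontrivial S := (Submodule.nontrivial_iff_ne_bot).2 hS
  let D' : Module.End ℂ S := D.restrict hD
  obtain ⟨c0, hc0⟩ := Module.End.exists_eigenvalue D'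
  obtain ⟨c, hc, hmax⟩ := Set.exists_max_image {μ | D'.HasEigenvalue μ} Complex.re
    (Module.End.finite_hasEigenvalue D') ⟨c0, hc0⟩
  let S1 : Submodule ℂ Y := S ⊓ LinearMap.ker (D - c • 1)
  have hm1 : ∀ x, x ∈ S1 ↔ x ∈ S ∧ D x = c • x := by
    intro x
    rw [Submodule.mem_inf, LinearMap.mem_ker, LinearMap.sub_apply, sub_eq_zero]; rfl
  have hS1 : S1 ≠ ⊥ := by
    obtain ⟨x, hx⟩ := Module.End.HasEigenvalue.exists_hasEigenvector hc
    intro hbot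
    have hx1 := congrArg Subtype.val hx.apply_eq_smul
    have : (x : Y) ∈ S1 := (hm1 _).2 ⟨x.2, by simpa [D'] using hx1⟩
    rw [hbot] at this
    exact hx.2 (Subtype.ext (by simpa using this))
  have hkill : ∀ x ∈ S1, ∀ a b, a < b → E a b x = 0 := by
    intro x hx a b hab
    by_contra hne
    rw [hm1] at hx
    have h1 : D (E a b x) = (c + ((b : ℕ) - (a : ℕ) : ℂ)) • E a b x := by
      rw [hDE, hx.2, map_smul, add_smul]
    have h2 : D'.HasEigenvalue (c + ((b : ℕ) - (a : ℕ) : ℂ)) := by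
      refine Module.End.hasEigenvalue_of_hasEigenvector (x := ⟨E a b x, hst a b x hx.1⟩) ⟨?_, ?_⟩
      · rw [Module.End.mem_eigenspace_iff]
        exact Subtype.ext h1
      · intro h3; exact hne (congrArg Subtype.val h3)
    have h3 := hmax _ h2
    simp only [Complex.add_re, Complex.sub_re, Complex.natCast_re] at h3
    have h4 : ((a : ℕ) : ℝ) < (b : ℕ) := by exact_mod_cast hab
    linarith
  have hst1 : ∀ a, ∀ x ∈ S1, E a a x ∈ S1 := by
    intro a x hx
    rw [hm1] at hx ⊢
    refine ⟨hst a a x hx.1, ?_⟩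
    rw [hDE, hx.2, map_smul]; simp
  obtain ⟨S', hle, hne, _, hev⟩ := common_eig (fun a => E a a) hcomm univ S1 hS1 hst1
  obtain ⟨s, hs, hs0⟩ := Submodule.exists_mem_ne_zero_of_ne_bot hne
  choose ν hν using fun a => hev a (mem_univ a)
  exact ⟨s, (hle hs).1, hs0, fun a b hab => hkill s (hle hs) a b hab, ν, fun a => hν a s hs⟩

lemma sing_dom [FiniteDimensional ℂ Y] (h : GLr E) (s : Y) (hs : s ≠ 0) (hk : ∀ a b, a < b → E a b s = 0) (μ : Fin N → ℤ)
    (hμ : ∀ a, E a a s = (μ a : ℂ) • s) (a b : Fin N) (hab : a < b) : μ b ≤ μ a := by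
  have hne := hab.ne
  have hne' := hab.ne'
  have hhs : (E a a - E b b) s = ((μ a : ℂ) - μ b) • s := by
    rw [LinearMap.sub_apply, hμ, hμ, sub_smul]
  by_cases h0 : E a a - E b b = 0
  · rw [h0, LinearMap.zero_apply] at hhs
    have := (smul_eq_zero.1 hhs.symm).resolve_right hs
    rw [sub_eq_zero] at this
    exact (Int.cast_injective this).ge
  · letI : LieRing (Module.End ℂ Y) := LieRing.ofAssociativeRing
    have t : IsSl2Triple (E a a - E b b) (E a b) (E b a) := by
      refine ⟨h0, ?_, ?_, ?_⟩
      · rw [Ring.lie_def, h a b b a]; simp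
      · have e1 := h a a a b
        have e2 := h b b a b
        simp only [hne, hne', if_true, if_false, one_smul, zero_smul, sub_zero, zero_sub] at e1 e2
        rw [Ring.lie_def, sub_mul, mul_sub, sub_sub_sub_comm, e1, e2, sub_neg_eq_add, two_smul]
      · have e1 := h a a b a
        have e2 := h b b b a
        simp only [hne, hne', if_true, if_false, one_smul, zero_smul, sub_zero, zero_sub] at e1 e2
        rw [Ring.lie_def, sub_mul, mul_sub, sub_sub_sub_comm, e1, e2, two_smul]; abel
    have P : t.HasPrimitiveVectorWith s ((μ a : ℂ) - μ b) := ⟨hs, hhs, hk a b hab⟩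
    obtain ⟨n, hn⟩ := P.exists_nat
    have : ((μ a - μ b : ℤ) : ℂ) = ((n : ℤ) : ℂ) := by push_cast; exact hn
    have := Int.cast_injective this
    omega

/-- Casimir operator -/
def Cas (E : Fin N → Fin N → Module.End ℂ Y) : Module.End ℂ Y := ∑ a, ∑ b, E a b * E b a

lemma Cas_comm (h : GLr E) (c d : Fin N) (x : Y) : Cas E (E c d x) = E c d (Cas E x) := by
  simp only [Cas, LinearMap.sum_apply, Module.End.mul_apply, map_sum]
  have key : ∀ a b, E a b (E b a (E c d x)) = E c d (E a b (E b a x)) +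
      ((if b = c then E a d (E b a x) else 0) - (if d = a then E c b (E b a x) else 0)) +
      ((if a = c then E a b (E b d x) else 0) - (if d = b then E a b (E c a x) else 0)) := by
    intro a b
    rw [h.app b a c d x, map_sub, map_add, h.app a b c d]
    simp only [apply_ite (E a b), map_zero]; abel
  simp only [key, sum_add_distrib, sum_sub_distrib]
  have e1 : ∑ a, ∑ b, (if b = c then E a d (E b a x) else 0) = ∑ a, E a d (E c a x) := by
    refine sum_congr rfl fun a _ => ?_
    rw [Finset.sum_ite_eq' univ c]; simp
  have e2 : ∑ a, ∑ b, (if d = a then E c b (E b a x) else 0) = ∑ b, E c b (E b d x) := by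
    rw [Finset.sum_comm]
    refine sum_congr rfl fun a _ => ?_
    rw [Finset.sum_ite_eq univ d]; simp
  have e3 : ∑ a, ∑ b, (if a = c then E a b (E b d x) else 0) = ∑ b, E c b (E b d x) := by
    rw [Finset.sum_comm]
    refine sum_congr rfl fun a _ => ?_
    rw [Finset.sum_ite_eq' univ c]; simp
  have e4 : ∑ a, ∑ b, (if d = b then E a b (E c a x) else 0) = ∑ a, E a d (E c a x) := by
    refine sum_congr rfl fun a _ => ?_
    rw [Finset.sum_ite_eq univ d]; simp
  rw [e1, e2, e3, e4]; abel

lemma Cas_sing (h : GLr E) (s : Y) (hk : ∀ a b, a < b → E a b s = 0) (μ : Fin N → ℤ)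
    (hμ : ∀ a, E a a s = (μ a : ℂ) • s) :
    Cas E s = ((∑ a, μ a * (μ a + (N - 1 - 2 * (a : ℕ))) : ℤ) : ℂ) • s := by
  have key : ∀ a b, E a b (E b a s) = ((if a = b then μ a * μ a else if a < b then μ a - μ b else 0 : ℤ) : ℂ) • s := by
    intro a b
    by_cases hab : a = b
    · subst hab; rw [hμ, map_smul, hμ, smul_smul, if_pos rfl]; push_cast; rfl
    · rw [if_neg hab]
      by_cases hlt : a < b
      · rw [h.app, hk a b hlt, map_zero, if_pos rfl, if_pos rfl, if_pos hlt, hμ, hμ]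
        push_cast; rw [sub_smul]; abel
      · have : b < a := lt_of_le_of_ne (not_lt.1 hlt) (Ne.symm hab)
        rw [hk b a this, map_zero, if_neg hlt]; simp
  simp only [Cas, LinearMap.sum_apply, Module.End.mul_apply, key, ← Finset.sum_smul, ← Int.cast_sum]
  congr 2
  have h1 : ∀ a b : Fin N, (if a = b then μ a * μ a else if a < b then μ a - μ b else 0) =
      (if a = b then μ a * μ a else 0) + ((if a < b then μ a else 0) - (if a < b then μ b else 0)) := by
    intro a b
    by_cases hab : a = b
    · subst hab; simp
    · simp only [if_neg hab]; split_ifs <;> ring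
  simp only [h1, sum_add_distrib, sum_sub_distrib]
  rw [Finset.sum_comm (f := fun a b : Fin N => if a < b then μ b else 0), ← sum_sub_distrib, ← sum_add_distrib]
  refine sum_congr rfl fun a _ => ?_
  rw [Finset.sum_ite_eq univ a, ← Finset.sum_filter, ← Finset.sum_filter, Finset.sum_const, Finset.sum_const]
  have f1 : (univ.filter fun x : Fin N => a < x) = Finset.Ioi a := by ext; simp
  have f2 : (univ.filter fun x : Fin N => x < a) = Finset.Iio a := by ext; simp
  rw [f1, f2, Fin.card_Ioi, Fin.card_Iio]
  have := a.2
  simp only [mem_univ, if_true, nsmul_eq_mul]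
  have h3 : ((N - 1 - (a : ℕ) : ℕ) : ℤ) = (N : ℤ) - 1 - (a : ℕ) := by omega
  rw [h3]; ring

theorem cyc_simple [FiniteDimensional ℂ Y] (h : GLr E) (hw : ∀ a, E a a γ = (Λ a : ℂ) • γ)
    (hs : ∀ a b, a < b → E a b γ = 0) (hdom : ∀ a b, a ≤ b → Λ b ≤ Λ a) (S : Submodule ℂ Y) (hS : S ≠ ⊥)
    (hle : S ≤ Gam E Λ γ) (hst : ∀ a b, ∀ x ∈ S, E a b x ∈ S) : γ ∈ S := by
  obtain ⟨s, hsS, hs0, hk, ν, hν⟩ := exists_sing h S hS hst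
  have h1 := Gam_wt h hw ν s (hle hsS) hν
  have h2 : ∃ μ : Fin N → ℤ, ν = fun a => (μ a : ℂ) := by
    by_contra hne
    push Not at hne
    have : {x | ∃ μ : Fin N → ℤ, LW E Λ γ μ x ∧ ν = fun a => (μ a : ℂ)} = ∅ := by
      ext x
      simp only [Set.mem_setOf_eq, Set.mem_empty_iff_false, iff_false]
      rintro ⟨μ, _, h3⟩
      exact hne μ h3
    rw [this, Submodule.span_empty] at h1
    exact hs0 (by simpa using h1)
  obtain ⟨μ, rfl⟩ := h2
  have hdomμ := sing_dom h s hs0 hk μ hν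
  have hC : ∀ x ∈ Gam E Λ γ, Cas E x = ((∑ a, Λ a * (Λ a + (N - 1 - 2 * (a : ℕ))) : ℤ) : ℂ) • x := by
    intro x hx
    induction hx using Submodule.span_induction with
    | mem x hx =>
      obtain ⟨μ, hx⟩ := hx
      induction hx with
      | base => exact Cas_sing h γ hs Λ hw
      | step a b _ _ x _ ih => rw [Cas_comm h, ih, map_smul]
    | zero => simp
    | add x y _ _ hx hy => rw [map_add, hx, hy, smul_add]
    | smul c x _ hx => rw [map_smul, hx, smul_comm]
  have h3 := (hC s (hle hsS)).symm.trans (Cas_sing h s hk μ hν)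
  have h4 := Int.cast_injective (smul_left_injective ℂ hs0 h3)
  have h5 : {x | ∃ μ' : Fin N → ℤ, LW E Λ γ μ' x ∧ (fun a => (μ a : ℂ)) = fun a => (μ' a : ℂ)} ⊆ {γ} := by
    rintro x ⟨μ', hx, hμ⟩
    have : μ = μ' := by
      ext a; exact_mod_cast congrFun hμ a
    subst this
    let κ : Fin N → ℤ := fun a => Λ a + μ a + (N - 1 - 2 * (a : ℕ))
    have hκ : ∀ a b, a < b → κ b < κ a := by
      intro a b hab
      simp only [κ]
      have := hdom a b hab.le
      have := hdomμ a b hab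
      have : (a : ℕ) < (b : ℕ) := hab
      omega
    rcases LW_kap κ hκ hx with h6 | h6
    · exfalso
      have h7 : ∑ a, Λ a * κ a - ∑ a, μ a * κ a = 0 := by
        rw [← sub_eq_zero, ← sum_sub_distrib] at h4
        rw [← h4, ← sum_sub_distrib]
        refine sum_congr rfl fun a _ => ?_
        simp only [κ]; ring
      omega
    · exact h6.2
  have h6 := Submodule.span_mono h5 h1
  rw [Submodule.mem_span_singleton] at h6
  obtain ⟨t, ht⟩ := h6
  have ht0 : t ≠ 0 := by rintro rfl; exact hs0 (by rw [← ht, zero_smul])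
  have := Submodule.smul_mem S t⁻¹ hsS
  rwa [← ht, smul_smul, inv_mul_cancel₀ ht0, one_smul] at this

theorem embed {V R : Type*} [AddCommGroup V] [Module ℂ V] [FiniteDimensional ℂ V] [AddCommGroup R] [Module ℂ R]
    [FiniteDimensional ℂ R] {E : Fin N → Fin N → Module.End ℂ V} {E' : Fin N → Fin N → Module.End ℂ R}
    (h : GLr E) (h' : GLr E') (Λ : Fin N → ℤ) (hdom : ∀ a b, a ≤ b → Λ b ≤ Λ a) (v : V) (w : R) (hv : v ≠ 0) (hw0 : w ≠ 0)
    (hv1 : ∀ a b, a < b → E a b v = 0) (hv2 : ∀ a, E a a v = (Λ a : ℂ) • v)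
    (hw1 : ∀ a b, a < b → E' a b w = 0) (hw2 : ∀ a, E' a a w = (Λ a : ℂ) • w)
    (hgen : ∀ W : Submodule ℂ V, (∀ a b : Fin N, ∀ x ∈ W, E a b x ∈ W) → v ∈ W → ∀ x : V, x ∈ W) :
    ∃ i : V →ₗ[ℂ] R, Function.Injective i ∧ (∀ a b x, i (E a b x) = E' a b (i x)) ∧ i v = w := by
  let EP : Fin N → Fin N → Module.End ℂ (V × R) := fun a b => LinearMap.prodMap (E a b) (E' a b)
  have hEP : ∀ a b x, EP a b x = (E a b x.1, E' a b x.2) := fun a b x => rfl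
  have hGL : GLr EP := by
    intro a b c d
    refine LinearMap.ext fun x => ?_
    have e1 := LinearMap.congr_fun (h a b c d) x.1
    have e2 := LinearMap.congr_fun (h' a b c d) x.2
    exact Prod.ext e1 e2
  have hγ1 : ∀ a b, a < b → EP a b (v, w) = 0 := fun a b hab => Prod.ext (hv1 a b hab) (hw1 a b hab)
  have hγ2 : ∀ a, EP a a (v, w) = (Λ a : ℂ) • (v, w) := fun a => Prod.ext (hv2 a) (hw2 a)
  let Γ := Gam EP Λ (v, w)
  have hst := Gam_stable hGL hγ2 hγ1
  have hmem : (v, w) ∈ Γ := Submodule.subset_span ⟨_, LW.base⟩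
  have hsimp := fun S hS hle hst => cyc_simple hGL hγ2 hγ1 hdom S hS hle hst
  have hsurj : ∀ x : V, ∃ y : R, (x, y) ∈ Γ := by
    intro x
    have := hgen (Γ.map (LinearMap.fst ℂ V R)) ?_ ⟨(v, w), hmem, rfl⟩ x
    · obtain ⟨p, hp, rfl⟩ := this
      exact ⟨p.2, hp⟩
    · rintro a b _ ⟨p, hp, rfl⟩
      exact ⟨EP a b p, hst a b p hp, rfl⟩
  have hinj1 : ∀ y : R, ((0 : V), y) ∈ Γ → y = 0 := by
    intro y hy
    by_contra hne
    have := hsimp (Γ ⊓ LinearMap.ker (LinearMap.fst ℂ V R)) ?_ inf_le_left ?_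
    · exact hv this.2
    · intro hbot
      have h3 : ((0 : V), y) ∈ Γ ⊓ LinearMap.ker (LinearMap.fst ℂ V R) := ⟨hy, rfl⟩
      rw [hbot, Submodule.mem_bot] at h3
      exact hne (congrArg Prod.snd h3)
    · rintro a b x ⟨hx1, hx2⟩
      refine ⟨hst a b x hx1, ?_⟩
      have : x.1 = 0 := hx2
      show E a b x.1 = 0
      rw [this, map_zero]
  have hinj2 : ∀ y : V, (y, (0 : R)) ∈ Γ → y = 0 := by
    intro y hy
    by_contra hne
    have := hsimp (Γ ⊓ LinearMap.ker (LinearMap.snd ℂ V R)) ?_ inf_le_left ?_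
    · exact hw0 this.2
    · intro hbot
      have h3 : (y, (0 : R)) ∈ Γ ⊓ LinearMap.ker (LinearMap.snd ℂ V R) := ⟨hy, rfl⟩
      rw [hbot, Submodule.mem_bot] at h3
      exact hne (congrArg Prod.fst h3)
    · rintro a b x ⟨hx1, hx2⟩
      refine ⟨hst a b x hx1, ?_⟩
      have : x.2 = 0 := hx2
      show E' a b x.2 = 0
      rw [this, map_zero]
  have huniq : ∀ x y y', (x, y) ∈ Γ → (x, y') ∈ Γ → y = y' := by
    intro x y y' h1 h2
    have := sub_mem h1 h2
    rw [Prod.mk_sub_mk, sub_self] at this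
    exact sub_eq_zero.1 (hinj1 _ this)
  choose g hg using hsurj
  refine ⟨{ toFun := g, map_add' := fun x y => ?_, map_smul' := fun c x => ?_ }, ?_, ?_, ?_⟩
  · exact huniq (x + y) _ _ (hg _) (add_mem (hg x) (hg y))
  · exact huniq (c • x) _ _ (hg _) (Submodule.smul_mem _ c (hg x))
  · intro x y hxy
    have hxy' : g x = g y := hxy
    have := sub_mem (hg x) (hg y)
    rw [Prod.mk_sub_mk, hxy', sub_self] at this
    exact sub_eq_zero.1 (hinj2 _ this)
  · intro a b x
    exact huniq _ _ _ (hg _) (hst a b _ (hg x))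
  · exact huniq _ _ _ (hg _) hmem

end Cyc
end XXXAux

namespace XXXAux
open Finset

section Tens
variable {n : ℕ}

/-- action in one tensor factor -/
def tmA (X : Fin n → Type*) [∀ i, AddCommGroup (X i)] [∀ i, Module ℂ (X i)] (j : Fin n) :
    Module.End ℂ (X j) →+* Module.End ℂ (PiTensorProduct ℂ X) :=
  RingHom.mk' 
    { toFun := fun A => PiTensorProduct.map (Function.update (fun i => (LinearMap.id : X i →ₗ[ℂ] X i)) j A)
      map_one' := by
        have : Function.update (fun i => (LinearMap.id : X i →ₗ[ℂ] X i)) j 1 = fun i => LinearMap.id :=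
          Function.update_eq_self j _
        rw [this, PiTensorProduct.map_id]; rfl
      map_mul' := by
        intro A B
        change _ = (PiTensorProduct.map _) ∘ₗ (PiTensorProduct.map _)
        rw [← PiTensorProduct.map_comp]
        congr 1
        funext i
        by_cases h : i = j
        · subst h; simp only [Function.update_self]; rfl
        · simp only [Function.update_of_ne h]; rfl }
    (fun A B => PiTensorProduct.map_update_add _ j A B)

variable {X Y : Fin n → Type*} [∀ i, AddCommGroup (X i)] [∀ i, Module ℂ (X i)]
  [∀ i, AddCommGroup (Y i)] [∀ i, Module ℂ (Y i)]

lemma tmA_smul (j : Fin n) (c : ℂ) (A : Module.End ℂ (X j)) : tmA X j (c • A) = c • tmA X j A :=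
  PiTensorProduct.map_update_smul _ j c A

lemma tmA_comm {j j' : Fin n} (h : j ≠ j') (A : Module.End ℂ (X j)) (B : Module.End ℂ (X j')) :
    Commute (tmA X j A) (tmA X j' B) := by
  change (PiTensorProduct.map _) ∘ₗ (PiTensorProduct.map _) = (PiTensorProduct.map _) ∘ₗ (PiTensorProduct.map _)
  rw [← PiTensorProduct.map_comp, ← PiTensorProduct.map_comp]
  congr 1
  funext i
  by_cases h1 : i = j
  · subst h1
    simp only [Function.update_self, Function.update_of_ne h]; rfl
  · by_cases h2 : i = j'
    · subst h2; simp only [Function.update_self, Function.update_of_ne h1]; rfl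
    · simp only [Function.update_of_ne h1, Function.update_of_ne h2]

lemma tmA_map (ι : ∀ i, X i →ₗ[ℂ] Y i) (j : Fin n) (A : Module.End ℂ (X j)) (A' : Module.End ℂ (Y j))
    (h : ∀ x, ι j (A x) = A' (ι j x)) (t : PiTensorProduct ℂ X) :
    PiTensorProduct.map ι (tmA X j A t) = tmA Y j A' (PiTensorProduct.map ι t) := by
  have : PiTensorProduct.map ι ∘ₗ tmA X j A = tmA Y j A' ∘ₗ PiTensorProduct.map ι := by
    change (PiTensorProduct.map _) ∘ₗ (PiTensorProduct.map _) = (PiTensorProduct.map _) ∘ₗ (PiTensorProduct.map _)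
    rw [← PiTensorProduct.map_comp, ← PiTensorProduct.map_comp]
    congr 1
    funext i
    by_cases h1 : i = j
    · subst h1
      simp only [Function.update_self]
      exact LinearMap.ext h
    · simp only [Function.update_of_ne h1]; rfl
  exact LinearMap.congr_fun this t

lemma tmap_inj (ι : ∀ i, X i →ₗ[ℂ] Y i) (h : ∀ i, Function.Injective (ι i)) :
    Function.Injective (PiTensorProduct.map ι) := by
  choose g hg using fun i => LinearMap.exists_leftInverse_of_injective (ι i) (LinearMap.ker_eq_bot.2 (h i))
  have : PiTensorProduct.map g ∘ₗ PiTensorProduct.map ι = LinearMap.id := by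
    rw [← PiTensorProduct.map_comp]
    simp only [hg]
    exact PiTensorProduct.map_id
  exact Function.LeftInverse.injective (g := PiTensorProduct.map g) (fun t => LinearMap.congr_fun this t)

end Tens

section Asm
variable {N n : ℕ}

theorem fac (hN : 1 ≤ N) {V : Type*} [AddCommGroup V] [Module ℂ V] [FiniteDimensional ℂ V]
    (E : Fin N → Fin N → Module.End ℂ V) (h : GLr E) (Λ : Fin N → ℤ) (hdom : ∀ a b, a ≤ b → Λ b ≤ Λ a) (hpos : ∀ a, 0 ≤ Λ a)
    (v : V) (hv : v ≠ 0)
    (hv1 : ∀ a b, a < b → E a b v = 0) (hv2 : ∀ a, E a a v = (Λ a : ℂ) • v)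
    (hgen : ∀ W : Submodule ℂ V, (∀ a b : Fin N, ∀ x ∈ W, E a b x ∈ W) → v ∈ W → ∀ x : V, x ∈ W) :
    ∃ (B : Type) (_ : Fintype B) (e : B → Fin N → Fin N → Module.End ℂ ((B → Fin N) → ℂ)) (c : B → ℂ) (L : List B)
      (i : V →ₗ[ℂ] ((B → Fin N) → ℂ)), UnitFam e ∧ L.Nodup ∧ (∀ x, x ∈ L) ∧ Function.Injective i ∧
      (∀ a b x, i (E a b x) = (∑ q, e q a b) (i x)) ∧ ∀ x, JM e c L (i x) := by
  obtain ⟨B, hB, e, c, L, w, U, hL, hall, hJ, hw0, hw1, hw2⟩ := column_space hN (fun a => (Λ a).toNat)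
    (fun a b hab => Int.toNat_le_toNat (hdom a b hab))
  obtain ⟨i, hi, hintw, hiv⟩ := embed h (E' := fun a b => ∑ q, e q a b) (tot_rel U) Λ hdom v w hv hw0 hv1 hv2 hw1
    (fun a => by
      rw [hw2 a]
      congr 1
      have : ((Λ a).toNat : ℤ) = Λ a := Int.toNat_of_nonneg (hpos a)
      exact_mod_cast congrArg (Int.cast : ℤ → ℂ) this) hgen
  refine ⟨B, hB, e, c, L, i, U, hL, hall, hi, hintw, ?_⟩
  obtain ⟨S, hS⟩ := JM_lin e c L
  intro x
  rw [← hS]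
  refine hgen (S.comap i) (fun a b x hx => ?_) ?_ x
  · rw [Submodule.mem_comap, hS] at hx ⊢
    rw [hintw]
    exact JM_of_comm e c L _ _ (fun j _ l _ hjl => Pm_tot U hjl a b) hL hx
  · rw [Submodule.mem_comap, hS, hiv]; exact hJ

open XXXModel

theorem exists_P (hN : 2 ≤ N)
    (V : Fin n → Type*) [∀ i, AddCommGroup (V i)] [∀ i, Module ℂ (V i)]
    [∀ i, FiniteDimensional ℂ (V i)]
    (M : Type*) [AddCommGroup M] [Module ℂ M]
    (Λ : Fin n → Fin N → ℤ)
    (hdom : ∀ i, ∀ a b : Fin N, a ≤ b → Λ i b ≤ Λ i a)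
    (hpoly : ∀ i a, 0 ≤ Λ i a)
    (E : ∀ i : Fin n, Fin N → Fin N → (V i →ₗ[ℂ] V i))
    (hrel : GlRel V E)
    (hhw : IsHW V E Λ)
    (φ : M ≃ₗ[ℂ] PiTensorProduct ℂ V)
    (z : Fin n → ℂ) :
    ∃ bad : Finset ℂ, ∀ x : ℂ, (∀ b ∈ bad, ∀ j : ℤ, x + j ≠ b) →
      ∃ P ∈ PF (Module.End ℂ M), (∀ i : ℕ, 1 ≤ i → i < N → P (x - i) = 0) ∧
      (∃ c : ℂ, c ≠ 0 ∧ ∀ v, P x v = c • v) ∧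
      (∀ s : ℕ, N ≤ s → ∀ v, Dgen (Tmat V M E φ z) (fun u => P u v) (x + s) = 0) ∧
      (∀ u a b, Commute (P u) (∑ j, EE V M E φ j a b)) := by
  classical
  choose v hv hv1 hv2 hgen using hhw
  choose B hB e c L ι U hL hall hinj hintw hJ using fun i => fac (by omega : 1 ≤ N) (E i) (hrel i) (Λ i) (hdom i) (hpoly i)
    (v i) (hv i) (hv1 i) (hv2 i) (hgen i)
  let X : Fin n → Type := fun i => (B i → Fin N) → ℂ
  let Q := Σ i, B i
  let ee : Q → Fin N → Fin N → Module.End ℂ (PiTensorProduct ℂ X) := fun q a b => tmA X q.1 (e q.1 q.2 a b)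
  let w : Q → ℂ := fun q => z q.1 - c q.1 q.2
  let qf : List (Fin n) → List Q := fun js => js.flatMap fun j => (L j).reverse.map (Sigma.mk j)
  have hU : UnitFam ee := by
    constructor
    · intro q a b c d
      simp only [ee]
      rw [← map_mul, (U q.1).rel q.2]
      split_ifs
      · rfl
      · exact map_zero _
    · rintro ⟨i, l⟩ ⟨i', l'⟩ hne a b c d
      by_cases hi : i = i'
      · subst hi
        have : l ≠ l' := fun h => hne (by rw [h])
        exact ((U i).comm l l' this a b c d).map (tmA X i)
      · exact tmA_comm hi _ _
  have hqn : ∀ js : List (Fin n), js.Nodup → (qf js).Nodup := by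
    intro js hjs
    refine List.nodup_flatMap.2 ⟨fun j _ => ?_, ?_⟩
    · exact (List.nodup_reverse.2 (hL j)).map sigma_mk_injective
    · refine hjs.imp ?_
      intro j j' hne q hq hq'
      rw [List.mem_map] at hq hq'
      obtain ⟨l, _, rfl⟩ := hq
      obtain ⟨l', _, h⟩ := hq'
      exact hne (congrArg Sigma.fst h).symm
  let ιι : M →ₗ[ℂ] PiTensorProduct ℂ X := PiTensorProduct.map ι ∘ₗ φ.toLinearMap
  have hιι : Function.Injective ιι := (tmap_inj ι hinj).comp φ.injective
  have hEE : ∀ j a b y, φ (EE V M E φ j a b y) = tmA V j (E j a b) (φ y) := by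
    intro j a b y
    simp only [EE, LinearMap.comp_apply, LinearEquiv.coe_coe, LinearEquiv.apply_symm_apply]
    rfl
  have hLint : ∀ j u, u ≠ z j → (∀ l, u ≠ w ⟨j, l⟩) → ∀ a b y, ιι (Lmat V M E φ z j u a b y) =
      (((L j).reverse.map (Sigma.mk j)).map fun q => LR ee w q u).prod a b (ιι y) := by
    intro j u hu hu' a b y
    have h1 : (((L j).reverse.map (Sigma.mk j)).map fun q => LR ee w q u).prod =
        (tmA X j).mapMatrix ((L j).reverse.map fun l => LR (e j) (fun q => - c j q) l (u - z j)).prod := by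
      rw [map_list_prod, List.map_map, List.map_map]
      congr 1
      refine List.map_congr_left fun l _ => ?_
      ext1 a b
      simp only [Function.comp, LR, RingHom.mapMatrix_apply, Matrix.map_apply, map_add, tmA_smul, ee, w]
      congr 1
      · split_ifs
        · exact (map_one _).symm
        · exact (map_zero _).symm
      · congr 2; ring
    rw [h1]
    have h2 : φ (Lmat V M E φ z j u a b y) =
        tmA V j ((if a = b then 1 else 0) + (u - z j)⁻¹ • E j b a) (φ y) := by
      rw [map_add, tmA_smul]
      simp only [Lmat, LinearMap.add_apply, LinearMap.smul_apply, map_add, map_smul, hEE]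
      congr 1
      split_ifs
      · rw [map_one]; rfl
      · rw [map_zero]; simp
    change PiTensorProduct.map ι (φ _) = _
    rw [h2]
    refine tmA_map ι j _ _ (fun x => ?_) _
    rw [fusion (U j) (c j) (u - z j) (sub_ne_zero.2 hu) (L j) (hL j) (fun l _ h => hu' l (by
      simp only [w]; linear_combination h)) _ (hJ j x)]
    have h3 : ((L j).map fun q => e j q b a).sum = ∑ q, e j q b a := by
      have : (L j).toFinset = univ := by ext q; simp [hall j q]
      rw [← this, List.sum_toFinset _ (hL j)]
    rw [h3, ← hintw]
    simp only [LinearMap.add_apply, LinearMap.smul_apply, map_add, map_smul]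
    congr 1
    split_ifs
    · rfl
    · simp
  have hTint : ∀ u, (∀ j, u ≠ z j) → (∀ q, u ≠ w q) → ∀ (js : List (Fin n)) a b y,
      ιι ((js.map fun j => Lmat V M E φ z j u).prod a b y) = TR ee w (qf js) u a b (ιι y) := by
    intro u hu hu' js
    induction js with
    | nil =>
      intro a b y
      simp only [qf, TR, List.flatMap_nil, List.map_nil, List.prod_nil, Matrix.one_apply]
      split_ifs
      · rfl
      · simp
    | cons j js ih =>
      intro a b y
      have : qf (j :: js) = (L j).reverse.map (Sigma.mk j) ++ qf js := by simp only [qf, List.flatMap_cons]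
      rw [this]
      simp only [TR, List.map_append, List.prod_append, List.map_cons, List.prod_cons, Matrix.mul_apply,
        LinearMap.sum_apply, map_sum, Module.End.mul_apply] at ih ⊢
      refine sum_congr rfl fun d _ => ?_
      rw [hLint j u (hu j) (fun l => hu' ⟨j, l⟩), ih]
  have hT : ∀ u, Tmat V M E φ z u = ((List.finRange n).reverse.map fun j => Lmat V M E φ z j u).prod := by
    intro u
    rw [Tmat, List.ofFn_eq_map, List.map_reverse]
  refine ⟨univ.image z ∪ univ.image w, fun x hx => ?_⟩
  refine main_R ee w (qf (List.finRange n).reverse) (by omega) hU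
    (hqn _ (List.nodup_reverse.2 (List.nodup_finRange n))) x
    (fun q _ j => hx _ (mem_union_right _ (mem_image_of_mem _ (mem_univ q))) j) ιι hιι (Tmat V M E φ z) ?_
    (fun a b => ∑ j, EE V M E φ j a b) ?_
  · intro j a b y
    rw [hT]
    exact hTint _ (fun i => hx _ (mem_union_left _ (mem_image_of_mem _ (mem_univ i))) j)
      (fun q => hx _ (mem_union_right _ (mem_image_of_mem _ (mem_univ q))) j) _ a b y
  · intro a b y
    rw [Fintype.sum_sigma]
    simp only [LinearMap.sum_apply, map_sum]
    refine sum_congr rfl fun j _ => ?_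
    change PiTensorProduct.map ι (φ _) = _
    rw [hEE, tmA_map ι j _ (∑ q, e j q a b) (fun x => hintw j a b x), map_sum, LinearMap.sum_apply]
    rfl

theorem Dop_eq (V : Fin n → Type*) [∀ i, AddCommGroup (V i)] [∀ i, Module ℂ (V i)]
    (M : Type*) [AddCommGroup M] [Module ℂ M]
    (E : ∀ i : Fin n, Fin N → Fin N → (V i →ₗ[ℂ] V i)) (φ : M ≃ₗ[ℂ] PiTensorProduct ℂ V)
    (z : Fin n → ℂ) (f : ℂ → M) (u : ℂ) :
    Dop V M E φ z (1 : Matrix (Fin N) (Fin N) ℂ) f u = Dgen (Tmat V M E φ z) f u := by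
  rw [Dop]
  refine Dgen_eq (Tmat V M E φ z) (Xop V M E φ z 1) (fun a b f u => ?_) f u
  rw [Xop]
  congr 1
  rw [Finset.sum_eq_single a]
  · simp
  · intro c _ hc; simp [Matrix.one_apply_ne' hc]
  · simp
end Asm
end XXXAux

namespace XXXAux
open Finset

section RfS
variable {X Y Z : Type*} [AddCommGroup X] [Module ℂ X] [AddCommGroup Y] [Module ℂ Y] [AddCommGroup Z] [Module ℂ Z]

lemma PF_sum {α : Type*} (s : Finset α) (f : α → ℂ → X) (h : ∀ a ∈ s, f a ∈ PF X) : (fun u => ∑ a ∈ s, f a u) ∈ PF X := by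
  have := Submodule.sum_mem (PF X) h
  convert this using 1
  ext u; simp

lemma PF_bilin (B : X →ₗ[ℂ] Y →ₗ[ℂ] Z) {f : ℂ → X} {g : ℂ → Y} (hf : f ∈ PF X) (hg : g ∈ PF Y) :
    (fun u => B (f u) (g u)) ∈ PF Z := by
  obtain ⟨d, c, _, hc⟩ := PF_coeffs hf
  have : (fun u => B (f u) (g u)) = fun u => ∑ t ∈ range d, u ^ t • B (c t) (g u) := by
    ext u
    rw [hc, map_sum, LinearMap.sum_apply]
    simp
  rw [this]
  refine PF_sum _ _ fun t _ => ?_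
  have := PF_smul (PF_comp hg (B (c t))) (Polynomial.X ^ t)
  simpa using this

/-- rational functions regular off `S` -/
def Rf (S : Set ℂ) (X : Type*) [AddCommGroup X] [Module ℂ X] (g : ℂ → X) : Prop :=
  ∃ q : Polynomial ℂ, (∀ u, u ∉ S → q.eval u ≠ 0) ∧ ∃ G ∈ PF X, ∀ u, u ∉ S → q.eval u • g u = G u

variable {S : Set ℂ}

lemma Rf_PF {g : ℂ → X} (h : g ∈ PF X) : Rf S X g := ⟨1, by simp, g, h, by simp⟩

lemma Rf_bilin (B : X →ₗ[ℂ] Y →ₗ[ℂ] Z) {f : ℂ → X} {g : ℂ → Y} (hf : Rf S X f) (hg : Rf S Y g) :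
    Rf S Z (fun u => B (f u) (g u)) := by
  obtain ⟨q, hq, F, hF, h1⟩ := hf
  obtain ⟨q', hq', G, hG, h2⟩ := hg
  refine ⟨q * q', fun u hu => ?_, _, PF_bilin B hF hG, fun u hu => ?_⟩
  · rw [Polynomial.eval_mul]; exact mul_ne_zero (hq u hu) (hq' u hu)
  · rw [← h1 u hu, ← h2 u hu, Polynomial.eval_mul]
    simp [smul_smul, mul_comm]

lemma Rf_add {f g : ℂ → X} (hf : Rf S X f) (hg : Rf S X g) : Rf S X (fun u => f u + g u) := by
  obtain ⟨q, hq, F, hF, h1⟩ := hf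
  obtain ⟨q', hq', G, hG, h2⟩ := hg
  refine ⟨q * q', fun u hu => ?_, _, Submodule.add_mem _ (PF_smul hF q') (PF_smul hG q), fun u hu => ?_⟩
  · rw [Polynomial.eval_mul]; exact mul_ne_zero (hq u hu) (hq' u hu)
  · simp only [Pi.add_apply]
    rw [← h1 u hu, ← h2 u hu, Polynomial.eval_mul, smul_add, smul_smul, smul_smul, mul_comm (q'.eval u)]

lemma Rf_sum {α : Type*} (s : Finset α) (f : α → ℂ → X) (h : ∀ a ∈ s, Rf S X (f a)) :
    Rf S X (fun u => ∑ a ∈ s, f a u) := by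
  classical
  induction s using Finset.induction_on with
  | empty => simpa using Rf_PF (PF_const (0 : X))
  | insert a s ha ih =>
    simp only [sum_insert ha]
    exact Rf_add (h a (mem_insert_self a s)) (ih fun b hb => h b (mem_insert_of_mem hb))

lemma Rf_inv (w : ℂ) (v : X) (hw : w ∈ S) : Rf S X (fun u => (u - w)⁻¹ • v) := by
  refine ⟨Polynomial.X - Polynomial.C w, fun u hu => ?_, _, PF_const v, fun u hu => ?_⟩
  · have : u - w ≠ 0 := sub_ne_zero.2 (fun h => hu (h ▸ hw))
    simpa using this
  · have : u - w ≠ 0 := sub_ne_zero.2 (fun h => hu (h ▸ hw))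
    simp [smul_smul, this]

lemma Rf_mul {f g : ℂ → Module.End ℂ X} (hf : Rf S _ f) (hg : Rf S _ g) : Rf S _ (fun u => f u * g u) :=
  Rf_bilin (LinearMap.mul ℂ (Module.End ℂ X)) hf hg

lemma Rf_comp (L : X →ₗ[ℂ] Y) {f : ℂ → X} (hf : Rf S X f) : Rf S Y (fun u => L (f u)) := by
  obtain ⟨q, hq, F, hF, h1⟩ := hf
  exact ⟨q, hq, _, PF_comp hF L, fun u hu => by rw [← h1 u hu, map_smul]⟩

lemma Rf_zero {f : ℂ → X} (hf : Rf S X f) (A : Set ℂ) (hA : A.Infinite) (hAS : ∀ u ∈ A, u ∉ S) (h : ∀ u ∈ A, f u = 0) :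
    ∀ u, u ∉ S → f u = 0 := by
  obtain ⟨q, hq, F, hF, h1⟩ := hf
  intro u hu
  have := PF_eq_zero hF A hA (fun v hv => by rw [← h1 v (hAS v hv), h v hv, smul_zero]) u
  rw [← h1 u hu] at this
  exact (smul_eq_zero.1 this).resolve_left (hq u hu)

end RfS

section RfT
open XXXModel
variable {N n : ℕ} {R : Type*} [AddCommGroup R] [Module ℂ R] {S : Set ℂ}

lemma Rf_Phi (T : ℂ → Matrix (Fin N) (Fin N) (Module.End ℂ R))
    (hT : ∀ i : ℕ, i < N → ∀ a b, Rf S _ (fun u => T (u - i) a b)) (l : List (Fin N)) : ∀ i : ℕ, i + l.length ≤ N →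
    Rf S _ (fun u => Phi T l (u - i)) := by
  induction l with
  | nil => intro i _; exact Rf_PF (PF_const _)
  | cons a l ih =>
    intro i hi
    simp only [List.length_cons] at hi
    simp only [Phi]
    refine Rf_mul ?_ ?_
    · simp only [PsiT]
      refine Rf_sum _ _ fun b _ => Rf_mul (Rf_PF (PF_const _)) ?_
      exact Rf_comp (pwA (N := N) (X := R)).toLinearMap (hT i (by omega) a b)
    · have := ih (i + 1) (by omega)
      push_cast at this
      simpa only [sub_sub] using this

lemma Rf_Dgen (T : ℂ → Matrix (Fin N) (Fin N) (Module.End ℂ R))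
    (hT : ∀ i : ℕ, i < N → ∀ a b, Rf S _ (fun u => T (u - i) a b)) {f : ℂ → R} (hf : f ∈ PF R) :
    Rf S R (Dgen T f) := by
  have h : Dgen T f = fun u => ∑ I : Finset (Fin N), ((-1 : ℂ) ^ #I) • Phi T (I.sort (· ≤ ·)) u (vac (f (u - #I))) I := rfl
  rw [h]
  refine Rf_sum _ _ fun I _ => ?_
  have h1 := Rf_Phi T hT (I.sort (· ≤ ·)) 0 (by simpa using (card_le_univ I))
  simp only [Nat.cast_zero, sub_zero] at h1
  have h2 : Rf S _ (fun u => (LinearMap.single ℂ (fun _ : Finset (Fin N) => R) ∅) (f (u + (-(#I : ℂ))))) :=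
    Rf_comp _ (Rf_PF (PF_shift hf _))
  have h3 := Rf_comp (((-1 : ℂ) ^ #I) • (LinearMap.proj I : (Finset (Fin N) → R) →ₗ[ℂ] R))
    (Rf_bilin (LinearMap.id : Module.End ℂ (Finset (Fin N) → R) →ₗ[ℂ] _) h1 h2)
  simpa [sub_eq_add_neg, vac] using h3

lemma Rf_matprod {α : Type*} (A : α → ℂ → Matrix (Fin N) (Fin N) (Module.End ℂ R)) (js : List α)
    (h : ∀ j a b, Rf S _ (fun u => A j u a b)) : ∀ a b, Rf S _ (fun u => (js.map fun j => A j u).prod a b) := by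
  induction js with
  | nil => intro a b; exact Rf_PF (PF_const _)
  | cons j js ih =>
    intro a b
    simp only [List.map_cons, List.prod_cons, Matrix.mul_apply]
    exact Rf_sum _ _ fun c _ => Rf_mul (h j a c) (ih c b)

theorem Dgen_good (V : Fin n → Type*) [∀ i, AddCommGroup (V i)] [∀ i, Module ℂ (V i)]
    (M : Type*) [AddCommGroup M] [Module ℂ M]
    (E : ∀ i : Fin n, Fin N → Fin N → (V i →ₗ[ℂ] V i)) (φ : M ≃ₗ[ℂ] PiTensorProduct ℂ V)
    (z : Fin n → ℂ) {f : ℂ → M} (hf : f ∈ PF M) (x : ℂ) (hx : ∀ j, ∀ k : ℤ, x + k ≠ z j)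
    (h : ∀ s : ℕ, N ≤ s → Dgen (Tmat V M E φ z) f (x + s) = 0) (u : ℂ) (hu : Good N z u) :
    Dgen (Tmat V M E φ z) f u = 0 := by
  refine Rf_zero (S := {u | ¬ Good N z u}) (Rf_Dgen (Tmat V M E φ z) ?_ hf) _ (inf_shift x N) ?_ ?_ u (by simpa using hu)
  · intro i hi a b
    simp only [Tmat, List.ofFn_eq_map, ← List.map_reverse]
    refine Rf_matprod (fun j u => Lmat V M E φ z j (u - i)) _ (fun j a b => ?_) a b
    simp only [Lmat]
    refine Rf_add (Rf_PF (PF_const _)) ?_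
    have := Rf_inv (S := {u | ¬ Good N z u}) (z j + i) (EE V M E φ j b a) (fun hg => hg j i hi (by ring))
    simpa only [show ∀ u, u - (z j + i) = u - i - z j from fun u => by ring] using this
  · rintro _ ⟨s, hs, rfl⟩
    simp only [Set.mem_setOf_eq, not_not]
    intro j k hk
    have := hx j (s - k)
    push_cast at this
    rwa [add_sub_assoc]
  · rintro _ ⟨s, hs, rfl⟩
    exact h s hs
end RfT
end XXXAux

namespace XXXAux
open Finset Filter Topology

section AnS

/-- expansion at infinity of a scalar function: order at most `k`, leading coefficient `c` -/
def An (k : ℤ) (c : ℂ) (r : ℂ → ℂ) : Prop :=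
  ∃ h : ℂ → ℂ, AnalyticAt ℂ h 0 ∧ h 0 = c ∧ ∀ᶠ s in 𝓝[≠] (0 : ℂ), r s⁻¹ = s ^ (-k) * h s

lemma An_add {k : ℤ} {c c' : ℂ} {r r' : ℂ → ℂ} (h : An k c r) (h' : An k c' r') : An k (c + c') (fun u => r u + r' u) := by
  obtain ⟨g, hg, g0, hr⟩ := h
  obtain ⟨g', hg', g0', hr'⟩ := h'
  refine ⟨fun s => g s + g' s, hg.add hg', by simp [g0, g0'], ?_⟩
  filter_upwards [hr, hr'] with s h1 h2
  rw [h1, h2, mul_add]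

lemma An_mul {k k' : ℤ} {c c' : ℂ} {r r' : ℂ → ℂ} (h : An k c r) (h' : An k' c' r') :
    An (k + k') (c * c') (fun u => r u * r' u) := by
  obtain ⟨g, hg, g0, hr⟩ := h
  obtain ⟨g', hg', g0', hr'⟩ := h'
  refine ⟨fun s => g s * g' s, hg.mul hg', by simp [g0, g0'], ?_⟩
  filter_upwards [hr, hr', self_mem_nhdsWithin] with s h1 h2 hs
  rw [h1, h2, neg_add, zpow_add₀ hs]; ring

lemma An_const (c : ℂ) : An 0 c (fun _ => c) := ⟨fun _ => c, analyticAt_const, rfl, by simp⟩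

lemma An_cmul {k : ℤ} {c : ℂ} {r : ℂ → ℂ} (a : ℂ) (h : An k c r) : An k (a * c) (fun u => a * r u) := by
  simpa using An_mul (An_const a) h

lemma An_up {k k' : ℤ} {c : ℂ} {r : ℂ → ℂ} (h : An k c r) (hk : k < k') : An k' 0 r := by
  obtain ⟨g, hg, g0, hr⟩ := h
  obtain ⟨d, hd⟩ : ∃ d : ℕ, k' = k + (d + 1 : ℕ) := ⟨(k' - k - 1).toNat, by push_cast; omega⟩
  refine ⟨fun s => s ^ (d + 1) * g s, (analyticAt_id.pow _).mul hg, by simp, ?_⟩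
  filter_upwards [hr, self_mem_nhdsWithin] with s h1 hs
  rw [h1, hd, neg_add, zpow_add₀ hs, zpow_neg s ((d + 1 : ℕ) : ℤ), zpow_natCast, mul_assoc, inv_mul_cancel_left₀ (pow_ne_zero _ hs)]

lemma An_zero (k : ℤ) : An k 0 (fun _ => 0) := ⟨fun _ => 0, analyticAt_const, rfl, by simp⟩

lemma An_sum {α : Type*} (s : Finset α) {k : ℤ} (c : α → ℂ) (r : α → ℂ → ℂ) (h : ∀ a ∈ s, An k (c a) (r a)) :
    An k (∑ a ∈ s, c a) (fun u => ∑ a ∈ s, r a u) := by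
  classical
  induction s using Finset.induction_on with
  | empty => simpa using An_zero k
  | insert a s ha ih =>
    simp only [sum_insert ha]
    exact An_add (h a (mem_insert_self a s)) (ih fun b hb => h b (mem_insert_of_mem hb))

lemma sh_an : AnalyticAt ℂ (fun s : ℂ => s / (1 - s)) 0 :=
  analyticAt_id.div (analyticAt_const.sub analyticAt_id) (by simp)

lemma sh_tendsto : Tendsto (fun s : ℂ => s / (1 - s)) (𝓝[≠] 0) (𝓝[≠] 0) := by
  refine tendsto_nhdsWithin_iff.2 ⟨?_, ?_⟩
  · have : Tendsto (fun s : ℂ => s / (1 - s)) (𝓝 0) (𝓝 ((0 : ℂ) / (1 - 0))) := sh_an.continuousAt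
    rw [zero_div] at this
    exact this.mono_left nhdsWithin_le_nhds
  · have h1 : ∀ᶠ s in 𝓝 (0 : ℂ), s ≠ 1 := isOpen_ne.mem_nhds (by simp)
    filter_upwards [self_mem_nhdsWithin, h1.filter_mono nhdsWithin_le_nhds] with s hs hs1
    exact div_ne_zero hs (sub_ne_zero.2 (Ne.symm hs1))

lemma An_shift_ex {k : ℤ} {h r : ℂ → ℂ} (hr : ∀ᶠ s in 𝓝[≠] (0 : ℂ), r s⁻¹ = s ^ (-k) * h s) :
    ∀ᶠ s in 𝓝[≠] (0 : ℂ), r (s⁻¹ - 1) = s ^ (-k) * ((1 - s) ^ k * h (s / (1 - s))) := by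
  have h1 : ∀ᶠ s in 𝓝 (0 : ℂ), s ≠ 1 := isOpen_ne.mem_nhds (by simp)
  filter_upwards [sh_tendsto.eventually hr, self_mem_nhdsWithin, h1.filter_mono nhdsWithin_le_nhds] with s h2 hs hs1
  have hs : s ≠ 0 := hs
  have hs2 : 1 - s ≠ 0 := sub_ne_zero.2 (Ne.symm hs1)
  rw [show s⁻¹ - 1 = (s / (1 - s))⁻¹ by field_simp, h2, div_zpow, zpow_neg (1 - s), div_inv_eq_mul, mul_assoc]

lemma sh2_an {k : ℤ} {h : ℂ → ℂ} (hh : AnalyticAt ℂ h 0) :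
    AnalyticAt ℂ (fun s => (1 - s) ^ k * h (s / (1 - s))) 0 := by
  refine AnalyticAt.mul (AnalyticAt.zpow (analyticAt_const.sub analyticAt_id) (by simp)) ?_
  exact AnalyticAt.comp' (by simpa using hh) sh_an

lemma An_shift {k : ℤ} {c : ℂ} {r : ℂ → ℂ} (h : An k c r) : An k c (fun u => r (u - 1)) := by
  obtain ⟨g, hg, g0, hr⟩ := h
  exact ⟨_, sh2_an hg, by simp [g0], An_shift_ex hr⟩

lemma An_diff {k : ℤ} {c : ℂ} {r : ℂ → ℂ} (h : An k c r) : An (k - 1) (k * c) (fun u => r u - r (u - 1)) := by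
  obtain ⟨g, hg, g0, hr⟩ := h
  let H : ℂ → ℂ := fun s => g s - (1 - s) ^ k * g (s / (1 - s))
  have hH : AnalyticAt ℂ H 0 := hg.sub (sh2_an hg)
  have hH0 : H 0 = 0 := by simp [H]
  have hd : HasDerivAt H (k * c) 0 := by
    have d1 : HasDerivAt g (deriv g 0) 0 := hg.differentiableAt.hasDerivAt
    have d2 : HasDerivAt (fun s : ℂ => 1 - s) (-1) 0 := by simpa using (hasDerivAt_id (0 : ℂ)).const_sub 1
    have d3 : HasDerivAt (fun s : ℂ => (1 - s) ^ k) (k * (1 - 0) ^ (k - 1) * (-1)) 0 :=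
      HasDerivAt.comp (0 : ℂ) (hasDerivAt_zpow k (1 - 0 : ℂ) (Or.inl (by simp))) d2
    have d4 : HasDerivAt (fun s : ℂ => s / (1 - s)) 1 0 := by
      have : HasDerivAt (fun s : ℂ => s / (1 - s)) _ 0 := (hasDerivAt_id (0 : ℂ)).div d2 (by simp)
      convert this using 1
      simp
    have d5 : HasDerivAt (fun s : ℂ => g (s / (1 - s))) (deriv g 0 * 1) 0 :=
      HasDerivAt.comp (0 : ℂ) (by simpa using d1) d4
    have d6 : HasDerivAt H _ 0 := d1.sub (d3.mul d5)
    convert d6 using 1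
    simp [g0]
  obtain ⟨p, hp⟩ := hH
  refine ⟨dslope H 0, hp.has_fpower_series_dslope_fslope.analyticAt, by rw [dslope_same, hd.deriv], ?_⟩
  filter_upwards [hr, An_shift_ex hr, self_mem_nhdsWithin] with s h1 h2 hs
  have hs : s ≠ 0 := hs
  rw [h1, h2, dslope_of_ne _ hs, slope_def_field, hH0, show -(k - 1) = -k + 1 by ring, zpow_add₀ hs, sub_zero, sub_zero, zpow_one]
  simp only [H]
  field_simp

lemma An_unique {k : ℤ} {c : ℂ} {r : ℂ → ℂ} (h : An k c r) (h0 : ∀ᶠ s in 𝓝[≠] (0 : ℂ), r s⁻¹ = 0) : c = 0 := by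
  obtain ⟨g, hg, g0, hr⟩ := h
  have h1 : Tendsto g (𝓝[≠] 0) (𝓝 (g 0)) := hg.continuousAt.tendsto.mono_left nhdsWithin_le_nhds
  have h2 : Tendsto g (𝓝[≠] 0) (𝓝 0) := by
    refine Tendsto.congr' ?_ tendsto_const_nhds
    filter_upwards [hr, h0, self_mem_nhdsWithin] with s h1 h2 hs
    rw [h1] at h2
    exact ((mul_eq_zero.1 h2).resolve_left (zpow_ne_zero _ hs)).symm
  rw [← g0]
  exact tendsto_nhds_unique h1 h2

lemma An_pow (t : ℕ) : An t 1 (fun u => u ^ t) :=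
  ⟨fun _ => 1, analyticAt_const, rfl, by simp⟩

lemma An_inv (z : ℂ) : An (-1) 1 (fun u => (u - z)⁻¹) := by
  refine ⟨fun s => (1 - z * s)⁻¹, ?_, by simp, ?_⟩
  · exact (analyticAt_const.sub (analyticAt_const.mul analyticAt_id)).inv (by simp)
  · filter_upwards [self_mem_nhdsWithin] with s hs
    have hs : s ≠ 0 := hs
    rw [neg_neg, zpow_one, show s⁻¹ - z = s⁻¹ * (1 - z * s) by field_simp, mul_inv, inv_inv]

end AnS

section VAs
variable {X Y Z : Type*} [AddCommGroup X] [Module ℂ X] [AddCommGroup Y] [Module ℂ Y] [AddCommGroup Z] [Module ℂ Z]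

/-- vector valued expansions at infinity -/
def VA (k : ℤ) (v : X) (f : ℂ → X) : Prop := ∀ ℓ : X →ₗ[ℂ] ℂ, An k (ℓ v) (fun u => ℓ (f u))

lemma VA_add {k : ℤ} {v v' : X} {f f' : ℂ → X} (h : VA k v f) (h' : VA k v' f') : VA k (v + v') (fun u => f u + f' u) := by
  intro ℓ; simpa using An_add (h ℓ) (h' ℓ)

lemma VA_sum {α : Type*} (s : Finset α) {k : ℤ} (v : α → X) (f : α → ℂ → X) (h : ∀ a ∈ s, VA k (v a) (f a)) :
    VA k (∑ a ∈ s, v a) (fun u => ∑ a ∈ s, f a u) := by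
  intro ℓ; simpa using An_sum s (fun a => ℓ (v a)) (fun a u => ℓ (f a u)) (fun a ha => h a ha ℓ)

lemma VA_comp {k : ℤ} {v : X} {f : ℂ → X} (h : VA k v f) (L : X →ₗ[ℂ] Y) : VA k (L v) (fun u => L (f u)) :=
  fun ℓ => h (ℓ ∘ₗ L)

lemma VA_up {k k' : ℤ} {v : X} {f : ℂ → X} (h : VA k v f) (hk : k < k') : VA k' 0 f := by
  intro ℓ; rw [map_zero]; exact An_up (h ℓ) hk

lemma VA_shift {k : ℤ} {v : X} {f : ℂ → X} (h : VA k v f) : VA k v (fun u => f (u - 1)) := fun ℓ => An_shift (h ℓ)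

lemma VA_diff {k : ℤ} {v : X} {f : ℂ → X} (h : VA k v f) : VA (k - 1) ((k : ℂ) • v) (fun u => f u - f (u - 1)) := by
  intro ℓ; simpa using An_diff (h ℓ)

lemma VA_smul {k k' : ℤ} {c : ℂ} {r : ℂ → ℂ} (hr : An k c r) {v : X} {f : ℂ → X} (h : VA k' v f) :
    VA (k + k') (c • v) (fun u => r u • f u) := by
  intro ℓ; simpa using An_mul hr (h ℓ)

lemma VA_const (v : X) : VA 0 v (fun _ => v) := fun ℓ => An_const (ℓ v)

lemma VA_bilin [FiniteDimensional ℂ Y] (B : X →ₗ[ℂ] Y →ₗ[ℂ] Z) {k k' : ℤ} {v : X} {f : ℂ → X} {w : Y} {g : ℂ → Y}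
    (hf : VA k v f) (hg : VA k' w g) : VA (k' + k) (B v w) (fun u => B (f u) (g u)) := by
  let b := Module.finBasis ℂ Y
  have h1 : ∀ (x : X) (y : Y), B x y = ∑ i, b.coord i y • (B.flip (b i)) x := by
    intro x y
    conv_lhs => rw [← b.sum_repr y, map_sum]
    simp only [map_smul]
    rfl
  simp only [h1]
  exact VA_sum _ _ _ fun i _ => VA_smul (hg (b.coord i)) (VA_comp hf (B.flip (b i)))

lemma VA_unique {k : ℤ} {v : X} {f : ℂ → X} (h : VA k v f) (h0 : ∀ᶠ s in 𝓝[≠] (0 : ℂ), f s⁻¹ = 0) : v = 0 := by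
  rw [← Module.forall_dual_apply_eq_zero_iff ℂ]
  intro ℓ
  refine An_unique (h ℓ) ?_
  filter_upwards [h0] with s hs
  rw [hs, map_zero]
end VAs

section Lead
variable {N : ℕ} {M : Type*} [AddCommGroup M] [Module ℂ M] [FiniteDimensional ℂ M]

theorem lead (T : ℂ → Matrix (Fin N) (Fin N) (Module.End ℂ M)) (Xo : Fin N → Fin N → (ℂ → M) → ℂ → M)
    (hX : ∀ a b f u, Xo a b f u = (if a = b then f u else 0) - T u a b (f (u - 1)))
    (K : Fin N → Fin N → Module.End ℂ M)
    (hT : ∀ a b, VA (-1) (K b a) (fun u => T u a b - (1 : Matrix (Fin N) (Fin N) (Module.End ℂ M)) a b))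
    (m : Fin N → ℂ) (v0 : M) (hv1 : ∀ a, K a a v0 = m a • v0) (hv2 : ∀ a b, a < b → K a b v0 = 0)
    (f : ℂ → M) (d : ℤ) (hf : VA d v0 f)
    (h0 : ∀ᶠ s in 𝓝[≠] (0 : ℂ), ∑ σ : Equiv.Perm (Fin N), ((Equiv.Perm.sign σ : ℤˣ) : ℤ) •
      (((List.ofFn fun a : Fin N => Xo a (σ a)).foldr (· ∘ ·) id) f s⁻¹) = 0) :
    v0 = 0 ∨ ∃ a : Fin N, (d : ℂ) - (N - 1 - (a : ℕ)) - m a = 0 := by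
  have hstep : ∀ a b (k : ℤ) (v : M) (g : ℂ → M), VA k v g →
      VA (k - 1) ((if a = b then (k : ℂ) • v else 0) + (-1 : ℂ) • K b a v) (Xo a b g) := by
    intro a b k v g hg
    have e1 : Xo a b g = fun u => (if a = b then (1 : Module.End ℂ M) else 0) (g u - g (u - 1)) +
        ((-1 : ℂ) • (LinearMap.id : M →ₗ[ℂ] M)) ((T u a b - (1 : Matrix (Fin N) (Fin N) (Module.End ℂ M)) a b) (g (u - 1))) := by
      funext u
      rw [hX]
      simp only [Matrix.one_apply]
      split_ifs <;> simp
    rw [e1]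
    refine VA_add ?_ ?_
    · have := VA_comp (VA_diff hg) (if a = b then (1 : Module.End ℂ M) else 0)
      convert this using 1
      split_ifs <;> simp
    · have := VA_comp (VA_bilin (LinearMap.id : Module.End ℂ M →ₗ[ℂ] _) (hT a b) (VA_shift hg)) ((-1 : ℂ) • (LinearMap.id : M →ₗ[ℂ] M))
      simpa [← sub_eq_add_neg] using this
  let fac : Equiv.Perm (Fin N) → Fin N → ℂ := fun σ a => if σ a = a then (d : ℂ) - (N - 1 - (a : ℕ)) - m a else 0
  have hmain : ∀ (σ : Equiv.Perm (Fin N)) (j : ℕ), j ≤ N →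
      VA (d - j) ((((List.finRange N).drop (N - j)).map (fac σ)).prod • v0)
        ((((List.finRange N).drop (N - j)).map fun a => Xo a (σ a)).foldr (· ∘ ·) id f) := by
    intro σ j
    induction j with
    | zero => 
      intro _
      have : (List.finRange N).drop (N - 0) = [] := List.drop_eq_nil_of_le (by simp)
      rw [this]; simpa using hf
    | succ j ih =>
      intro hj
      have ih := ih (by omega)
      have hlt : N - (j + 1) < (List.finRange N).length := by simp; omega
      have hdrop : (List.finRange N).drop (N - (j + 1)) = ⟨N - (j + 1), by omega⟩ :: (List.finRange N).drop (N - j) := by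
        rw [List.drop_eq_getElem_cons hlt]
        congr 1
        · simp
        · congr 1; omega
      rw [hdrop]
      simp only [List.map_cons, List.foldr_cons, List.prod_cons, Function.comp]
      set a : Fin N := ⟨N - (j + 1), by omega⟩ with ha
      set p := (((List.finRange N).drop (N - j)).map (fac σ)).prod with hp
      have h1 := hstep a (σ a) _ _ _ ih
      have e1 : d - ((j + 1 : ℕ) : ℤ) = d - j - 1 := by push_cast; ring
      rw [e1]
      convert h1 using 1
      have haN : ((a : ℕ) : ℂ) = N - (j + 1) := by
        rw [ha]; simp only; rw [Nat.cast_sub hj]; push_cast; ring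
      by_cases h2 : σ a = a
      · simp only [fac, h2, if_true]
        rw [map_smul, hv1, haN]
        simp only [smul_smul, ← add_smul]
        congr 1
        push_cast; ring
      · simp only [fac, h2, Ne.symm h2, if_false, zero_mul, zero_smul, zero_add]
        rcases lt_or_gt_of_ne h2 with h3 | h3
        · rw [map_smul, hv2 _ _ h3]; simp
        · have : p = 0 := by
            rw [hp]
            refine List.prod_eq_zero (List.mem_map.2 ⟨σ a, ?_, ?_⟩)
            · rw [List.mem_iff_getElem]
              have h4 : N - (j + 1) < (σ a : ℕ) := h3
              refine ⟨(σ a : ℕ) - (N - j), ?_, ?_⟩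
              · simp; omega
              · ext; simp; omega
            · simp only [fac]
              rw [if_neg]
              intro h5; exact h2 (σ.injective h5)
          rw [this]; simp
  have hfin : ∀ σ : Equiv.Perm (Fin N), VA (d - N) ((∏ a, fac σ a) • v0)
      ((List.ofFn fun a : Fin N => Xo a (σ a)).foldr (· ∘ ·) id f) := by
    intro σ
    have := hmain σ N le_rfl
    simp only [Nat.sub_self, List.drop_zero] at this
    rw [List.ofFn_eq_map]
    convert this using 2
    rw [← List.ofFn_eq_map, List.prod_ofFn]
  have hsum := VA_sum (univ : Finset (Equiv.Perm (Fin N))) _ _ fun σ _ =>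
    VA_comp (hfin σ) (((Equiv.Perm.sign σ : ℤˣ) : ℤ) • (LinearMap.id : M →ₗ[ℂ] M))
  have hz := VA_unique hsum (by simpa using h0)
  rw [Finset.sum_eq_single 1] at hz
  · simp only [Equiv.Perm.sign_one, Units.val_one, one_smul, LinearMap.id_apply] at hz
    rcases smul_eq_zero.1 hz with h | h
    · right
      obtain ⟨a, _, ha⟩ := Finset.prod_eq_zero_iff.1 h
      exact ⟨a, by simpa [fac] using ha⟩
    · exact Or.inl h
  · intro σ _ hσ
    obtain ⟨a, ha⟩ : ∃ a, σ a ≠ a := by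
      by_contra hcon
      push Not at hcon
      exact hσ (Equiv.ext hcon)
    have : ∏ a, fac σ a = 0 := Finset.prod_eq_zero (mem_univ a) (by simp [fac, ha])
    rw [this]; simp
  · simp
end Lead
end XXXAux

namespace XXXAux
open Finset Filter Topology

section Fin1
variable {M : Type*} [AddCommGroup M] [Module ℂ M]

lemma coeff_zero (D : ℕ) (c : ℕ → M) (h : ∀ u : ℂ, ∑ t ∈ range D, u ^ t • c t = 0) : ∀ t < D, c t = 0 := by
  intro t ht
  rw [← Module.forall_dual_apply_eq_zero_iff ℂ]
  intro ℓ
  let p : Polynomial ℂ := ∑ t ∈ range D, Polynomial.C (ℓ (c t)) * Polynomial.X ^ t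
  have hp : p = 0 := by
    refine Polynomial.funext fun u => ?_
    have := congrArg ℓ (h u)
    simp only [map_sum, map_smul, map_zero, smul_eq_mul] at this
    simp only [p, Polynomial.eval_finset_sum, Polynomial.eval_mul, Polynomial.eval_C, Polynomial.eval_pow, Polynomial.eval_X,
      Polynomial.eval_zero]
    rw [← this]
    exact sum_congr rfl fun t _ => mul_comm _ _
  have h1 : p.coeff t = ℓ (c t) := by
    simp only [p, Polynomial.finset_sum_coeff, Polynomial.coeff_C_mul_X_pow]
    rw [Finset.sum_ite_eq]
    simp [ht]
  rw [← h1, hp, Polynomial.coeff_zero]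

lemma sum_ext_range (c : ℕ → M) (d D : ℕ) (hd : d ≤ D) (hc : ∀ t, d ≤ t → c t = 0) (u : ℂ) :
    ∑ t ∈ range d, u ^ t • c t = ∑ t ∈ range D, u ^ t • c t := by
  refine Finset.sum_subset (by simpa using hd) fun t _ ht => ?_
  rw [hc t (by simpa using ht), smul_zero]

lemma exists_top (c : ℕ → M) (D : ℕ) (hc : ∀ t, D ≤ t → c t = 0) (t0 : ℕ) (ht0 : c t0 ≠ 0) :
    ∃ d, c d ≠ 0 ∧ ∀ t, d < t → c t = 0 := by
  classical
  have hlt : t0 ≤ D := by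
    by_contra h
    exact ht0 (hc t0 (by omega))
  refine ⟨Nat.findGreatest (fun t => c t ≠ 0) D, Nat.findGreatest_spec (P := fun t => c t ≠ 0) hlt ht0, fun t ht => ?_⟩
  by_cases h : t ≤ D
  · by_contra h1
    exact absurd (Nat.le_findGreatest (P := fun t => c t ≠ 0) h h1) (by omega)
  · exact hc t (by omega)

theorem final_abs {N : ℕ} [FiniteDimensional ℂ M] (W : Submodule ℂ M) (l : Fin N → ℕ)
    (Sol : Submodule ℂ (ℂ → M)) (x0 : ℂ) (P : Fin N → ℂ → Module.End ℂ M) (hP : ∀ k, P k ∈ PF (Module.End ℂ M))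
    (hPW : ∀ k u, ∀ v ∈ W, P k u v ∈ W)
    (hvan : ∀ (k : Fin N) (i : ℕ), 1 ≤ i → i < N → P k (x0 + (k : ℕ) - i) = 0)
    (hc : ∀ k : Fin N, ∃ c : ℂ, c ≠ 0 ∧ ∀ v, P k (x0 + (k : ℕ)) v = c • v)
    (hsol : ∀ k, ∀ v ∈ W, (fun u => P k u v) ∈ Sol)
    (hlead : ∀ (D : ℕ) (c : ℕ → M), (∀ t, c t ∈ W) → (∀ t, D ≤ t → c t = 0) →
      (fun u : ℂ => ∑ t ∈ range D, u ^ t • c t) ∈ Sol → ∀ d, c d ≠ 0 → (∀ t, d < t → c t = 0) → ∃ a, d = l a)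
    (ii : Fin N) (v0 : M) (hv0 : v0 ∈ W) (hv : v0 ≠ 0) :
    ∃ c : ℕ → M, (∀ t, c t ∈ W) ∧ c (l ii) = v0 ∧ (∀ t, l ii < t → c t = 0) ∧ (∀ j, j ≠ ii → c (l j) = 0) ∧
      (fun u : ℂ => ∑ t ∈ range (l ii + 1), u ^ t • c t) ∈ Sol := by
  classical
  choose Dk p hp0 hp using fun k => PF_coeffs (hP k)
  let D := univ.sup Dk
  have hDk : ∀ k, Dk k ≤ D := fun k => Finset.le_sup (mem_univ k)
  have hp0' : ∀ k t, D ≤ t → p k t = 0 := fun k t ht => hp0 k t ((hDk k).trans ht)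
  have hp' : ∀ k u, P k u = ∑ t ∈ range D, u ^ t • p k t := fun k u => by
    rw [hp, sum_ext_range (p k) (Dk k) D (hDk k) (hp0 k)]
  have hpW : ∀ k t, ∀ v ∈ W, p k t v ∈ W := by
    intro k t v hv
    by_cases ht : t < D
    · have := coeff_zero D (fun t => W.mkQ (p k t v)) (fun u => by
        have h1 := (Submodule.Quotient.mk_eq_zero W).2 (hPW k u v hv)
        rw [hp'] at h1
        rw [← Submodule.mkQ_apply] at h1
        simpa only [LinearMap.sum_apply, LinearMap.smul_apply, map_sum, map_smul] using h1) t ht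
      exact (Submodule.Quotient.mk_eq_zero W).1 this
    · rw [hp0' k t (by omega)]; simp
  let C : (Fin N → W) → ℕ → M := fun w t => ∑ k, p k t (w k)
  have hCW : ∀ w t, C w t ∈ W := fun w t => Submodule.sum_mem _ fun k _ => hpW k t _ (w k).2
  have hC0 : ∀ w t, D ≤ t → C w t = 0 := fun w t ht => Finset.sum_eq_zero fun k _ => by rw [hp0' k t ht]; rfl
  have hCF : ∀ w u, ∑ t ∈ range D, u ^ t • C w t = ∑ k, P k u (w k) := by
    intro w u
    simp only [C, Finset.smul_sum]
    rw [Finset.sum_comm]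
    refine sum_congr rfl fun k _ => ?_
    rw [hp', LinearMap.sum_apply]; rfl
  have hCS : ∀ w, (fun u : ℂ => ∑ t ∈ range D, u ^ t • C w t) ∈ Sol := by
    intro w
    have : (fun u : ℂ => ∑ t ∈ range D, u ^ t • C w t) = ∑ k, fun u => P k u (w k) := by
      funext u; rw [hCF]; simp
    rw [this]
    exact Submodule.sum_mem _ fun k _ => hsol k _ (w k).2
  let A : (Fin N → W) →ₗ[ℂ] (Fin N → W) :=
    LinearMap.pi fun i => ∑ k, ((p k (l i)).restrict (hpW k (l i))) ∘ₗ LinearMap.proj k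
  have hA : ∀ w i, ((A w i : W) : M) = C w (l i) := by
    intro w i
    simp [A, C, LinearMap.sum_apply]
  have hinj : Function.Injective A := by
    rw [injective_iff_map_eq_zero]
    intro w hw
    have hz : ∀ i, C w (l i) = 0 := fun i => by rw [← hA, hw]; rfl
    have hall : ∀ t, C w t = 0 := by
      intro t
      by_contra ht
      obtain ⟨d, hd, hd'⟩ := exists_top (C w) D (hC0 w) t ht
      obtain ⟨a, ha⟩ := hlead D (C w) (hCW w) (hC0 w) (hCS w) d hd hd'
      exact hd (ha ▸ hz a)
    have hF : ∀ u, ∑ k, P k u (w k) = 0 := by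
      intro u; rw [← hCF]; simp [hall]
    have hk : ∀ (j : ℕ) (hj : j < N), w ⟨j, hj⟩ = 0 := by
      intro j
      induction j using Nat.strong_induction_on with
      | _ j ih =>
        intro hj
        have h1 := hF (x0 + (j : ℕ))
        rw [Finset.sum_eq_single (⟨j, hj⟩ : Fin N)] at h1
        · obtain ⟨c, hc0, hcv⟩ := hc ⟨j, hj⟩
          simp only at hcv
          rw [hcv] at h1
          exact Subtype.ext ((smul_eq_zero.1 h1).resolve_left hc0)
        · intro k _ hk
          have hk' : (k : ℕ) ≠ j := fun h => hk (Fin.ext h)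
          rcases lt_or_gt_of_ne hk' with h2 | h2
          · have := ih k h2 k.2
            rw [Fin.eta] at this
            rw [this]; simp
          · have := hvan k (k - j) (by omega) (by omega)
            rw [Nat.cast_sub h2.le, show x0 + ((k : ℕ) : ℂ) - ((k : ℕ) - j) = x0 + j by ring] at this
            rw [this]; rfl
        · simp
    funext k
    exact hk k k.2
  obtain ⟨w, hw⟩ := (LinearMap.injective_iff_surjective.1 hinj) (Pi.single ii ⟨v0, hv0⟩)
  have h1 : C w (l ii) = v0 := by rw [← hA, hw]; simp
  have h2 : ∀ j, j ≠ ii → C w (l j) = 0 := fun j hj => by rw [← hA, hw]; simp [hj]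
  have h3 : ∀ t, l ii < t → C w t = 0 := by
    obtain ⟨d, hd, hd'⟩ := exists_top (C w) D (hC0 w) (l ii) (by rw [h1]; exact hv)
    obtain ⟨a, ha⟩ := hlead D (C w) (hCW w) (hC0 w) (hCS w) d hd hd'
    have : a = ii := by
      by_contra hne
      exact hd (ha ▸ h2 a hne)
    subst this
    rw [← ha]; exact hd'
  refine ⟨C w, hCW w, h1, h3, h2, ?_⟩
  have h4 : (fun u : ℂ => ∑ t ∈ range (l ii + 1), u ^ t • C w t) = fun u : ℂ => ∑ t ∈ range D, u ^ t • C w t := by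
    funext u
    rw [sum_ext_range (C w) (l ii + 1) (max (l ii + 1) D) (le_max_left _ _) (fun t ht => h3 t ht),
      sum_ext_range (C w) D (max (l ii + 1) D) (le_max_right _ _) (hC0 w)]
  rw [h4]; exact hCS w

open XXXModel

theorem indep_periodic {ι : Type*} [Fintype ι] (F : ι → ℂ → M) (hF : ∀ i, F i ∈ PF M)
    (hind : ∀ α : ι → ℂ, (∀ u, ∑ i, α i • F i u = 0) → ∀ i, α i = 0) : IndepPeriodic F := by
  intro c hm hp hz
  have step1 : ∀ x, (∀ i, AnalyticAt ℂ (c i) x) → ∀ i, c i x = 0 := by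
    intro x hx
    have hper : ∀ i (k : ℕ) y, c i (y + k) = c i y := by
      intro i k
      induction k with
      | zero => simp
      | succ k ih => intro y; push_cast; rw [← add_assoc, hp, ih]
    refine hind (fun i => c i x) (PF_eq_zero (PF_sum _ _ fun i _ => Submodule.smul_mem _ (c i x) (hF i)) _ (inf_shift x 0) ?_)
    rintro _ ⟨s, _, rfl⟩
    have h1 : ∀ i, AnalyticAt ℂ (c i) (x + s) := by
      intro i
      have h2 : c i = fun y => c i (y - s) := by
        funext y
        rw [← hper i s (y - s), sub_add_cancel]
      rw [h2]
      exact AnalyticAt.comp' (f := fun y : ℂ => y - s) (by simpa using hx i) (analyticAt_id.sub analyticAt_const)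
    have h3 := hz _ h1
    simpa only [hper] using h3
  intro i x hx
  have h1 : ∀ᶠ y in 𝓝[≠] x, ∀ j, AnalyticAt ℂ (c j) y := by
    rw [Filter.eventually_all]
    intro j
    have : MeromorphicAt (c j) x := hm j x
    exact this.eventually_analyticAt
  have h2 : Tendsto (c i) (𝓝[≠] x) (𝓝 0) := by
    refine Tendsto.congr' ?_ tendsto_const_nhds
    filter_upwards [h1] with y hy
    exact (step1 y hy i).symm
  exact tendsto_nhds_unique (hx.continuousAt.tendsto.mono_left nhdsWithin_le_nhds) h2

lemma exists_generic (bad : Finset ℂ) : ∃ x : ℂ, ∀ b ∈ bad, ∀ j : ℤ, x + j ≠ b := by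
  have hc : (⋃ b ∈ bad, ⋃ j : ℤ, {b - (j : ℂ)}).Countable := by
    refine Set.Countable.biUnion (bad.countable_toSet) fun b _ => Set.countable_iUnion fun j => Set.countable_singleton _
  obtain ⟨x, hx⟩ := (hc.dense_compl ℝ).nonempty
  refine ⟨x, fun b hb j h => hx ?_⟩
  simp only [Set.mem_iUnion, Set.mem_singleton_iff]
  exact ⟨b, hb, j, by rw [← h]; ring⟩

end Fin1

section Fin2
open XXXModel
variable {N n : ℕ} (V : Fin n → Type*) [∀ i, AddCommGroup (V i)] [∀ i, Module ℂ (V i)]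
    (M : Type*) [AddCommGroup M] [Module ℂ M]
    (E : ∀ i : Fin n, Fin N → Fin N → (V i →ₗ[ℂ] V i)) (φ : M ≃ₗ[ℂ] PiTensorProduct ℂ V)
    (z : Fin n → ℂ)

lemma mem_SingWt (m : Fin N → ℤ) (v : M) : v ∈ SingWt V M E φ m ↔
    (∀ a, (∑ j, EE V M E φ j a a) v = (m a : ℂ) • v) ∧ ∀ a b, a < b → (∑ j, EE V M E φ j a b) v = 0 := by
  simp only [SingWt, Wt, Submodule.mem_inf, Submodule.mem_iInf, LinearMap.mem_ker, LinearMap.sub_apply, sub_eq_zero,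
    LinearMap.smul_apply, Module.End.one_apply]

lemma VA_Tmat [FiniteDimensional ℂ M] (a b : Fin N) : VA (-1) (∑ j, EE V M E φ j b a)
    (fun u => Tmat V M E φ z u a b - (1 : Matrix (Fin N) (Fin N) (Module.End ℂ M)) a b) := by
  have key : ∀ (js : List (Fin n)) a b, VA (-1) ((js.map fun j => EE V M E φ j b a).sum)
      (fun u => (js.map fun j => Lmat V M E φ z j u).prod a b - (1 : Matrix (Fin N) (Fin N) (Module.End ℂ M)) a b) := by
    intro js
    induction js with
    | nil =>
      intro a b
      simp only [List.map_nil, List.prod_nil, List.sum_nil, sub_self]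
      exact VA_up (k := -2) (v := (0 : Module.End ℂ M)) (fun ℓ => by simpa using An_zero (-2)) (by norm_num)
    | cons j js ih =>
      intro a b
      have hL : ∀ a b, VA (-1) (EE V M E φ j b a)
          (fun u => (Lmat V M E φ z j u - 1 : Matrix (Fin N) (Fin N) (Module.End ℂ M)) a b) := by
        intro a b
        have h1 := VA_smul (An_inv (z j)) (VA_const (EE V M E φ j b a))
        simpa [Lmat, Matrix.sub_apply, Matrix.one_apply] using h1
      have h2 : ∀ u, ((j :: js).map fun j => Lmat V M E φ z j u).prod a b - (1 : Matrix (Fin N) (Fin N) (Module.End ℂ M)) a b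
          = (∑ c, (Lmat V M E φ z j u - 1) a c * ((js.map fun j => Lmat V M E φ z j u).prod - 1) c b) +
            ((Lmat V M E φ z j u - 1) a b + ((js.map fun j => Lmat V M E φ z j u).prod - 1) a b) := by
        intro u
        rw [← Matrix.mul_apply, ← Matrix.add_apply, ← Matrix.add_apply, ← Matrix.sub_apply, List.map_cons, List.prod_cons]
        have h0 : ∀ A B : Matrix (Fin N) (Fin N) (Module.End ℂ M), A * B - 1 = (A - 1) * (B - 1) + ((A - 1) + (B - 1)) := by
          intro A B
          rw [sub_mul, mul_sub, mul_one, one_mul]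
          abel
        rw [h0]
      rw [show (fun u => ((j :: js).map fun j => Lmat V M E φ z j u).prod a b -
        (1 : Matrix (Fin N) (Fin N) (Module.End ℂ M)) a b) = _ from funext h2]
      rw [List.map_cons, List.sum_cons]
      rw [← zero_add (EE V M E φ j b a + _)]
      refine VA_add ?_ (VA_add (hL a b) (ih a b))
      have h3 : VA (-1 + -1) _ _ := VA_sum univ _ _ fun c _ => VA_bilin (LinearMap.mul ℂ (Module.End ℂ M)) (hL a c) (ih c b)
      exact VA_up h3 (by norm_num)
  have h := key (List.finRange n).reverse a b
  have e1 : ((List.finRange n).reverse.map fun j => EE V M E φ j b a).sum = ∑ j, EE V M E φ j b a := by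
    rw [List.map_reverse, List.sum_reverse, ← List.ofFn_eq_map, List.sum_ofFn]
  rw [e1] at h
  simpa only [Tmat, List.ofFn_eq_map, ← List.map_reverse] using h

lemma eventually_good : ∀ᶠ s in 𝓝[≠] (0 : ℂ), Good N z s⁻¹ := by
  have h1 : ∀ j : Fin n, ∀ k : Fin N, ∀ᶠ s in 𝓝[≠] (0 : ℂ), s⁻¹ ≠ z j + (k : ℕ) := by
    intro j k
    exact (tendsto_inv₀_nhdsNE_zero (α := ℂ)).eventually (Bornology.eventually_ne_cobounded _)
  have h2 : ∀ᶠ s in 𝓝[≠] (0 : ℂ), ∀ j : Fin n, ∀ k : Fin N, s⁻¹ ≠ z j + (k : ℕ) := by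
    rw [Filter.eventually_all]; intro j
    rw [Filter.eventually_all]; intro k
    exact h1 j k
  filter_upwards [h2] with s hs j k hk h
  exact hs j ⟨k, hk⟩ (by simp only; linear_combination h)

lemma Xop_eq (a b : Fin N) (f : ℂ → M) (u : ℂ) : Xop V M E φ z 1 a b f u =
    (if a = b then f u else 0) - Tmat V M E φ z u a b (f (u - 1)) := by
  rw [Xop]
  congr 1
  rw [Finset.sum_eq_single a]
  · simp
  · intro c _ hc; simp [Matrix.one_apply_ne' hc]
  · simp

theorem lead_deg [FiniteDimensional ℂ M] (m : Fin N → ℕ) (D : ℕ) (c : ℕ → M)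
    (hcW : ∀ t, c t ∈ SingWt V M E φ (fun b => (m b : ℤ))) (hc0 : ∀ t, D ≤ t → c t = 0)
    (hs : ∀ u, Good N z u → Dop V M E φ z (1 : Matrix (Fin N) (Fin N) ℂ) (fun u : ℂ => ∑ t ∈ range D, u ^ t • c t) u = 0)
    (d : ℕ) (hd : c d ≠ 0) (hd' : ∀ t, d < t → c t = 0) : ∃ a : Fin N, d = m a + (N - 1 - (a : ℕ)) := by
  have hdD : d < D := by
    by_contra h
    exact hd (hc0 d (by omega))
  have hf : VA (d : ℤ) (c d) (fun u : ℂ => ∑ t ∈ range D, u ^ t • c t) := by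
    have h1 : c d = ∑ t ∈ range D, if t = d then c d else 0 := by
      rw [Finset.sum_ite_eq']; simp [hdD]
    rw [h1]
    refine VA_sum _ _ _ fun t _ => ?_
    have h2 : VA ((t : ℤ) + 0) ((1 : ℂ) • c t) (fun u : ℂ => u ^ t • c t) := VA_smul (An_pow t) (VA_const (c t))
    rcases lt_trichotomy t d with h | h | h
    · rw [if_neg h.ne]
      exact VA_up h2 (by omega)
    · subst h
      simpa using h2
    · rw [if_neg h.ne']
      simp only [hd' t h, smul_zero]
      exact fun ℓ => by simpa using An_zero d
  obtain ⟨hw, hk⟩ := (mem_SingWt V M E φ _ _).1 (hcW d)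
  rcases lead (Tmat V M E φ z) (Xop V M E φ z 1) (Xop_eq V M E φ z) (fun a b => ∑ j, EE V M E φ j a b)
    (VA_Tmat V M E φ z) (fun a => (m a : ℂ)) (c d) (fun a => by simpa using hw a) hk _ d hf (by
      filter_upwards [eventually_good (N := N) z] with s hgs
      exact hs _ hgs) with h | ⟨a, ha⟩
  · exact absurd h hd
  · refine ⟨a, ?_⟩
    have ha2 := a.2
    have h1 : ((d : ℤ) : ℂ) = ((m a + (N - 1 - (a : ℕ)) : ℕ) : ℂ) := by
      rw [Nat.cast_add, Nat.sub_sub, Nat.cast_sub (by omega)]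
      push_cast at ha ⊢
      linear_combination ha
    exact_mod_cast h1

lemma Dgen_add (T : ℂ → Matrix (Fin N) (Fin N) (Module.End ℂ M)) (f g : ℂ → M) (u : ℂ) :
    Dgen T (f + g) u = Dgen T f u + Dgen T g u := by
  simp only [Dgen, ← sum_add_distrib]
  refine sum_congr rfl fun I _ => ?_
  have : vac (N := N) ((f + g) (u - #I)) = vac (f (u - #I)) + vac (g (u - #I)) := by
    simp only [vac, Pi.add_apply]; exact Pi.single_add _ _ _
  rw [this, map_add, Pi.add_apply, smul_add]

lemma Dgen_smul (T : ℂ → Matrix (Fin N) (Fin N) (Module.End ℂ M)) (c : ℂ) (f : ℂ → M) (u : ℂ) :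
    Dgen T (c • f) u = c • Dgen T f u := by
  simp only [Dgen, Finset.smul_sum]
  refine sum_congr rfl fun I _ => ?_
  have : vac (N := N) ((c • f) (u - #I)) = c • vac (f (u - #I)) := by
    simp only [vac, Pi.smul_apply]; exact Pi.single_smul _ _ _
  rw [this, map_smul, Pi.smul_apply, smul_comm]

/-- solutions -/
def Sol : Submodule ℂ (ℂ → M) where
  carrier := {f | ∀ u, Good N z u → Dop V M E φ z (1 : Matrix (Fin N) (Fin N) ℂ) f u = 0}
  zero_mem' := by
    intro u _
    rw [Dop_eq]
    have := Dgen_smul M (Tmat V M E φ z) 0 0 u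
    simpa using this
  add_mem' := by
    intro f g hf hg u hu
    have h1 := hf u hu
    have h2 := hg u hu
    rw [Dop_eq] at h1 h2 ⊢
    rw [Dgen_add, h1, h2, add_zero]
  smul_mem' := by
    intro c f hf u hu
    have h1 := hf u hu
    rw [Dop_eq] at h1 ⊢
    rw [Dgen_smul, h1, smul_zero]

theorem sols (hN : 2 ≤ N) [∀ i, FiniteDimensional ℂ (V i)] [FiniteDimensional ℂ M] (Λ : Fin n → Fin N → ℤ)
    (hdom : ∀ i, ∀ a b : Fin N, a ≤ b → Λ i b ≤ Λ i a)
    (hpoly : ∀ i a, 0 ≤ Λ i a) (hrel : GlRel V E) (hhw : IsHW V E Λ) (m : Fin N → ℕ)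
    (ii : Fin N) (v0 : M) (hv0 : v0 ∈ SingWt V M E φ (fun b => (m b : ℤ))) (hv : v0 ≠ 0) :
    ∃ c : ℕ → M, (∀ t, c t ∈ SingWt V M E φ (fun b => (m b : ℤ))) ∧ c (m ii + (N - 1 - (ii : ℕ))) = v0 ∧
      (∀ t, m ii + (N - 1 - (ii : ℕ)) < t → c t = 0) ∧ (∀ j : Fin N, j ≠ ii → c (m j + (N - 1 - (j : ℕ))) = 0) ∧
      (fun u : ℂ => ∑ t ∈ range (m ii + (N - 1 - (ii : ℕ)) + 1), u ^ t • c t) ∈ Sol V M E φ z := by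
  classical
  obtain ⟨bad, hbad⟩ := exists_P hN V M Λ hdom hpoly E hrel hhw φ z
  obtain ⟨x0, hx0⟩ := exists_generic (bad ∪ univ.image z)
  have hgen : ∀ k : Fin N, ∀ b ∈ bad ∪ univ.image z, ∀ j : ℤ, (x0 + (k : ℕ)) + j ≠ b := by
    intro k b hb j
    have := hx0 b hb ((k : ℕ) + j)
    push_cast at this
    rwa [← add_assoc] at this
  choose P hP hvan hc hD hcomm using fun k : Fin N => hbad (x0 + (k : ℕ)) (fun b hb => hgen k b (mem_union_left _ hb))
  refine final_abs (SingWt V M E φ (fun b => (m b : ℤ))) (fun a : Fin N => m a + (N - 1 - (a : ℕ))) (Sol V M E φ z) x0 P hP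
    ?_ hvan hc ?_ ?_ ii v0 hv0 hv
  · intro k u v hv
    rw [mem_SingWt] at hv ⊢
    have hcc : ∀ a b, (∑ j, EE V M E φ j a b) (P k u v) = P k u ((∑ j, EE V M E φ j a b) v) := fun a b =>
      (LinearMap.congr_fun (hcomm k u a b) v).symm
    refine ⟨fun a => ?_, fun a b hab => ?_⟩
    · rw [hcc, hv.1, map_smul]
    · rw [hcc, hv.2 a b hab, map_zero]
  · intro k v _ u hu
    rw [Dop_eq]
    refine Dgen_good V M E φ z (PF_comp (hP k) (LinearMap.applyₗ v)) (x0 + (k : ℕ)) ?_ (fun s hs => hD k s hs v) u hu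
    intro j i
    exact hgen k _ (mem_union_right _ (mem_image_of_mem _ (mem_univ j))) i
  · intro D c hcW hc0 hs d hd hd'
    exact lead_deg V M E φ z m D c hcW hc0 hs d hd hd'

lemma reflect (c : ℕ → M) (L : ℕ) (u : ℂ) :
    ∑ t ∈ range (L + 1), u ^ (L - t) • c (L - t) = ∑ t ∈ range (L + 1), u ^ t • c t := by
  have := Finset.sum_range_reflect (fun t => u ^ t • c t) (L + 1)
  simpa using this

end Fin2
end XXXAux

namespace XXXAux

lemma PF_poly {M : Type*} [AddCommGroup M] [Module ℂ M] (c : ℕ → M) (D : ℕ) :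
    (fun u : ℂ => ∑ t ∈ Finset.range D, u ^ t • c t) ∈ PF M := by
  refine PF_sum _ _ fun t _ => ?_
  simpa using PF_mk (Polynomial.X ^ t) (c t)

end XXXAux

namespace XXXModel

/-- Let `Q` be the identity matrix.  For every `i` (with `ii : Fin N`
encoding `i = ii + 1`) and every nonzero `v₀ ∈ sing M[m]` there is a polynomial
`v₀ u^{m_i+N−i} + v₁ u^{m_i+N−i−1} + … + v_{m_i+N−i}` with all `v_t ∈ sing M[m]` lying in
the kernel of `D_{Q=1,M}(u,τ)` restricted to `sing M[m]`-valued functions; moreover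
`N·dim sing M[m]` polynomials of this form lie in the kernel and are linearly independent
over the field of one-periodic meromorphic functions. -/
theorem statement_10
    {N n : ℕ} (hN : 2 ≤ N) (hn : 1 ≤ n)
    (V : Fin n → Type*) [∀ i, AddCommGroup (V i)] [∀ i, Module ℂ (V i)]
    [∀ i, FiniteDimensional ℂ (V i)]
    (M : Type*) [AddCommGroup M] [Module ℂ M] [FiniteDimensional ℂ M]
    (Λ : Fin n → Fin N → ℤ)
    (hdom : ∀ i, ∀ a b : Fin N, a ≤ b → Λ i b ≤ Λ i a)
    (hpoly : ∀ i a, 0 ≤ Λ i a)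
    (hlast : ∀ i, Λ i ⟨N - 1, by omega⟩ = 0)
    (E : ∀ i : Fin n, Fin N → Fin N → (V i →ₗ[ℂ] V i))
    (hrel : GlRel V E)
    (hhw : IsHW V E Λ)
    (φ : M ≃ₗ[ℂ] PiTensorProduct ℂ V)
    (z : Fin n → ℂ)
    (m : Fin N → ℕ) :
    -- for every `i` and nonzero `v₀ ∈ sing M[m]` there is a polynomial solution of degree
    -- `m_i + N − i` with leading coefficient `v₀`
    (∀ ii : Fin N, ∀ v0 ∈ SingWt V M E φ (fun b => (m b : ℤ)), v0 ≠ 0 →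
      ∃ v : ℕ → M, (∀ t, v t ∈ SingWt V M E φ (fun b => (m b : ℤ))) ∧ v 0 = v0 ∧
        ∀ u : ℂ, Good N z u →
          Dop V M E φ z (1 : Matrix (Fin N) (Fin N) ℂ)
            (fun x => ∑ t ∈ Finset.range (m ii + (N - 1 - (ii : ℕ)) + 1),
              (x ^ (m ii + (N - 1 - (ii : ℕ)) - t)) • v t) u = 0) ∧
    -- such polynomials generate the kernel
    ∃ F : Fin (N * Module.finrank ℂ (SingWt V M E φ (fun b => (m b : ℤ)))) → ℂ → M,
      (∀ t, ∃ (ii : Fin N) (v : ℕ → M),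
        (∀ s, v s ∈ SingWt V M E φ (fun b => (m b : ℤ))) ∧ v 0 ≠ 0 ∧
        F t = fun x => ∑ s ∈ Finset.range (m ii + (N - 1 - (ii : ℕ)) + 1),
          (x ^ (m ii + (N - 1 - (ii : ℕ)) - s)) • v s) ∧
      (∀ t, ∀ u : ℂ, Good N z u →
        Dop V M E φ z (1 : Matrix (Fin N) (Fin N) ℂ) (F t) u = 0) ∧
      IndepPeriodic F := by
  have key := fun (ii : Fin N) (v0 : M) (hv0 : v0 ∈ SingWt V M E φ (fun b => (m b : ℤ))) (hv : v0 ≠ 0) =>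
    XXXAux.sols V M E φ z hN Λ hdom hpoly hrel hhw m ii v0 hv0 hv
  refine ⟨?_, ?_⟩
  · intro ii v0 hv0 hv
    obtain ⟨c, hcW, hc0, _, _, hS⟩ := key ii v0 hv0 hv
    refine ⟨fun t => c (m ii + (N - 1 - (ii : ℕ)) - t), fun t => hcW _, by simpa using hc0, ?_⟩
    rw [show (fun x : ℂ => ∑ t ∈ Finset.range (m ii + (N - 1 - (ii : ℕ)) + 1),
              (x ^ (m ii + (N - 1 - (ii : ℕ)) - t)) • c (m ii + (N - 1 - (ii : ℕ)) - t)) = _ from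
        funext fun x => XXXAux.reflect M c (m ii + (N - 1 - (ii : ℕ))) x]
    exact hS
  · let b := Module.finBasis ℂ (SingWt V M E φ (fun b => (m b : ℤ)))
    have hb : ∀ j, ((b j : SingWt V M E φ (fun b => (m b : ℤ))) : M) ≠ 0 := fun j h =>
      b.ne_zero j (Subtype.ext h)
    choose c hcW hc0 hcbig hcoth hS using fun (p : Fin N × Fin (Module.finrank ℂ (SingWt V M E φ (fun b => (m b : ℤ))))) =>
      key p.1 (b p.2) (b p.2).2 (hb p.2)
    refine ⟨fun t => fun x => ∑ s ∈ Finset.range (m (finProdFinEquiv.symm t).1 + (N - 1 - ((finProdFinEquiv.symm t).1 : ℕ)) + 1),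
      x ^ s • c (finProdFinEquiv.symm t) s, ?_, ?_, ?_⟩
    · intro t
      refine ⟨(finProdFinEquiv.symm t).1, fun s => c (finProdFinEquiv.symm t)
        (m (finProdFinEquiv.symm t).1 + (N - 1 - ((finProdFinEquiv.symm t).1 : ℕ)) - s), fun s => hcW _ _, ?_, ?_⟩
      · show c _ (_ - 0) ≠ 0
        rw [Nat.sub_zero, hc0]
        exact hb _
      · exact funext fun x => (XXXAux.reflect M _ _ x).symm
    · intro t
      exact hS (finProdFinEquiv.symm t)
    · refine XXXAux.indep_periodic _ ?_ ?_
      · intro t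
        exact XXXAux.PF_poly _ _
      · intro α hα
        have h1 : ∀ p, α (finProdFinEquiv p) = 0 := by
          let D := ∑ i : Fin N, (m i + (N - 1 - (i : ℕ)) + 1)
          have hD : ∀ i : Fin N, m i + (N - 1 - (i : ℕ)) + 1 ≤ D := fun i =>
            Finset.single_le_sum (f := fun i : Fin N => m i + (N - 1 - (i : ℕ)) + 1) (fun _ _ => Nat.zero_le _) (Finset.mem_univ i)
          have h2 : ∀ u : ℂ, ∑ t ∈ Finset.range D, u ^ t • (∑ p, α (finProdFinEquiv p) • c p t) = 0 := by
            intro u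
            rw [← hα u, ← Equiv.sum_comp finProdFinEquiv]
            simp only [Equiv.symm_apply_apply, Finset.smul_sum]
            rw [Finset.sum_comm]
            refine Finset.sum_congr rfl fun p _ => ?_
            rw [← Finset.smul_sum, XXXAux.sum_ext_range (c p) _ D (hD p.1) (fun t ht => hcbig p t (by omega)) u, Finset.smul_sum]
            exact Finset.sum_congr rfl fun t _ => smul_comm _ _ _
          rintro ⟨i0, j0⟩
          have h3 := XXXAux.coeff_zero D _ h2 (m i0 + (N - 1 - (i0 : ℕ))) (by have := hD i0; omega)
          rw [Fintype.sum_prod_type, Finset.sum_eq_single i0] at h3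
          · have h4 : ∑ j, α (finProdFinEquiv (i0, j)) • b j = 0 := by
              apply Subtype.ext
              rw [Submodule.coe_sum, Submodule.coe_zero, ← h3]
              refine Finset.sum_congr rfl fun j _ => ?_
              rw [Submodule.coe_smul, hc0 (i0, j)]
            exact Fintype.linearIndependent_iff.1 b.linearIndependent _ h4 j0
          · intro i _ hi
            refine Finset.sum_eq_zero fun j _ => ?_
            rw [hcoth (i, j) i0 (Ne.symm hi), smul_zero]
          · intro h; exact absurd (Finset.mem_univ _) h
        intro t
        have := h1 (finProdFinEquiv.symm t)
        rwa [Equiv.apply_symm_apply] at this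

end XXXModel
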